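/- For every automorphism φ of the free group F_n of finite rank n there exist an ordered free basis (x_1, …, x_n) of F_n, integers r ≥ 0 and s ≥ 0, indices 0 = i_0 < i_1 < ⋯ < i_r with i_r + s ≤ n, and elements y_1, …, y_r, z_1, …, z_s of F_n such that: Fix(φ) = ⟨y_1, …, y_r, z_1, …, z_s⟩; each y_j is not a proper power and y_j ∈ ⟨x_{i_{j−1}+1}, …, x_{i_j}⟩ for j = 1, …, r; and z_k = x_{i_r+k}^{−1} w_k x_{i_r+k} with w_k ∈ ⟨x_1, …, x_{i_r+k−1}⟩ for k = 1, …, s. -/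

import Mathlib

/-- The rank of a subgroup: the minimal cardinality of a generating set.
For subgroups of free groups (which are free by Nielsen–Schreier) this is the
cardinality of a free basis. -/
noncomputable def rk {G : Type*} [Group G] (H : Subgroup G) : Cardinal :=
  ⨅ S : {S : Set G // Subgroup.closure S = H}, Cardinal.mk S.1

/-- A subgroup `H` is inert if `rk (H ⊓ K) ≤ rk K` for every finitely generated `K`. -/
def IsInert {G : Type*} [Group G] (H : Subgroup G) : Prop :=
  ∀ K : Subgroup G, K.FG → rk (H ⊓ K) ≤ rk K

/-- `stage x i` is the subgroup generated by the first `i` elements of `x`. -/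
def stage {n : ℕ} {F : Type*} [Group F] (x : Fin n → F) (i : ℕ) : Subgroup F :=
  Subgroup.closure (x '' {j | (j : ℕ) < i})

/-- `x` is an ordered free basis of `F`. -/
def IsOrderedBasis {n : ℕ} {F : Type*} [Group F] (x : Fin n → F) : Prop :=
  Function.Bijective (FreeGroup.lift x)

/-- `H` is in echelon form with respect to the ordered basis `x`:
`rk (H ⊓ F_i) ≤ rk (H ⊓ F_{i-1}) + 1` for `i = 1, …, n`. -/
def InEchelonForm {n : ℕ} {F : Type*} [Group F] (x : Fin n → F) (H : Subgroup F) : Prop :=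
  ∀ i : ℕ, i < n → rk (H ⊓ stage x (i + 1)) ≤ rk (H ⊓ stage x i) + 1

/-- `H` is an echelon subgroup: it is in echelon form with respect to
some ordered free basis. -/
def IsEchelon {n : ℕ} (H : Subgroup (FreeGroup (Fin n))) : Prop :=
  ∃ x : Fin n → FreeGroup (Fin n), IsOrderedBasis x ∧ InEchelonForm x H

/-- A 1-generator (subgroup) endomorphism: an endomorphism fixing all but (possibly)
one member of some set of free generators. -/
def IsOneGenEndo {G : Type*} [Group G] (φ : G →* G) : Prop :=
  ∃ (ι : Type) (b : FreeGroupBasis ι G) (s : Set ι),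
    s.Subsingleton ∧ ∀ i ∉ s, φ (b i) = b i

/-- The subgroup of points fixed by an endomorphism. -/
def fixedSubgroup {G : Type*} [Group G] (φ : G →* G) : Subgroup G where
  carrier := {g | φ g = g}
  one_mem' := by simp
  mul_mem' := by intro a b ha hb; simp only [Set.mem_setOf_eq, map_mul] at *; rw [ha, hb]
  inv_mem' := by intro a ha; simp only [Set.mem_setOf_eq, map_inv] at *; rw [ha]

/-- An element is primitive if it belongs to some free basis. -/
def IsPrimitive {n : ℕ} (g : FreeGroup (Fin n)) : Prop :=
  ∃ x : Fin n → FreeGroup (Fin n), IsOrderedBasis x ∧ ∃ j, x j = g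

section MVProof
open Filter
set_option linter.all false
set_option linter.unusedSectionVars false
set_option linter.deprecated false

namespace MV

section basics
variable {G : Type} [Group G]

/-- almost (right) invariant sets -/
def AInv (A : Set G) : Prop := ∀ g : G, ∀ᶠ x in cofinite, (x ∈ A ↔ x * g ∈ A)

/-- inclusion up to a finite set -/
def SubF (A B : Set G) : Prop := ∀ᶠ x in cofinite, x ∈ A → x ∈ B

/-- equality up to a finite set -/
def EqF (A B : Set G) : Prop := ∀ᶠ x in cofinite, (x ∈ A ↔ x ∈ B)

/-- both the set and its complement are infinite -/
def Nontriv (A : Set G) : Prop := (∃ᶠ x in cofinite, x ∈ A) ∧ (∃ᶠ x in cofinite, x ∉ A)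

/-- `A` separates the subgroup `P` -/
def Sep (A : Set G) (P : Subgroup G) : Prop :=
  (∃ᶠ x in cofinite, x ∈ A ∧ x ∈ P) ∧ (∃ᶠ x in cofinite, x ∉ A ∧ x ∈ P)

/-- left translate -/
def ltr (g : G) (A : Set G) : Set G := {x | g⁻¹ * x ∈ A}

/-- image under an automorphism -/
def img {H : Type} [Group H] (e : G ≃* H) (A : Set G) : Set H := {x | e.symm x ∈ A}

@[simp] lemma mem_ltr {g x : G} {A : Set G} : x ∈ ltr g A ↔ g⁻¹ * x ∈ A := Iff.rfl
@[simp] lemma mem_img {H : Type} [Group H] {e : G ≃* H} {x : H} {A : Set G} :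
    x ∈ img e A ↔ e.symm x ∈ A := Iff.rfl

lemma ev_left {p : G → Prop} (g : G) (h : ∀ᶠ x in cofinite, p x) :
    ∀ᶠ x in cofinite, p (g * x) :=
  (mul_right_injective g).tendsto_cofinite.eventually h

lemma ev_right {p : G → Prop} (g : G) (h : ∀ᶠ x in cofinite, p x) :
    ∀ᶠ x in cofinite, p (x * g) :=
  (mul_left_injective g).tendsto_cofinite.eventually h

lemma ev_left_iff {p : G → Prop} (g : G) :
    (∀ᶠ x in cofinite, p (g * x)) ↔ ∀ᶠ x in cofinite, p x :=
  ⟨fun h => by simpa using ev_left g⁻¹ h, ev_left g⟩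

lemma ev_equiv {H : Type} {p : H → Prop} (e : G ≃ H) :
    (∀ᶠ x in cofinite, p (e x)) ↔ ∀ᶠ x in cofinite, p x := by
  constructor
  · intro h
    simpa using e.symm.injective.tendsto_cofinite.eventually h
  · intro h
    exact e.injective.tendsto_cofinite.eventually h

lemma AInv.compl {A : Set G} (h : AInv A) : AInv Aᶜ := fun g => by
  filter_upwards [h g] with x hx
  simp only [Set.mem_compl_iff]; tauto

lemma AInv.inter {A B : Set G} (h : AInv A) (h' : AInv B) : AInv (A ∩ B) := fun g => by
  filter_upwards [h g, h' g] with x hx hy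
  simp only [Set.mem_inter_iff]; tauto

lemma AInv.union {A B : Set G} (h : AInv A) (h' : AInv B) : AInv (A ∪ B) := fun g => by
  filter_upwards [h g, h' g] with x hx hy
  simp only [Set.mem_union]; tauto

lemma AInv.diff {A B : Set G} (h : AInv A) (h' : AInv B) : AInv (A \ B) := fun g => by
  filter_upwards [h g, h' g] with x hx hy
  simp only [Set.mem_diff]; tauto

lemma AInv.ltr {A : Set G} (h : AInv A) (g : G) : AInv (ltr g A) := fun k => by
  filter_upwards [ev_left g⁻¹ (h k)] with x hx
  simpa [mul_assoc] using hx

lemma AInv.img {H : Type} [Group H] {A : Set G} (h : AInv A) (e : G ≃* H) :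
    AInv (img e A) := fun k => by
  filter_upwards [(ev_equiv e.symm.toEquiv).2 (h (e.symm k))] with x hx
  simpa [mul_assoc] using hx

lemma AInv.congr {A B : Set G} (h : AInv A) (hAB : EqF A B) : AInv B := fun g => by
  filter_upwards [h g, hAB, ev_right g hAB] with x h1 h2 h3
  tauto

lemma ainv_univ : AInv (Set.univ : Set G) := fun g => by simp
lemma ainv_empty : AInv (∅ : Set G) := fun g => by simp

lemma EqF.symm {A B : Set G} (h : EqF A B) : EqF B A := h.mono fun _ => Iff.symm
lemma EqF.refl (A : Set G) : EqF A A := Eventually.of_forall fun _ => Iff.rfl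
lemma EqF.trans {A B C : Set G} (h : EqF A B) (h' : EqF B C) : EqF A C := by
  filter_upwards [h, h'] with x h1 h2; tauto
lemma SubF.refl (A : Set G) : SubF A A := Eventually.of_forall fun _ => id
lemma SubF.trans {A B C : Set G} (h : SubF A B) (h' : SubF B C) : SubF A C := by
  filter_upwards [h, h'] with x h1 h2; tauto
lemma SubF.antisymm {A B : Set G} (h : SubF A B) (h' : SubF B A) : EqF A B := by
  filter_upwards [h, h'] with x h1 h2; tauto
lemma EqF.subF {A B : Set G} (h : EqF A B) : SubF A B := h.mono fun _ => Iff.mp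
lemma SubF.of_subset {A B : Set G} (h : A ⊆ B) : SubF A B := Eventually.of_forall fun _ hx => h hx

lemma EqF.ltr {A B : Set G} (h : EqF A B) (g : G) : EqF (ltr g A) (ltr g B) :=
  ev_left g⁻¹ h
lemma EqF.img {H : Type} [Group H] {A B : Set G} (h : EqF A B) (e : G ≃* H) :
    EqF (img e A) (img e B) := (ev_equiv e.symm.toEquiv).2 h
lemma SubF.ltr {A B : Set G} (h : SubF A B) (g : G) : SubF (ltr g A) (ltr g B) :=
  ev_left g⁻¹ h
lemma SubF.img {H : Type} [Group H] {A B : Set G} (h : SubF A B) (e : G ≃* H) :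
    SubF (img e A) (img e B) := (ev_equiv e.symm.toEquiv).2 h

lemma ltr_ltr (g h : G) (A : Set G) : ltr g (ltr h A) = ltr (g * h) A := by
  ext x; simp [mul_assoc]
lemma ltr_one (A : Set G) : ltr 1 A = A := by ext x; simp
lemma ltr_compl (g : G) (A : Set G) : ltr g Aᶜ = (ltr g A)ᶜ := rfl
lemma img_compl {H : Type} [Group H] (e : G ≃* H) (A : Set G) : img e Aᶜ = (img e A)ᶜ := rfl
lemma img_img {H K : Type} [Group H] [Group K] (e : G ≃* H) (f : H ≃* K) (A : Set G) :
    img f (img e A) = img (e.trans f) A := rfl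
lemma img_ltr {H : Type} [Group H] (e : G ≃* H) (g : G) (A : Set G) :
    img e (ltr g A) = ltr (e g) (img e A) := by
  ext x; simp
lemma img_mul (e f : MulAut G) (A : Set G) : img (e * f) A = img e (img f A) := by
  ext x; rfl
lemma img_one (A : Set G) : img (1 : MulAut G) A = A := by
  ext x; rfl

lemma Nontriv.compl {A : Set G} (h : Nontriv A) : Nontriv Aᶜ := by
  refine ⟨h.2, ?_⟩; simpa using h.1

lemma Nontriv.congr {A B : Set G} (h : Nontriv A) (hAB : EqF A B) : Nontriv B := by
  constructor
  · intro h0; apply h.1; filter_upwards [h0, hAB] with x; tauto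
  · intro h0; apply h.2; filter_upwards [h0, hAB] with x; tauto

lemma Nontriv.ltr {A : Set G} (h : Nontriv A) (g : G) : Nontriv (ltr g A) := by
  constructor
  · intro h0; apply h.1
    have := ev_left g h0
    simpa using this
  · intro h0; apply h.2
    have := ev_left g h0
    simpa using this

lemma Nontriv.img {H : Type} [Group H] {A : Set G} (h : Nontriv A) (e : G ≃* H) :
    Nontriv (img e A) := by
  constructor
  · intro h0; apply h.1
    have := (ev_equiv e.toEquiv).2 h0
    simpa using this
  · intro h0; apply h.2
    have := (ev_equiv e.toEquiv).2 h0
    simpa using this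

lemma Sep.compl {A : Set G} {P : Subgroup G} (h : Sep A P) : Sep Aᶜ P := by
  refine ⟨h.2, ?_⟩; simpa using h.1

lemma sep_compl {A : Set G} {P : Subgroup G} : Sep Aᶜ P ↔ Sep A P :=
  ⟨fun h => by simpa using h.compl, Sep.compl⟩

lemma Sep.congr {A B : Set G} {P : Subgroup G} (h : Sep A P) (hAB : EqF A B) : Sep B P := by
  constructor
  · intro h0; apply h.1; filter_upwards [h0, hAB] with x; tauto
  · intro h0; apply h.2; filter_upwards [h0, hAB] with x; tauto

lemma sep_congr {A B : Set G} {P : Subgroup G} (hAB : EqF A B) : Sep A P ↔ Sep B P :=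
  ⟨fun h => h.congr hAB, fun h => h.congr hAB.symm⟩

lemma Sep.nontriv {A : Set G} {P : Subgroup G} (h : Sep A P) : Nontriv A :=
  ⟨h.1.mono fun _ h => h.1, h.2.mono fun _ h => h.1⟩

/-- alternative when not separated -/
lemma not_sep {A : Set G} {P : Subgroup G} (h : ¬ Sep A P) :
    (∀ᶠ x in cofinite, x ∈ P → x ∉ A) ∨ (∀ᶠ x in cofinite, x ∈ P → x ∈ A) := by
  by_contra h0
  push Not at h0
  apply h
  refine ⟨?_, ?_⟩
  · intro h1; apply h0.1; filter_upwards [h1] with x; tauto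
  · intro h1; apply h0.2; filter_upwards [h1] with x; tauto

/-- `AInv` sets see conjugate translation -/
lemma sep_ltr {A : Set G} (hA : AInv A) {P Q : Subgroup G} (g : G)
    (hPQ : ∀ x, x ∈ Q ↔ g⁻¹ * x * g ∈ P) : Sep (ltr g A) Q ↔ Sep A P := by
  have key : ∀ q : Prop → Prop, (∃ᶠ x in cofinite, q (x ∈ ltr g A) ∧ x ∈ Q) ↔
      ∃ᶠ x in cofinite, q (x ∈ A) ∧ x ∈ P := by
    intro q
    rw [not_iff_not.symm, not_frequently, not_frequently]
    constructor
    · intro h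
      have h1 := ev_left g (ev_right g⁻¹ h)
      filter_upwards [h1, hA g⁻¹] with x hx hx2
      simp only [mem_ltr, hPQ, mul_assoc, inv_mul_cancel_left, inv_mul_cancel, mul_one] at hx
      rw [← hx2] at hx; exact hx
    · intro h
      have h1 := ev_left g⁻¹ (ev_right g h)
      have h2 := ev_left g⁻¹ (hA g)
      filter_upwards [h1, h2] with x hx hx2
      simp only [mem_ltr, hPQ]
      rw [hx2]; exact hx
  exact and_congr (key id) (key Not)

lemma sep_img {H : Type} [Group H] {A : Set G} {P : Subgroup G} {Q : Subgroup H} (e : G ≃* H)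
    (hPQ : ∀ x, x ∈ Q ↔ e.symm x ∈ P) : Sep (img e A) Q ↔ Sep A P := by
  have key : ∀ q : Prop → Prop, (∃ᶠ x in cofinite, q (x ∈ img e A) ∧ x ∈ Q) ↔
      ∃ᶠ x in cofinite, q (x ∈ A) ∧ x ∈ P := by
    intro q
    rw [not_iff_not.symm, not_frequently, not_frequently, ← ev_equiv e.toEquiv]
    simp [hPQ]
  exact and_congr (key id) (key Not)

/-- An `AInv` set is moved finitely by right translation. -/
lemma AInv.conj_eqF {A : Set G} (hA : AInv A) (g : G) :
    EqF (MV.img (MulAut.conj g) A) (MV.ltr g A) := by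
  have h2 := ev_left g⁻¹ (hA g)
  filter_upwards [h2] with x hx
  simp only [mem_img, mem_ltr, MulAut.conj_symm_apply]
  exact hx.symm

lemma sub_or {A B : Set G} (h : ¬ Nontriv (A \ B) ) (hn : ∃ᶠ x in cofinite, x ∉ A) : SubF A B := by
  by_contra h0
  apply h
  refine ⟨fun h1 => h0 ?_, hn.mono fun x hx h => hx h.1⟩
  filter_upwards [h1] with x hx h2
  by_contra h3; exact hx ⟨h2, h3⟩

end basics

section stab
variable {G : Type} [Group G] [IsMulTorsionFree G]

lemma pow_root_commute {a b : G} {k : ℕ} (hk : k ≠ 0) (h : Commute (a ^ k) b) : Commute a b := by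
  have h1 : (b * a * b⁻¹) ^ k = a ^ k := by
    rw [conj_pow]; rw [← h.eq]; simp
  have h2 := pow_left_injective hk h1
  exact (mul_inv_eq_iff_eq_mul.1 h2).symm

/-- **Stabilizer lemma.** -/
theorem stab_lemma (hnc : ∃ a b : G, a * b ≠ b * a) {A : Set G} (hA : AInv A) (hn : Nontriv A)
    {y : G} (hy : ∀ᶠ x in cofinite, (x ∈ A ↔ y * x ∈ A)) : y = 1 := by
  by_contra hy1
  set K : Set G := {x | ¬ (x ∈ A ↔ y * x ∈ A)} with hK
  have hKf : K.Finite := hy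
  have hinj : ∀ a : G, Function.Injective (fun n : ℤ => y ^ n * a) := by
    intro a m n h
    exact injective_zpow_iff_not_isOfFinOrder.2 (not_isOfFinOrder_of_isMulTorsionFree hy1) (mul_right_cancel h)
  -- orbit lemma
  have orb : ∀ (x : G) (n : ℕ), ¬ (x ∈ A ↔ y ^ n * x ∈ A) → ∃ i : ℤ, y ^ i * x ∈ K := by
    intro x n hx
    by_contra! hcon
    apply hx
    clear hx
    induction n with
    | zero => simp
    | succ n ih =>
      rw [ih]
      have := hcon n
      simp only [hK, Set.mem_setOf_eq, not_not] at this
      rw [zpow_natCast, ← mul_assoc, ← pow_succ'] at this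
      exact this
  have orb' : ∀ (x : G) (n : ℕ), ¬ (x ∈ A ↔ y ^ (-(n : ℤ)) * x ∈ A) → ∃ i : ℤ, y ^ i * x ∈ K := by
    intro x n hx
    obtain ⟨i, hi⟩ := orb (y ^ (-(n : ℤ)) * x) n (by
      rw [← mul_assoc, ← zpow_natCast, ← zpow_add]
      simp only [add_neg_cancel, zpow_zero, one_mul]; tauto)
    refine ⟨i + -n, ?_⟩
    rwa [zpow_add, mul_assoc]
  -- eventual constancy
  have evp : (∀ᶠ n : ℕ in atTop, y ^ (n : ℤ) ∈ A) ∨ (∀ᶠ n : ℕ in atTop, y ^ (n : ℤ) ∉ A) := by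
    have h1 : ∀ᶠ n : ℕ in atTop, y ^ (n : ℤ) ∉ K := by
      rw [← Nat.cofinite_eq_atTop]
      have : Function.Injective (fun n : ℕ => y ^ (n : ℤ)) := fun a b h => by
        have := @hinj 1 a b (by simpa using h); exact_mod_cast this
      exact this.tendsto_cofinite.eventually (hKf.compl_mem_cofinite)
    obtain ⟨N, hN⟩ := eventually_atTop.1 h1
    have h2 : ∀ n ≥ N, (y ^ (n : ℤ) ∈ A ↔ y ^ (N : ℤ) ∈ A) := by
      intro n hn
      induction n, hn using Nat.le_induction with
      | base => rfl
      | succ n hn ih =>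
        have := hN n hn
        simp only [hK, Set.mem_setOf_eq, not_not] at this
        rw [← ih, this]
        push_cast
        rw [add_comm, zpow_add, zpow_one]
    by_cases h : y ^ (N : ℤ) ∈ A
    · left; filter_upwards [eventually_ge_atTop N] with n hn using (h2 n hn).2 h
    · right; filter_upwards [eventually_ge_atTop N] with n hn using fun h' => h ((h2 n hn).1 h')
  have evm : (∀ᶠ n : ℕ in atTop, y ^ (-(n : ℤ)) ∈ A) ∨ (∀ᶠ n : ℕ in atTop, y ^ (-(n : ℤ)) ∉ A) := by
    have h1 : ∀ᶠ n : ℕ in atTop, y ^ (-(n : ℤ)) ∉ K := by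
      rw [← Nat.cofinite_eq_atTop]
      have : Function.Injective (fun n : ℕ => y ^ (-(n : ℤ))) := fun a b h => by
        have := @hinj 1 (-a) (-b) (by simpa using h); simpa using this
      exact this.tendsto_cofinite.eventually (hKf.compl_mem_cofinite)
    obtain ⟨N, hN⟩ := eventually_atTop.1 h1
    have h2 : ∀ n ≥ N, (y ^ (-(n : ℤ)) ∈ A ↔ y ^ (-(N : ℤ)) ∈ A) := by
      intro n hn
      induction n, hn using Nat.le_induction with
      | base => rfl
      | succ n hn ih =>
        have := hN (n + 1) (by omega)
        simp only [hK, Set.mem_setOf_eq, not_not] at this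
        rw [← ih, this]
        push_cast
        rw [neg_add, zpow_add, zpow_neg_one]
        have : y * (y ^ (-(n : ℤ)) * y⁻¹) = y ^ (-(n : ℤ)) := by
          rw [← mul_assoc, ← zpow_one_add, ← zpow_sub_one]; congr 1; ring
        rw [this]
    by_cases h : y ^ (-(N : ℤ)) ∈ A
    · left; filter_upwards [eventually_ge_atTop N] with n hn using (h2 n hn).2 h
    · right; filter_upwards [eventually_ge_atTop N] with n hn using fun h' => h ((h2 n hn).1 h')
  have indep : ∀ a : G, ∀ᶠ n : ℤ in cofinite, (y ^ n ∈ A ↔ y ^ n * a ∈ A) := by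
    intro a
    have : Function.Injective (fun n : ℤ => y ^ n) := fun p q h => @hinj 1 p q (by simpa using h)
    exact this.tendsto_cofinite.eventually (hA a)
  have indp : ∀ a : G, ∀ᶠ n : ℕ in atTop, (y ^ (n : ℤ) ∈ A ↔ y ^ (n : ℤ) * a ∈ A) := by
    intro a
    rw [← Nat.cofinite_eq_atTop]
    exact (Nat.cast_injective (R := ℤ)).tendsto_cofinite.eventually (indep a)
  have indm : ∀ a : G, ∀ᶠ n : ℕ in atTop, (y ^ (-(n : ℤ)) ∈ A ↔ y ^ (-(n : ℤ)) * a ∈ A) := by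
    intro a
    rw [← Nat.cofinite_eq_atTop]
    have : Function.Injective (fun n : ℕ => -(n : ℤ)) := fun a b h => by simpa using h
    exact this.tendsto_cofinite.eventually (indep a)
  -- two same ends
  have same : ∀ q : Prop → Prop, (∀ p, q p ↔ p) ∨ (∀ p, q p ↔ ¬ p) →
      (∀ᶠ n : ℕ in atTop, q (y ^ (n : ℤ) ∈ A)) → (∀ᶠ n : ℕ in atTop, q (y ^ (-(n : ℤ)) ∈ A)) →
      ∀ᶠ x in cofinite, q (x ∈ A) := by
    intro q hq h1 h2
    have hf : ∀ k : G, {i : ℤ | ¬ q (y ^ i * k ∈ A)}.Finite := by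
      intro k
      change ∀ᶠ i : ℤ in cofinite, q (y ^ i * k ∈ A)
      have h3 : ∀ᶠ i : ℤ in cofinite, q (y ^ i ∈ A) := by
        rw [Int.cofinite_eq, eventually_sup]
        constructor
        · obtain ⟨N, hN⟩ := eventually_atTop.1 h2
          rw [eventually_atBot]
          refine ⟨-N, fun b hb => ?_⟩
          have := hN (-b).toNat (by omega)
          rwa [Int.toNat_of_nonneg (by omega), neg_neg] at this
        · obtain ⟨N, hN⟩ := eventually_atTop.1 h1
          rw [eventually_atTop]
          refine ⟨N, fun b hb => ?_⟩
          have := hN b.toNat (by omega)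
          rwa [Int.toNat_of_nonneg (by omega)] at this
      filter_upwards [indep k, h3] with i hi hi2
      rwa [hi] at hi2
    have hfin : (⋃ k ∈ K, (fun i : ℤ => y ^ i * k) '' {i : ℤ | ¬ q (y ^ i * k ∈ A)}).Finite :=
      hKf.biUnion fun k _ => (hf k).image _
    refine hfin.subset ?_
    intro x hx
    have hx : ¬ q (x ∈ A) := hx
    obtain ⟨n, hn1, hn2⟩ := ((indp x).and h1).exists
    rw [hn1] at hn2
    obtain ⟨i, hi⟩ := orb x n (by
      rw [← zpow_natCast]
      rcases hq with hq | hq <;> rw [hq] at hx hn2 <;> tauto)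
    simp only [Set.mem_iUnion, Set.mem_image]
    have e : y ^ (-i) * (y ^ i * x) = x := by rw [← mul_assoc, ← zpow_add]; simp
    exact ⟨y ^ i * x, hi, -i, by simpa only [Set.mem_setOf_eq, e] using hx, e⟩
  have diffc : (∃ᶠ n : ℕ in atTop, ¬ (y ^ (n : ℤ) ∈ A ↔ y ^ (-(n : ℤ)) ∈ A)) → False := by
    intro hd
    have cov : ∀ x : G, ∃ i : ℤ, y ^ i * x ∈ K := by
      intro x
      obtain ⟨n, hn, h1, h2⟩ := (hd.and_eventually ((indp x).and (indm x))).exists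
      rw [h1, h2] at hn
      by_cases h3 : (x ∈ A ↔ y ^ n * x ∈ A)
      · apply orb' x n
        intro h4; apply hn
        rw [zpow_natCast, ← h3, ← h4]
      · exact orb x n h3
    have root : ∀ a : G, ∃ k : ℕ, k ≠ 0 ∧ ∃ p : ℤ, a ^ k = y ^ p := by
      intro a
      choose i hi using cov
      obtain ⟨s, t, hst, h⟩ := hKf.exists_lt_map_eq_of_forall_mem (f := fun n : ℕ => y ^ (i (a ^ n)) * a ^ n)
        (fun n => hi _)
      refine ⟨t - s, by omega, -i (a ^ t) + i (a ^ s), ?_⟩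
      have h5 : a ^ t = a ^ (t - s) * a ^ s := by rw [← pow_add]; congr 1; omega
      rw [zpow_add, zpow_neg, eq_inv_mul_iff_mul_eq]
      apply mul_right_cancel (b := a ^ s)
      rw [mul_assoc, ← h5]; exact h.symm
    obtain ⟨a, b, hab⟩ := hnc
    obtain ⟨k, hk, p, hp⟩ := root a
    obtain ⟨l, hl, q, hq⟩ := root b
    have : Commute (a ^ k) (b ^ l) := by
      rw [hp, hq]; exact Commute.zpow_zpow_self y p q
    have h1 := pow_root_commute hk this
    exact hab (pow_root_commute hl h1.symm).symm
  rcases evp with h1 | h1 <;> rcases evm with h2 | h2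
  · exact hn.2 (by simpa using same id (Or.inl fun _ => Iff.rfl) h1 h2)
  · exact diffc (h1.and h2 |>.mono fun n h => by tauto).frequently
  · exact diffc (h1.and h2 |>.mono fun n h => by tauto).frequently
  · exact hn.1 (same Not (Or.inr fun _ => Iff.rfl) h1 h2)

end stab

end MV


namespace MV

lemma ncard_two {α : Type} {X Y Z W : Set α} (hZ : Z.Finite) (hW : W.Finite)
    (h1 : X ∪ Y ⊆ Z ∪ W) (h2 : X ∩ Y ⊆ Z ∩ W) : X.ncard + Y.ncard ≤ Z.ncard + W.ncard := by
  have hu := (hZ.union hW)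
  have hX : X.Finite := hu.subset (fun x hx => h1 (Or.inl hx))
  have hY : Y.Finite := hu.subset (fun x hx => h1 (Or.inr hx))
  rw [← Set.ncard_union_add_ncard_inter X Y hX hY, ← Set.ncard_union_add_ncard_inter Z W hZ hW]
  exact add_le_add (Set.ncard_le_ncard h1 hu) (Set.ncard_le_ncard h2 (hZ.inter_of_left _))

lemma ncard_two_lt {α : Type} {X Y Z W : Set α} (hZ : Z.Finite) (hW : W.Finite)
    (h1 : X ∪ Y ⊆ Z ∪ W) (h2 : X ∩ Y ⊆ Z ∩ W) {e : α} (heZ : e ∈ Z) (heW : e ∈ W)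
    (heX : e ∉ X) (heY : e ∉ Y) : X.ncard + Y.ncard + 2 ≤ Z.ncard + W.ncard := by
  have h := ncard_two (X := X) (Y := Y) (Z := Z \ {e}) (W := W \ {e}) (hZ.diff) (hW.diff)
    (by intro x hx
        have := h1 hx
        have hne : x ≠ e := by rintro rfl; exact hx.elim heX heY
        rcases this with h | h
        · exact Or.inl ⟨h, hne⟩
        · exact Or.inr ⟨h, hne⟩)
    (by intro x hx
        have := h2 hx
        have hne : x ≠ e := by rintro rfl; exact heX hx.1
        exact ⟨⟨this.1, hne⟩, ⟨this.2, hne⟩⟩)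
  have h3 := Set.ncard_diff_singleton_add_one heZ hZ
  have h4 := Set.ncard_diff_singleton_add_one heW hW
  omega

section
variable {F : Type} [Group F]

lemma sep_diff_or {A B : Set F} {P : Subgroup F} (h : Sep (A \ B) P) : Sep A P ∨ Sep B P := by
  by_contra h0
  push Not at h0
  rcases not_sep h0.1 with hA | hA <;> rcases not_sep h0.2 with hB | hB
  · apply h.1; filter_upwards [hA] with x hx; simp only [Set.mem_diff]; tauto
  · apply h.1; filter_upwards [hA] with x hx; simp only [Set.mem_diff]; tauto
  · apply h.2; filter_upwards [hA, hB] with x hx; simp only [Set.mem_diff]; tauto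
  · apply h.1; filter_upwards [hB] with x hx; simp only [Set.mem_diff]; tauto

lemma sep_diff_and {A B : Set F} {P : Subgroup F} (h : Sep (A \ B) P) (h' : Sep (B \ A) P) :
    Sep A P ∧ Sep B P :=
  ⟨⟨h.1.mono fun x hx => ⟨hx.1.1, hx.2⟩, h'.1.mono fun x hx => ⟨hx.1.2, hx.2⟩⟩,
    ⟨h'.1.mono fun x hx => ⟨hx.1.1, hx.2⟩, h.1.mono fun x hx => ⟨hx.1.2, hx.2⟩⟩⟩

lemma sep_inter_or {A B : Set F} {P : Subgroup F} (h : Sep (A ∩ B) P) : Sep A P ∨ Sep B P := by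
  have : A ∩ B = A \ Bᶜ := by ext; simp
  rw [this] at h
  rcases sep_diff_or h with h | h
  · exact Or.inl h
  · exact Or.inr (sep_compl.1 h)

lemma sep_union_or {A B : Set F} {P : Subgroup F} (h : Sep (A ∪ B) P) : Sep A P ∨ Sep B P := by
  have : A ∪ B = (Aᶜ ∩ Bᶜ)ᶜ := by ext; simp [Set.compl_inter]
  rw [this, sep_compl] at h
  rcases sep_inter_or h with h | h
  · exact Or.inl (sep_compl.1 h)
  · exact Or.inr (sep_compl.1 h)

lemma sep_inter_union {A B : Set F} {P : Subgroup F} (h : Sep (A ∩ B) P) (h' : Sep (A ∪ B) P) :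
    Sep A P ∧ Sep B P :=
  ⟨⟨h.1.mono fun x hx => ⟨hx.1.1, hx.2⟩, h'.2.mono fun x hx => ⟨fun h => hx.1 (Or.inl h), hx.2⟩⟩,
    ⟨h.1.mono fun x hx => ⟨hx.1.2, hx.2⟩, h'.2.mono fun x hx => ⟨fun h => hx.1 (Or.inr h), hx.2⟩⟩⟩

/-- A system of subgroups, equivariant under conjugation, with finite separation numbers. -/
structure HSys (F : Type) [Group F] (Ω : Type) [MulAction F Ω] where
  P : Ω → Subgroup F
  equiv : ∀ (g : F) (ω : Ω) (x : F), x ∈ P (g • ω) ↔ g⁻¹ * x * g ∈ P ω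
  fin : ∀ A : Set F, AInv A → {ω | Sep A (P ω)}.Finite

namespace HSys
variable {Ω : Type} [MulAction F Ω] (S : HSys F Ω)

/-- elements separated by a set -/
def sep (A : Set F) : Set Ω := {ω | Sep A (S.P ω)}

/-- separation number -/
noncomputable def c (A : Set F) : ℕ := (S.sep A).ncard

/-- minimal nontrivial sets -/
def Min (A : Set F) : Prop := AInv A ∧ Nontriv A ∧ ∀ B, AInv B → Nontriv B → S.c A ≤ S.c B

variable {S}
lemma mem_sep {A : Set F} {ω : Ω} : ω ∈ S.sep A ↔ Sep A (S.P ω) := Iff.rfl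

lemma sep_fin {A : Set F} (h : AInv A) : (S.sep A).Finite := S.fin A h

lemma sep_compl' (A : Set F) : S.sep Aᶜ = S.sep A := by ext ω; exact MV.sep_compl

lemma c_compl (A : Set F) : S.c Aᶜ = S.c A := by rw [c, c, sep_compl']

lemma sep_congr' {A B : Set F} (h : EqF A B) : S.sep A = S.sep B := by
  ext ω; exact MV.sep_congr h

lemma c_congr {A B : Set F} (h : EqF A B) : S.c A = S.c B := by rw [c, c, sep_congr' h]

lemma smul_mem_sep {A : Set F} (h : AInv A) (g : F) (ω : Ω) :
    g • ω ∈ S.sep (ltr g A) ↔ ω ∈ S.sep A := sep_ltr h g (S.equiv g ω)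

lemma mem_sep_ltr {A : Set F} (h : AInv A) (g : F) (ω : Ω) :
    ω ∈ S.sep (ltr g A) ↔ g⁻¹ • ω ∈ S.sep A := by
  rw [← smul_mem_sep h g, smul_inv_smul]

lemma sep_ltr_image {A : Set F} (h : AInv A) (g : F) :
    S.sep (ltr g A) = (fun ω => g • ω) '' S.sep A := by
  ext ω
  rw [mem_sep_ltr h]
  constructor
  · intro h; exact ⟨_, h, by simp⟩
  · rintro ⟨x, hx, rfl⟩; simpa using hx

lemma c_ltr {A : Set F} (h : AInv A) (g : F) : S.c (ltr g A) = S.c A := by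
  rw [c, c, sep_ltr_image h, Set.ncard_image_of_injective _ (MulAction.injective g)]

lemma c_diff {A B : Set F} (hA : AInv A) (hB : AInv B) :
    S.c (A \ B) + S.c (B \ A) ≤ S.c A + S.c B := by
  apply ncard_two (sep_fin hA) (sep_fin hB)
  · rintro ω (h | h)
    · exact sep_diff_or h
    · exact (sep_diff_or h).symm
  · rintro ω ⟨h1, h2⟩; exact sep_diff_and h1 h2

lemma c_inter_union {A B : Set F} (hA : AInv A) (hB : AInv B) :
    S.c (A ∩ B) + S.c (A ∪ B) ≤ S.c A + S.c B := by
  apply ncard_two (sep_fin hA) (sep_fin hB)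
  · rintro ω (h | h)
    · exact sep_inter_or h
    · exact sep_union_or h
  · rintro ω ⟨h1, h2⟩; exact sep_inter_union h1 h2

lemma Min.compl {A : Set F} (h : S.Min A) : S.Min Aᶜ :=
  ⟨h.1.compl, h.2.1.compl, by rw [c_compl]; exact h.2.2⟩

lemma Min.congr {A B : Set F} (h : S.Min A) (hAB : EqF A B) : S.Min B :=
  ⟨h.1.congr hAB, h.2.1.congr hAB, by rw [← c_congr hAB]; exact h.2.2⟩

lemma Min.ltr {A : Set F} (h : S.Min A) (g : F) : S.Min (ltr g A) :=
  ⟨h.1.ltr g, h.2.1.ltr g, by rw [c_ltr h.1]; exact h.2.2⟩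

lemma Min.c_eq {A B : Set F} (h : S.Min A) (h' : S.Min B) : S.c A = S.c B :=
  le_antisymm (h.2.2 _ h'.1 h'.2.1) (h'.2.2 _ h.1 h.2.1)

lemma Min.of_le {A B : Set F} (h : S.Min A) (hB : AInv B) (hn : Nontriv B) (hc : S.c B ≤ S.c A) :
    S.Min B := ⟨hB, hn, fun C h1 h2 => hc.trans (h.2.2 C h1 h2)⟩

lemma exists_min (h : ∃ A : Set F, AInv A ∧ Nontriv A) : ∃ A, S.Min A := by
  obtain ⟨A, hA⟩ := h
  let T : Set ℕ := {n | ∃ A : Set F, AInv A ∧ Nontriv A ∧ S.c A = n}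
  have hT : T.Nonempty := ⟨_, A, hA.1, hA.2, rfl⟩
  obtain ⟨B, h1, h2, h3⟩ := Nat.sInf_mem hT
  exact ⟨B, h1, h2, fun C hC hC' => by rw [h3]; exact Nat.sInf_le ⟨C, hC, hC', rfl⟩⟩

/-- the trace lemma -/
lemma Min.chain_aux {A B : Set F} (hA : S.Min A) (hB : S.Min B) {E : Ω} (hE : Sep A (S.P E))
    (ht : ∀ᶠ x in cofinite, x ∈ S.P E → (x ∈ A ↔ x ∈ B)) :
    S.c (A \ B) + S.c (B \ A) + 2 ≤ S.c A + S.c B := by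
  have hE' : Sep B (S.P E) := by
    constructor
    · intro h0; apply hE.1; filter_upwards [h0, ht] with x; tauto
    · intro h0; apply hE.2; filter_upwards [h0, ht] with x; tauto
  apply ncard_two_lt (sep_fin hA.1) (sep_fin hB.1) (e := E)
  · rintro ω (h | h)
    · exact sep_diff_or h
    · exact (sep_diff_or h).symm
  · rintro ω ⟨h1, h2⟩; exact sep_diff_and h1 h2
  · exact hE
  · exact hE'
  · intro h; apply h.1; filter_upwards [ht] with x; simp only [Set.mem_diff]; tauto
  · intro h; apply h.1; filter_upwards [ht] with x; simp only [Set.mem_diff]; tauto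

lemma Min.chain {A B : Set F} (hA : S.Min A) (hB : S.Min B) {E : Ω} (hE : Sep A (S.P E))
    (ht : ∀ᶠ x in cofinite, x ∈ S.P E → (x ∈ A ↔ x ∈ B)) : SubF A B ∨ SubF B A := by
  have h := hA.chain_aux hB hE ht
  by_contra h0
  push Not at h0
  have h1 : Nontriv (A \ B) := by by_contra h; exact h0.1 (sub_or h hA.2.1.2)
  have h2 : Nontriv (B \ A) := by by_contra h; exact h0.2 (sub_or h hB.2.1.2)
  have h3 := hA.2.2 _ (hA.1.diff hB.1) h1
  have h4 := hB.2.2 _ (hB.1.diff hA.1) h2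
  omega

end HSys
end
end MV


namespace MV

/-- a contiguous sublist of a reduced word is reduced -/
lemma isRed_sub {ι : Type} {L₁ L₂ : List (ι × Bool)} (h : FreeGroup.IsReduced L₂)
    (h' : L₁ <:+: L₂) : FreeGroup.IsReduced L₁ := by
  obtain ⟨s, t, rfl⟩ := h'
  unfold FreeGroup.IsReduced at h ⊢
  exact (List.isChain_append.1 (List.isChain_append.1 h).1).2.1

open FreeGroup
variable {ι : Type} [DecidableEq ι]

/-- inverse letter -/
def linv (d : ι × Bool) : ι × Bool := (d.1, !d.2)

@[simp] lemma linv_linv (d : ι × Bool) : linv (linv d) = d := by simp [linv]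
lemma linv_ne (d : ι × Bool) : linv d ≠ d := by
  intro h; have := congrArg Prod.snd h; simp [linv] at this
lemma linv_inj {a b : ι × Bool} : linv a = linv b ↔ a = b :=
  ⟨fun h => by simpa using congrArg linv h, fun h => by rw [h]⟩

/-- a letter as group element -/
def lt1 (d : ι × Bool) : FreeGroup ι := FreeGroup.mk [d]

lemma lt1_linv (d : ι × Bool) : lt1 (linv d) = (lt1 d)⁻¹ := by
  simp [lt1, linv, FreeGroup.inv_mk, FreeGroup.invRev]

lemma lt1_true (i : ι) : lt1 (i, true) = FreeGroup.of i := rfl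
lemma lt1_false (i : ι) : lt1 (i, false) = (FreeGroup.of i)⁻¹ := rfl

lemma toWord_lt1 (d : ι × Bool) : (lt1 d).toWord = [d] := by
  simp [lt1]

lemma red_rel {a b : ι × Bool} : (a.1 = b.1 → a.2 = b.2) ↔ b ≠ linv a := by
  obtain ⟨a1, a2⟩ := a
  obtain ⟨b1, b2⟩ := b
  cases a2 <;> cases b2 <;> simp [linv, eq_comm]

lemma red_snoc {L : List (ι × Bool)} {d : ι × Bool} (hL : IsReduced L) :
    IsReduced (L ++ [d]) ↔ ∀ l, L ≠ l ++ [linv d] := by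
  rw [FreeGroup.IsReduced, List.isChain_append]
  constructor
  · rintro ⟨_, _, h⟩ l rfl
    have := h (linv d) (by simp) d (by simp)
    rw [red_rel] at this; simp at this
  · intro h
    refine ⟨hL, by simp, ?_⟩
    intro x hx y hy
    rw [red_rel]
    simp at hy; subst hy
    rintro rfl
    obtain ⟨l, hl⟩ := List.mem_getLast?_eq_getLast hx |> fun ⟨h1, h2⟩ => (⟨L.dropLast, by
      rw [h2]; exact (List.dropLast_append_getLast h1).symm⟩ : ∃ l, L = l ++ [x])
    exact h l (by simpa using hl)

lemma red_cons {L : List (ι × Bool)} {d : ι × Bool} (hL : IsReduced L) :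
    IsReduced (d :: L) ↔ ∀ l, L ≠ linv d :: l := by
  cases L with
  | nil => simp
  | cons a l =>
    rw [FreeGroup.IsReduced, List.isChain_cons_cons, red_rel]
    constructor
    · rintro ⟨h, _⟩ l' h'
      injection h' with h1 h2
      exact h h1
    · intro h
      exact ⟨fun h' => h l (by rw [h']), hL⟩

lemma toWord_mul_lt1 (x : FreeGroup ι) (d : ι × Bool) :
    ((∀ l, x.toWord ≠ l ++ [linv d]) ∧ (x * lt1 d).toWord = x.toWord ++ [d]) ∨
    (∃ l, x.toWord = l ++ [linv d] ∧ (x * lt1 d).toWord = l) := by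
  by_cases h : ∀ l, x.toWord ≠ l ++ [linv d]
  · left
    refine ⟨h, ?_⟩
    rw [toWord_mul, toWord_lt1]
    exact ((red_snoc isReduced_toWord).2 h).reduce_eq
  · right
    push Not at h
    obtain ⟨l, hl⟩ := h
    refine ⟨l, hl, ?_⟩
    have hx : x = FreeGroup.mk l * lt1 (linv d) := by
      rw [lt1, FreeGroup.mul_mk, ← hl, mk_toWord]
    have hr : IsReduced l := isRed_sub (L₂ := x.toWord) isReduced_toWord (by rw [hl]; exact ⟨[], [linv d], by simp⟩)
    rw [hx, lt1_linv]
    simp [hr.reduce_eq]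

lemma toWord_lt1_mul (x : FreeGroup ι) (d : ι × Bool) :
    ((∀ l, x.toWord ≠ linv d :: l) ∧ (lt1 d * x).toWord = d :: x.toWord) ∨
    (∃ l, x.toWord = linv d :: l ∧ (lt1 d * x).toWord = l) := by
  by_cases h : ∀ l, x.toWord ≠ linv d :: l
  · left
    refine ⟨h, ?_⟩
    rw [toWord_mul, toWord_lt1]
    exact ((red_cons isReduced_toWord).2 h).reduce_eq
  · right
    push Not at h
    obtain ⟨l, hl⟩ := h
    refine ⟨l, hl, ?_⟩
    have hx : x = lt1 (linv d) * FreeGroup.mk l := by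
      rw [lt1, FreeGroup.mul_mk, List.singleton_append, ← hl, mk_toWord]
    have hr : IsReduced l := isRed_sub (L₂ := x.toWord) isReduced_toWord (by rw [hl]; exact ⟨[linv d], [], by simp⟩)
    rw [hx, lt1_linv]
    simp [hr.reduce_eq]

/-- the half-tree of a word -/
def N (L : List (ι × Bool)) : Set (FreeGroup ι) := {g | L <+: g.toWord}

lemma mem_N {L : List (ι × Bool)} {g : FreeGroup ι} : g ∈ N L ↔ L <+: g.toWord := Iff.rfl

@[simp] lemma N_nil : N ([] : List (ι × Bool)) = Set.univ := by ext; simp [N]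

lemma N_red {L : List (ι × Bool)} {g : FreeGroup ι} (h : g ∈ N L) : IsReduced L :=
  isRed_sub isReduced_toWord (List.IsPrefix.isInfix h)

lemma N_mono {L L' : List (ι × Bool)} (h : L <+: L') : N L' ⊆ N L := fun _ hg => h.trans hg

lemma mk_mem_N {L : List (ι × Bool)} (h : IsReduced L) : FreeGroup.mk L ∈ N L := by
  rw [mem_N, toWord_mk, h.reduce_eq]

lemma N_children {L : List (ι × Bool)} {g : FreeGroup ι} (h : g ∈ N L) :
    g = FreeGroup.mk L ∨ ∃ d, g ∈ N (L ++ [d]) := by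
  obtain ⟨t, ht⟩ := h
  cases t with
  | nil => left; rw [List.append_nil] at ht; rw [ht, mk_toWord]
  | cons d t => right; exact ⟨d, t, by simpa using ht⟩

variable [Fintype ι]

lemma ball_finite (n : ℕ) : {g : FreeGroup ι | g.toWord.length ≤ n}.Finite :=
  (List.finite_length_le (ι × Bool) n).preimage toWord_injective.injOn

lemma ev_long (n : ℕ) : ∀ᶠ g : FreeGroup ι in cofinite, n < g.toWord.length := by
  have := (ball_finite (ι := ι) n).compl_mem_cofinite
  filter_upwards [this] with g hg
  simpa using hg

lemma ainv_of_gens {A : Set (FreeGroup ι)}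
    (h : ∀ i : ι, ∀ᶠ x in cofinite, (x ∈ A ↔ x * FreeGroup.of i ∈ A)) : AInv A := by
  intro g
  induction g using FreeGroup.induction_on with
  | C1 => simp
  | of i => exact h i
  | inv_of i hi =>
    have := ev_right (FreeGroup.of i)⁻¹ (h i)
    filter_upwards [this] with x hx
    rw [hx]; simp
  | mul a b ha hb =>
    have := ev_right a hb
    filter_upwards [ha, this] with x h1 h2
    rw [h1, h2, mul_assoc]

lemma N_mul_lt1 {L : List (ι × Bool)} {x : FreeGroup ι} (d : ι × Bool)
    (h : L.length < x.toWord.length) : x ∈ N L ↔ x * lt1 d ∈ N L := by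
  rw [mem_N, mem_N]
  rcases toWord_mul_lt1 x d with ⟨_, h2⟩ | ⟨l, h1, h2⟩
  · rw [h2, List.prefix_concat_iff]
    constructor
    · exact Or.inr
    · rintro (h' | h')
      · rw [h'] at h; simp at h
      · exact h'
  · rw [h2, h1]
    rw [h1] at h
    simp at h
    rw [List.prefix_concat_iff]
    constructor
    · rintro (h' | h')
      · rw [h'] at h; simp at h
      · exact h'
    · exact Or.inr

lemma N_ainv (L : List (ι × Bool)) : AInv (N L) := by
  apply ainv_of_gens
  intro i
  filter_upwards [ev_long (ι := ι) L.length] with x hx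
  exact N_mul_lt1 (i, true) hx

lemma toWord_append {L t : List (ι × Bool)} (h : IsReduced (L ++ t)) :
    (FreeGroup.mk (L ++ t)).toWord = L ++ t := by rw [toWord_mk, h.reduce_eq]

/-- a half tree is a translate of the complement of a first-level half tree -/
lemma N_eq_ltr {L : List (ι × Bool)} {d : ι × Bool} (h : IsReduced (L ++ [d])) :
    N (L ++ [d]) = ltr (FreeGroup.mk (L ++ [d])) (N [linv d])ᶜ := by
  ext g
  simp only [mem_ltr, Set.mem_compl_iff]
  constructor
  · rintro ⟨t, ht⟩ ⟨s, hs⟩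
    have hg : g = FreeGroup.mk (L ++ [d]) * FreeGroup.mk t := by
      rw [FreeGroup.mul_mk, ht, mk_toWord]
    have hred : IsReduced ((L ++ [d]) ++ t) := by rw [ht]; exact isReduced_toWord
    have hrt : IsReduced t := isRed_sub hred ⟨L ++ [d], [], by simp⟩
    rw [hg, inv_mul_cancel_left, toWord_mk, hrt.reduce_eq] at hs
    subst hs
    have h2 : IsReduced [d, linv d] := isRed_sub hred ⟨L, s, by simp⟩
    have := (red_cons (L := [linv d]) (by simp)).1 h2 []
    exact this rfl
  · intro hg
    set u := (FreeGroup.mk (L ++ [d]))⁻¹ * g with hu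
    have hgu : g = FreeGroup.mk (L ++ [d]) * u := by rw [hu, mul_inv_cancel_left]
    have hred : IsReduced (L ++ [d] ++ u.toWord) := by
      have h1 : IsReduced ([d] ++ u.toWord) := by
        rw [List.singleton_append, red_cons isReduced_toWord]
        intro l hl
        exact hg ⟨l, by simpa using hl.symm⟩
      exact IsReduced.append_overlap h h1 (by simp)
    refine ⟨u.toWord, ?_⟩
    rw [hgu]
    conv_rhs => rw [← mk_toWord (x := u), FreeGroup.mul_mk, toWord_append hred]

/-- deep half-trees are monochromatic -/
lemma deep {A : Set (FreeGroup ι)} (hA : AInv A) : ∃ K : ℕ, ∀ L : List (ι × Bool),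
    K ≤ L.length → ∀ g ∈ N L, (g ∈ A ↔ FreeGroup.mk L ∈ A) := by
  have h1 : ∀ᶠ x in cofinite, ∀ d : ι × Bool, (x ∈ A ↔ x * lt1 d ∈ A) :=
    eventually_all.2 fun d => hA _
  have hf : {x : FreeGroup ι | ¬ ∀ d : ι × Bool, (x ∈ A ↔ x * lt1 d ∈ A)}.Finite := h1
  obtain ⟨K, hK⟩ := (hf.image fun x => x.toWord.length).bddAbove
  refine ⟨K + 1, fun L hL g hg => ?_⟩
  obtain ⟨t, ht⟩ := hg
  induction t using List.reverseRecOn generalizing g with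
  | nil => rw [List.append_nil] at ht; rw [ht, mk_toWord]
  | append_singleton t d ih =>
    rw [← List.append_assoc] at ht
    have hr : IsReduced ((L ++ t) ++ [d]) := by rw [ht]; exact isReduced_toWord
    have hr' : IsReduced (L ++ t) := isRed_sub hr ⟨[], [d], by simp⟩
    have := ih (FreeGroup.mk (L ++ t)) (by rw [toWord_mk, hr'.reduce_eq])
    rw [← this]
    have hg : g = FreeGroup.mk (L ++ t) * lt1 d := by
      rw [lt1, FreeGroup.mul_mk, ht, mk_toWord]
    rw [hg]
    by_contra hcon
    have h3 := hK ⟨FreeGroup.mk (L ++ t), fun h => hcon (h d).symm, rfl⟩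
    simp only [toWord_mk, hr'.reduce_eq, List.length_append] at h3
    omega

lemma N_infinite {L : List (ι × Bool)} (h : IsReduced L) (hL : L ≠ []) :
    ∃ᶠ x in cofinite, x ∈ N L := by
  rw [frequently_cofinite_iff_infinite]
  obtain ⟨l, d, rfl⟩ := List.eq_nil_or_concat'  L |>.resolve_left hL
  have hred : ∀ n, IsReduced (l ++ [d] ++ List.replicate n d) := by
    intro n
    refine IsReduced.append_overlap h ?_ (by simp)
    have : [d] ++ List.replicate n d = List.replicate (n+1) d := by simp [List.replicate_succ]
    rw [this, isReduced_iff_reduce_eq, reduce_replicate]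
  apply Set.infinite_of_injective_forall_mem (f := fun n : ℕ => FreeGroup.mk (l ++ [d] ++ List.replicate n d))
  · intro a b hab
    have := congrArg (fun x => x.toWord.length) hab
    simp only [toWord_append (hred _)] at this
    simpa using this
  · intro n
    refine ⟨List.replicate n d, ?_⟩
    rw [toWord_append (hred n)]

lemma N_compl_infinite [Nonempty ι] {L : List (ι × Bool)} (hL : L ≠ []) :
    ∃ᶠ x in cofinite, x ∉ N L := by
  obtain ⟨d, l, rfl⟩ := List.exists_cons_of_ne_nil hL
  refine (N_infinite (L := [linv d]) (by simp) (by simp)).mono ?_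
  rintro x ⟨t, ht⟩ ⟨s, hs⟩
  rw [← ht] at hs
  simp at hs
  exact linv_ne d hs.1.symm

end MV


namespace MV

lemma tight {α : Type} {Z U1 U2 U3 : Set α} (h1 : U1.Finite) (h2 : U2.Finite) (h3 : U3.Finite)
    (hZ : Z ⊆ U1 ∪ (U2 ∪ U3)) (hc : U1.ncard + U2.ncard + U3.ncard ≤ Z.ncard) {e : α}
    (he2 : e ∈ U2) (he1 : e ∉ U1) : e ∈ Z ∧ e ∉ U3 := by
  have hfin : (U1 ∪ (U2 ∪ U3)).Finite := h1.union (h2.union h3)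
  have a1 := Set.ncard_union_le U1 (U2 ∪ U3)
  have a2 := Set.ncard_union_add_ncard_inter U2 U3 h2 h3
  have a3 := Set.ncard_le_ncard hZ hfin
  constructor
  · by_contra hz
    have : Z ⊆ (U1 ∪ (U2 ∪ U3)) \ {e} := fun x hx => ⟨hZ hx, by rintro rfl; exact hz hx⟩
    have a4 := Set.ncard_le_ncard this hfin.diff
    have a5 := Set.ncard_diff_singleton_add_one (a := e) (s := U1 ∪ (U2 ∪ U3)) (Or.inr (Or.inl he2)) hfin
    omega
  · intro h
    have : 0 < (U2 ∩ U3).ncard := (Set.ncard_pos (h2.inter_of_left _)).2 ⟨e, he2, h⟩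
    omega

namespace HSys
section
variable {F : Type} [Group F] {Ω : Type} [MulAction F Ω] (S : HSys F Ω)

/-- members almost contained in a set -/
def insd (N : Set F) : Set Ω := {ω | ∀ᶠ x in cofinite, x ∈ S.P ω → x ∈ N}

variable {S}

lemma insd_mono {N N' : Set F} (h : N ⊆ N') : S.insd N ⊆ S.insd N' := by
  intro ω hω
  have hω' : ∀ᶠ x in cofinite, x ∈ S.P ω → x ∈ N := hω
  exact hω'.mono fun x hx hP => h (hx hP)

lemma tri (N : Set F) (ω : Ω) : ω ∈ S.insd N ∨ ω ∈ S.sep N ∨ ω ∈ S.insd Nᶜ := by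
  by_cases h : ω ∈ S.sep N
  · exact Or.inr (Or.inl h)
  · rcases not_sep h with h | h
    · exact Or.inr (Or.inr h)
    · exact Or.inl h

lemma insd_not_sep {A N : Set F} {ω : Ω} (h : ω ∈ S.insd N) (h' : ω ∈ S.insd Nᶜ) : ω ∉ S.sep A := by
  intro h0
  apply h0.1
  filter_upwards [h, h'] with x; simp only [Set.mem_compl_iff]; tauto

lemma insd_not_sep' {N : Set F} {ω : Ω} (h : ω ∈ S.insd N) : ω ∉ S.sep N := by
  intro h0
  apply h0.2
  filter_upwards [h] with x; tauto

lemma count {A : Set F} (hA : AInv A) (N : Set F) :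
    S.c A = (S.sep A ∩ S.insd N).ncard + (S.sep A ∩ S.sep N).ncard + (S.sep A ∩ S.insd Nᶜ).ncard := by
  have hf := S.sep_fin hA
  rw [← Set.ncard_union_eq _ (hf.inter_of_left _) (hf.inter_of_left _),
    ← Set.ncard_union_eq _ ((hf.inter_of_left _).union (hf.inter_of_left _)) (hf.inter_of_left _)]
  · rw [c, ← Set.inter_union_distrib_left, ← Set.inter_union_distrib_left, Set.inter_eq_left.2]
    intro ω _
    rcases tri (S := S) N ω with h | h | h <;> simp [h]
  · rw [Set.disjoint_left]
    rintro ω (⟨h1, h2⟩ | ⟨h1, h2⟩) ⟨h3, h4⟩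
    · exact insd_not_sep h2 h4 h1
    · exact insd_not_sep' h4 (by rwa [sep_compl'])
  · rw [Set.disjoint_left]
    rintro ω ⟨h1, h2⟩ ⟨h3, h4⟩
    exact insd_not_sep' h2 h4

lemma insd_ltr {N : Set F} (hN : AInv N) (g : F) (ω : Ω) :
    g • ω ∈ S.insd (ltr g N) ↔ ω ∈ S.insd N := by
  constructor
  · intro h
    have h1 := ev_left g (ev_right g⁻¹ h)
    filter_upwards [h1, hN g⁻¹] with x h2 h3 h4
    rw [S.equiv] at h2
    simp only [mem_ltr, mul_assoc, inv_mul_cancel_left, inv_mul_cancel, mul_one] at h2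
    exact h3.2 (h2 h4)
  · intro h
    have h1 := ev_left g⁻¹ (ev_right g h)
    filter_upwards [h1, ev_left g⁻¹ (hN g)] with x h2 h3 h4
    rw [S.equiv] at h4
    rw [mem_ltr, h3]
    exact h2 h4

/-- Members of the chain of minimal sets with prescribed trace. -/
def InC (S : HSys F Ω) (E : Ω) (A0 A : Set F) : Prop :=
  S.Min A ∧ ∀ᶠ x in cofinite, x ∈ S.P E → (x ∈ A0 ↔ x ∈ A)

set_option maxHeartbeats 2000000 in
/-- The core contradiction in the maximality claim. -/
lemma core [IsMulTorsionFree F] {E : Ω} {A0 A : Set F} (hE0 : Sep A0 (S.P E))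
    (hnc : ∃ a b : S.P E, a * b ≠ b * a)
    (hst : ∀ g : F, g • E = E → g ∈ S.P E)
    (hA : S.InC E A0 A) {g : F} (hg1 : g ≠ 1) {Ni Nj : Set F} (hNi : AInv Ni) (hNj : AInv Nj)
    (hgN : ltr g Ni = Nj) (hji : Nj ⊆ Ni) (hNinf : ∃ᶠ x in cofinite, x ∈ Nj)
    {J : Set Ω} (hi : S.sep A ∩ S.sep Ni = J) (hj : S.sep A ∩ S.sep Nj = J) {ν : ℕ}
    (hni : (S.sep A ∩ S.insd Ni).ncard = ν) (hnj : (S.sep A ∩ S.insd Nj).ncard = ν)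
    (hν : 1 ≤ ν) (hm : S.c A ≤ 2 * ν + (J \ {E}).ncard)
    (hcr : ∀ ω ∈ S.sep Nj, ω ∉ J → (ω ∈ S.insd A ∧ ω ∈ S.insd (ltr g A)) ∨
      (ω ∈ S.insd Aᶜ ∧ ω ∈ S.insd (ltr g A)ᶜ))
    (hfix : ∀ ω ∈ J, g • ω = ω)
    (hno : ∀ B, S.InC E A0 B → ¬ Nj ⊆ B) (hno' : ∀ B, S.InC E A0 B → ¬ Ni ⊆ B)
    (hEJ : E ∈ J ∨ E ∈ S.insd Niᶜ)
    (hτ : ∀ᶠ x in cofinite, x ∈ S.P E → x ∈ A → x ∉ Ni) : False := by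
  have aA := hA.1.1
  have agA := hA.1.1.ltr g
  set gA := ltr g A with hgA
  have hEA : E ∈ S.sep A := by
    constructor
    · intro h0; apply hE0.1; filter_upwards [h0, hA.2] with x; clear * -; tauto
    · intro h0; apply hE0.2; filter_upwards [h0, hA.2] with x; clear * -; tauto
  have hJf : J.Finite := by rw [← hj]; exact (S.sep_fin aA).inter_of_left _
  set V := (gA \ A) \ Nj with hV
  set V' := (A \ gA) \ Nj with hV'
  have aV : AInv V := (agA.diff aA).diff hNj
  have aV' : AInv V' := (aA.diff agA).diff hNj
  set outA := S.sep A ∩ S.insd Njᶜ with houtA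
  set outG := S.sep gA ∩ S.insd Njᶜ with houtG
  have fA : outA.Finite := (S.sep_fin aA).inter_of_left _
  have fG : outG.Finite := (S.sep_fin agA).inter_of_left _
  have cA : S.c A = ν + J.ncard + outA.ncard := by
    rw [count aA Nj, hj, hnj]
  have hGeq : outG = (fun ω => g • ω) '' (S.sep A ∩ S.insd Niᶜ) := by
    ext ω
    obtain ⟨ω, rfl⟩ := MulAction.surjective g ω
    simp only [houtG, Set.mem_inter_iff, Set.mem_image]
    rw [hgA, S.smul_mem_sep aA, ← hgN, ← ltr_compl, insd_ltr hNi.compl]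
    constructor
    · intro h; exact ⟨ω, h, rfl⟩
    · rintro ⟨ω', h, h'⟩
      rw [← MulAction.injective g h']; exact h
  have cG : S.c A = ν + J.ncard + outG.ncard := by
    rw [hGeq, Set.ncard_image_of_injective _ (MulAction.injective g), count aA Ni, hi, hni]
  -- location of the separated elements
  have loc : ∀ ω, (ω ∈ S.sep V ∨ ω ∈ S.sep V') → ω ∉ J → ω ∈ S.insd Njᶜ := by
    intro ω hω hωJ
    rcases tri (S := S) Nj ω with h | h | h
    · exfalso
      rcases hω with hω | hω
      · apply hω.1; filter_upwards [h] with x; simp only [hV, Set.mem_diff]; clear * -; tauto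
      · apply hω.1; filter_upwards [h] with x; simp only [hV', Set.mem_diff]; clear * -; tauto
    · exfalso
      rcases hcr ω h hωJ with ⟨h1, h2⟩ | ⟨h1, h2⟩
      · rcases hω with hω | hω
        · apply hω.1; filter_upwards [h1, h2] with x; simp only [hV, Set.mem_diff]; clear * -; tauto
        · apply hω.1; filter_upwards [h1, h2] with x; simp only [hV', Set.mem_diff]; clear * -; tauto
      · rcases hω with hω | hω
        · apply hω.1; filter_upwards [h1, h2] with x
          simp only [hV, Set.mem_diff, Set.mem_compl_iff]; clear * -; tauto
        · apply hω.1; filter_upwards [h1, h2] with x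
          simp only [hV', Set.mem_diff, Set.mem_compl_iff]; clear * -; tauto
    · exact h
  have toD : ∀ ω ∈ S.insd Njᶜ, ω ∈ S.sep V → Sep (gA \ A) (S.P ω) := by
    intro ω h h'
    constructor
    · intro h0; apply h'.1; filter_upwards [h0] with x; simp only [hV, Set.mem_diff]; clear * -; tauto
    · intro h0; apply h'.2; filter_upwards [h0, h] with x
      simp only [hV, Set.mem_diff, Set.mem_compl_iff]; clear * -; tauto
  have toD' : ∀ ω ∈ S.insd Njᶜ, ω ∈ S.sep V' → Sep (A \ gA) (S.P ω) := by
    intro ω h h'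
    constructor
    · intro h0; apply h'.1; filter_upwards [h0] with x; simp only [hV', Set.mem_diff]; clear * -; tauto
    · intro h0; apply h'.2; filter_upwards [h0, h] with x
      simp only [hV', Set.mem_diff, Set.mem_compl_iff]; clear * -; tauto
  have sub1 : S.sep V ⊆ J ∪ (outA ∪ outG) := by
    intro ω hω
    by_cases hωJ : ω ∈ J
    · exact Or.inl hωJ
    · have h := loc ω (Or.inl hω) hωJ
      rcases sep_diff_or (toD ω h hω) with h' | h'
      · exact Or.inr (Or.inr ⟨h', h⟩)
      · exact Or.inr (Or.inl ⟨h', h⟩)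
  have sub2 : S.sep V' ⊆ J ∪ (outG ∪ outA) := by
    intro ω hω
    by_cases hωJ : ω ∈ J
    · exact Or.inl hωJ
    · have h := loc ω (Or.inr hω) hωJ
      rcases sep_diff_or (toD' ω h hω) with h' | h'
      · exact Or.inr (Or.inr ⟨h', h⟩)
      · exact Or.inr (Or.inl ⟨h', h⟩)
  have e1 := Set.ncard_union_le J (outA ∪ outG)
  have e2 := Set.ncard_union_le outA outG
  have e1' := Set.ncard_union_le J (outG ∪ outA)
  have e2' := Set.ncard_union_le outG outA
  have e3 := Set.ncard_le_ncard sub1 (hJf.union (fA.union fG))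
  have e3' := Set.ncard_le_ncard sub2 (hJf.union (fG.union fA))
  have nV : ∀ W : Set F, W ⊆ Njᶜ → (∃ᶠ x in cofinite, x ∈ W) → Nontriv W := by
    intro W hW h
    exact ⟨h, hNinf.mono fun x hx h' => hW h' hx⟩
  have EnJ : ν ≤ outA.ncard → E ∉ J := by
    intro h hE
    have := Set.ncard_diff_singleton_add_one hE hJf
    omega
  have dle : (J \ {E}).ncard ≤ J.ncard := Set.ncard_le_ncard Set.diff_subset hJf
  by_cases iV : ∃ᶠ x in cofinite, x ∈ V
  · have ntV := nV V (fun x hx => hx.2) iV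
    have mV := hA.1.2.2 V aV ntV
    by_cases iV' : ∃ᶠ x in cofinite, x ∈ V'
    · have mV' := hA.1.2.2 V' aV' (nV V' (fun x hx => hx.2) iV')
      have := ncard_two (X := S.sep V \ J) (Y := S.sep V' \ J) fA fG
        (by
          rintro ω (⟨h1, h2⟩ | ⟨h1, h2⟩)
          · exact (sub1 h1).resolve_left h2
          · exact ((sub2 h1).resolve_left h2).symm)
        (by
          rintro ω ⟨⟨h1, h2⟩, ⟨h3, h4⟩⟩
          have hl := loc ω (Or.inl h1) h2
          have := sep_diff_and (toD ω hl h1) (toD' ω hl h3)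
          exact ⟨⟨this.2, hl⟩, ⟨this.1, hl⟩⟩)
      have a1 := Set.le_ncard_diff J (S.sep V) hJf
      have a2 := Set.le_ncard_diff J (S.sep V') hJf
      simp only [c] at mV mV' cA cG
      omega
    · have hEnJ := EnJ (by simp only [c] at mV cA cG; omega)
      have hEo : E ∈ S.insd Niᶜ := hEJ.resolve_left hEnJ
      have hEo' : E ∈ S.insd Njᶜ := insd_mono (Set.compl_subset_compl.2 hji) hEo
      have t := tight hJf fA fG sub1 (by simp only [c] at mV cA cG hm; omega) (e := E) ⟨hEA, hEo'⟩ hEnJ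
      have hEgA : E ∉ S.sep gA := fun h => t.2 ⟨h, hEo'⟩
      have hEi : E ∈ S.insd gA := by
        rcases not_sep hEgA with h | h
        · exfalso; apply t.1.1; filter_upwards [h] with x; simp only [hV, Set.mem_diff]; clear * -; tauto
        · exact h
      refine hno Vᶜ ⟨(hA.1.of_le aV ntV ?_).compl, ?_⟩ (fun x hx h => h.2 hx)
      · simp only [c] at mV cA cG hm ⊢; omega
      · filter_upwards [hA.2, hEi, hEo'] with x h1 h2 h3 h4
        have h1 := h1 h4
        have h2 := h2 h4
        have h3 := h3 h4
        revert h1 h2 h3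
        simp only [hV, Set.mem_diff, Set.mem_compl_iff]; clear * -; tauto
  · by_cases iV' : ∃ᶠ x in cofinite, x ∈ V'
    · have ntV := nV V' (fun x hx => hx.2) iV'
      have mV := hA.1.2.2 V' aV' ntV
      have hEnJ := EnJ (by simp only [c] at mV cA cG; omega)
      have hEo : E ∈ S.insd Niᶜ := hEJ.resolve_left hEnJ
      have hgEo : g • E ∈ S.insd Njᶜ := by
        rw [← hgN, ← ltr_compl, insd_ltr hNi.compl]; exact hEo
      have hgE : g • E ∈ outG := ⟨(S.smul_mem_sep aA g E).2 hEA, hgEo⟩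
      have hgJ : g • E ∉ J := by
        intro h
        have := hfix _ h
        rw [MulAction.injective g this] at h
        exact hEnJ h
      have t := tight hJf fG fA sub2 (by simp only [c] at mV cA cG hm; omega) hgE hgJ
      have hEgA : g • E ∉ S.sep A := fun h => t.2 ⟨h, hgEo⟩
      have hEi : g • E ∈ S.insd A := by
        rcases not_sep hEgA with h | h
        · exfalso; apply t.1.1; filter_upwards [h] with x; simp only [hV', Set.mem_diff]; clear * -; tauto
        · exact h
      refine hno' (ltr g⁻¹ V')ᶜ ⟨((hA.1.of_le aV' ntV ?_).ltr g⁻¹).compl, ?_⟩ ?_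
      · simp only [c] at mV cA cG hm ⊢; omega
      · have k1 : ∀ᶠ y in cofinite, y ∈ S.P (g • E) → (y ∈ V' ↔ y ∉ gA) := by
          filter_upwards [hEi, hgEo] with x h1 h2 h3
          have h1 := h1 h3
          have h2 := h2 h3
          revert h1 h2
          simp only [hV', Set.mem_diff, Set.mem_compl_iff, Set.mem_setOf_eq]; clear * -; tauto
        have k2 := ev_left g (ev_right g⁻¹ k1)
        have k3 := ev_left g (aV' g⁻¹)
        filter_upwards [k2, k3, aA g⁻¹, hA.2] with x h1 h2 h3 h4 h5
        have h4 := h4 h5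
        rw [S.equiv] at h1
        simp only [Set.mem_setOf_eq, hgA, mem_ltr, mul_assoc, inv_mul_cancel_left, inv_mul_cancel, mul_one] at h1 h2 h3
        have h1 := h1 h5
        simp only [Set.mem_compl_iff, mem_ltr, inv_inv]
        revert h1 h2 h3 h4
        clear * -; tauto
      · intro x hx h
        rw [mem_ltr, inv_inv] at h
        apply h.2
        rw [← hgN]; simpa using hx
    · -- both finite
      have hVf : ∀ᶠ x in cofinite, x ∉ V := by rwa [Filter.not_frequently] at iV
      have hVf' : ∀ᶠ x in cofinite, x ∉ V' := by rwa [Filter.not_frequently] at iV'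
      by_cases hEJ' : E ∈ J
      · have hgP : g ∈ S.P E := hst g (hfix E hEJ')
        -- invariance of the trace
        have k0 : ∀ᶠ x in cofinite, x ∈ S.P E → g⁻¹ * x ∈ A → x ∉ Nj := by
          filter_upwards [ev_left g⁻¹ hτ] with x h1 h2 h3 h4
          refine h1 (mul_mem (inv_mem hgP) h2) h3 ?_
          rw [← hgN] at h4; exact h4
        have k1 : ∀ᶠ x in cofinite, x ∈ S.P E → (x ∈ A ↔ g⁻¹ * x ∈ A) := by
          filter_upwards [hVf, hVf', hτ, k0] with x h1 h2 h3 h4 h5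
          have h3 := h3 h5
          have h4 := h4 h5
          have : x ∉ Ni → x ∉ Nj := fun h h' => h (hji h')
          revert h1 h2 h3 h4 this
          simp only [hV, hV', hgA, Set.mem_diff, mem_ltr]
          clear * -; tauto
        let B : Set (S.P E) := {p | (p : F) ∈ A}
        have hinj : Function.Injective (fun p : S.P E => (p : F)) := Subtype.val_injective
        have hB : AInv B := fun p => hinj.tendsto_cofinite.eventually (aA p)
        have key : ∀ q : F → Prop, (∃ᶠ x in cofinite, q x ∧ x ∈ S.P E) →
            ∃ᶠ p : S.P E in cofinite, q p := by
          intro q h h'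
          apply h
          rw [Filter.eventually_cofinite] at h' ⊢
          refine (h'.image Subtype.val).subset ?_
          intro x hx
          simp only [not_not, Set.mem_setOf_eq] at hx
          exact ⟨⟨x, hx.2⟩, by simpa using hx.1, rfl⟩
        have hBn : Nontriv B := ⟨key _ hEA.1, key _ hEA.2⟩
        have := stab_lemma hnc hB hBn (y := ⟨g⁻¹, inv_mem hgP⟩) (by
          have := hinj.tendsto_cofinite.eventually k1
          filter_upwards [this] with p hp
          exact hp p.2)
        have h1 := congrArg Subtype.val this
        simp at h1
        exact hg1 h1
      · have hEo : E ∈ S.insd Niᶜ := hEJ.resolve_left hEJ'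
        have hstep : ∀ ω, ω ∈ S.sep A → ω ∈ S.insd Niᶜ →
            g⁻¹ • ω ∈ S.sep A ∧ g⁻¹ • ω ∈ S.insd Niᶜ := by
          intro ω h1 h2
          have h3 : ω ∈ S.insd Njᶜ := insd_mono (Set.compl_subset_compl.2 hji) h2
          have h4 : ω ∈ S.sep gA := by
            have e : ∀ᶠ x in cofinite, x ∈ S.P ω → (x ∈ A ↔ x ∈ gA) := by
              filter_upwards [hVf, hVf', h3] with x; simp only [hV, hV', Set.mem_diff, Set.mem_compl_iff]; clear * -; tauto
            constructor
            · intro h0; apply h1.1; filter_upwards [h0, e] with x; clear * -; tauto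
            · intro h0; apply h1.2; filter_upwards [h0, e] with x; clear * -; tauto
          refine ⟨(S.mem_sep_ltr aA g ω).1 h4, ?_⟩
          rw [← insd_ltr hNi.compl g, smul_inv_smul, ltr_compl, hgN]
          exact h3
        have hall : ∀ n : ℕ, (g⁻¹) ^ n • E ∈ S.sep A ∧ (g⁻¹) ^ n • E ∈ S.insd Niᶜ := by
          intro n
          induction n with
          | zero => simpa using ⟨hEA, hEo⟩
          | succ n ih =>
            rw [pow_succ', mul_smul]; exact hstep _ ih.1 ih.2
        obtain ⟨a, b, hab, h⟩ := (S.sep_fin aA).exists_lt_map_eq_of_forall_mem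
          (f := fun n : ℕ => (g⁻¹) ^ n • E) (fun n => (hall n).1)
        have hk : g ^ (b - a) ∈ S.P E := by
          apply hst
          have h1 : (g⁻¹) ^ b = (g⁻¹) ^ a * (g⁻¹) ^ (b - a) := by rw [← pow_add]; congr 1; omega
          simp only [h1, mul_smul] at h
          have h2 := MulAction.injective _ h
          rw [inv_pow] at h2
          rw [← eq_inv_smul_iff]; exact h2
        set k := b - a with hkdef
        have hk0 : k ≠ 0 := by omega
        obtain ⟨u, hu⟩ := hNinf.exists
        have hu := hji hu
        have hstay : ∀ n : ℕ, g ^ n * u ∈ Ni := by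
          intro n
          induction n with
          | zero => simpa using hu
          | succ n ih =>
            apply hji
            rw [← hgN, mem_ltr, pow_succ', mul_assoc, inv_mul_cancel_left]; exact ih
        have hinj : Function.Injective (fun n : ℕ => (g ^ k) ^ n) := by
          apply injective_pow_iff_not_isOfFinOrder.2
          apply not_isOfFinOrder_of_isMulTorsionFree
          intro h
          exact hg1 ((pow_eq_one_iff_left hk0).1 h)
        have e1 := hinj.tendsto_cofinite.eventually (hNi u)
        have e2 := hinj.tendsto_cofinite.eventually hEo
        obtain ⟨n, h1, h2⟩ := (e1.and e2).exists
        apply h2 (pow_mem hk n)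
        rw [h1, ← pow_mul]
        exact hstay _

end
end HSys
end MV


namespace MV
namespace HSys

/-- chain of minimal sets with given trace -/
def Ch {F : Type} [Group F] {Ω : Type} [MulAction F Ω] (S : HSys F Ω) (E : Ω) (A0 : Set F) : Type :=
  {A : Set F // S.InC E A0 A}

instance {F : Type} [Group F] {Ω : Type} [MulAction F Ω] (S : HSys F Ω) (E : Ω) (A0 : Set F) :
    Preorder (Ch S E A0) where
  le a b := SubF a.1 b.1
  le_refl a := SubF.refl _
  le_trans a b c h h' := SubF.trans h h'

section
variable {F : Type} [Group F] {Ω : Type} [MulAction F Ω] {S : HSys F Ω} {E : Ω} {A0 : Set F}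

lemma InC.sepE {A : Set F} (h : S.InC E A0 A) (hE0 : Sep A0 (S.P E)) : Sep A (S.P E) := by
  have hA := h.2
  constructor
  · intro h0; apply hE0.1; filter_upwards [h0, hA] with x; tauto
  · intro h0; apply hE0.2; filter_upwards [h0, hA] with x; tauto

lemma InC.total {A B : Set F} (h : S.InC E A0 A) (h' : S.InC E A0 B) (hE0 : Sep A0 (S.P E)) :
    SubF A B ∨ SubF B A := by
  apply h.1.chain h'.1 (h.sepE hE0)
  filter_upwards [h.2, h'.2] with x; tauto

lemma ch_directed (hE0 : Sep A0 (S.P E)) : IsDirectedOrder (Ch S E A0) :=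
  ⟨fun a b => by
    rcases a.2.total b.2 hE0 with h | h
    · exact ⟨b, h, le_refl b⟩
    · exact ⟨a, le_refl a, h⟩⟩

/-- not stabilizing on a set -/
def Unst (S : HSys F Ω) (E : Ω) (A0 : Set F) (N : Set F) : Prop :=
  ∀ A : Ch S E A0, ∃ A' : Ch S E A0, A ≤ A' ∧ ∃ᶠ x in cofinite, x ∈ A'.1 ∧ x ∉ A.1 ∧ x ∈ N

/-- eventually containing -/
def Ty1 (S : HSys F Ω) (E : Ω) (A0 : Set F) (ω : Ω) : Prop :=
  ∀ᶠ A : Ch S E A0 in atTop, ω ∈ S.insd A.1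
/-- always almost disjoint -/
def Ty2 (S : HSys F Ω) (E : Ω) (A0 : Set F) (ω : Ω) : Prop :=
  ∀ A : Ch S E A0, ω ∈ S.insd A.1ᶜ
/-- eventually separated -/
def TyJ (S : HSys F Ω) (E : Ω) (A0 : Set F) (ω : Ω) : Prop :=
  ∀ᶠ A : Ch S E A0 in atTop, ω ∈ S.sep A.1

lemma insd_of_le {A A' : Ch S E A0} (h : A ≤ A') {ω : Ω} (hω : ω ∈ S.insd A.1) :
    ω ∈ S.insd A'.1 := by
  have h' : SubF A.1 A'.1 := h
  have h1 : ∀ᶠ x in cofinite, x ∈ S.P ω → x ∈ A.1 := hω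
  have : ∀ᶠ x in cofinite, x ∈ S.P ω → x ∈ A'.1 := by
    filter_upwards [h', h1] with x h1 h2 h3 using h1 (h2 h3)
  exact this

lemma insd_compl_of_le {A A' : Ch S E A0} (h : A ≤ A') {ω : Ω} (hω : ω ∈ S.insd A'.1ᶜ) :
    ω ∈ S.insd A.1ᶜ := by
  have h' : SubF A.1 A'.1 := h
  have h1 : ∀ᶠ x in cofinite, x ∈ S.P ω → x ∉ A'.1 := hω
  have : ∀ᶠ x in cofinite, x ∈ S.P ω → x ∉ A.1 := by
    filter_upwards [h', h1] with x h1 h2 h3 h4 using h2 h3 (h1 h4)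
  exact this

lemma types (ω : Ω) : Ty1 S E A0 ω ∨ Ty2 S E A0 ω ∨ TyJ S E A0 ω := by
  by_cases h1 : ∃ A : Ch S E A0, ω ∈ S.insd A.1
  · left
    obtain ⟨A, hA⟩ := h1
    filter_upwards [eventually_ge_atTop A] with A' h using insd_of_le h hA
  · push Not at h1
    right
    by_cases h2 : Ty2 S E A0 ω
    · exact Or.inl h2
    · right
      simp only [Ty2, not_forall] at h2
      obtain ⟨A, hA⟩ := h2
      filter_upwards [eventually_ge_atTop A] with A' h
      rcases tri (S := S) A'.1 ω with h' | h' | h'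
      · exact absurd h' (h1 A')
      · exact h'
      · exact absurd (insd_compl_of_le h h') hA

end

section
variable {ι : Type} [DecidableEq ι] [Fintype ι] {Ω : Type} [MulAction (FreeGroup ι) Ω]
  {S : HSys (FreeGroup ι) Ω} {E : Ω} {A0 : Set (FreeGroup ι)}

lemma unst_child (hE0 : Sep A0 (S.P E)) [Nonempty (Ch S E A0)] {L : List (ι × Bool)}
    (h : Unst S E A0 (N L)) : ∃ d, Unst S E A0 (N (L ++ [d])) := by
  haveI := ch_directed (S := S) hE0
  by_contra hcon
  simp only [Unst] at hcon
  push Not at hcon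
  choose B hB using hcon
  obtain ⟨A, hA⟩ := (eventually_all.2 fun d => eventually_ge_atTop (B d)).exists
  obtain ⟨A', hA', hf⟩ := h A
  apply hf
  have h1 : ∀ᶠ x in cofinite, ∀ d, ¬ (x ∈ A'.1 ∧ x ∉ (B d).1 ∧ x ∈ N (L ++ [d])) :=
    eventually_all.2 fun d => (hB d A' ((hA d).trans hA')).mono fun x h ⟨a, b, c⟩ => h a b c
  have h2 : ∀ᶠ x in cofinite, ∀ d, x ∈ (B d).1 → x ∈ A.1 := eventually_all.2 fun d => hA d
  have h3 : ∀ᶠ x in cofinite, x ≠ FreeGroup.mk L := by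
    simpa using (Set.finite_singleton (FreeGroup.mk L)).compl_mem_cofinite
  filter_upwards [h1, h2, h3] with x k1 k2 k3 ⟨k4, k5, k6⟩
  rcases N_children k6 with h | ⟨d, hd⟩
  · exact k3 h
  · exact k1 d ⟨k4, fun h => k5 (k2 d h), hd⟩

lemma unst_ray (hE0 : Sep A0 (S.P E)) [Nonempty (Ch S E A0)]
    (h : Unst S E A0 (N ([] : List (ι × Bool)))) :
    ∃ (w : ℕ → List (ι × Bool)) (d : ℕ → ι × Bool), w 0 = [] ∧ (∀ n, w (n + 1) = w n ++ [d n]) ∧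
      ∀ n, Unst S E A0 (N (w n)) := by
  let T := {L : List (ι × Bool) // Unst S E A0 (N L)}
  choose D hD using fun L : T => unst_child hE0 L.2
  let W : ℕ → T := fun n => Nat.rec ⟨[], h⟩ (fun _ L => ⟨L.1 ++ [D L], hD L⟩) n
  exact ⟨fun n => (W n).1, fun n => D (W n), rfl, fun n => rfl, fun n => (W n).2⟩

lemma card_bound_step {m ν : ℕ} {N : Set (FreeGroup ι)} (hN : AInv N) {J : Set Ω}
    {A A' : Set (FreeGroup ι)} (hA : S.InC E A0 A) (hA' : S.InC E A0 A')
    (hinf : ∃ᶠ x in cofinite, x ∈ A' ∧ x ∉ A ∧ x ∈ N)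
    (hJ : S.sep A ∩ S.sep N = J)
    (h1 : (S.sep A ∩ S.insd N).ncard ≤ ν) (h1' : (S.sep A' ∩ S.insd N).ncard ≤ ν)
    (hcr : ∀ ω ∈ S.sep N, ω ∉ J → ω ∈ S.insd A ∨ ω ∈ S.insd A'ᶜ) :
    S.c A ≤ 2 * ν + (J \ {E}).ncard := by
  set D := (A' \ A) ∩ N with hD
  have aD : AInv D := (hA'.1.1.diff hA.1.1).inter hN
  have nD : Nontriv D := ⟨hinf.mono fun x hx => ⟨⟨hx.1, hx.2.1⟩, hx.2.2⟩,
    hA'.1.2.1.2.mono fun x hx h => hx h.1.1⟩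
  have hc := hA.1.2.2 D aD nD
  have fA := S.sep_fin hA.1.1
  have fA' := S.sep_fin hA'.1.1
  have hJf : J.Finite := by rw [← hJ]; exact fA.inter_of_left _
  have hsub : S.sep D ⊆ (S.sep A ∩ S.insd N) ∪ (S.sep A' ∩ S.insd N) ∪ (J \ {E}) := by
    intro ω hω
    have hωE : ω ≠ E := by
      rintro rfl
      apply hω.1
      filter_upwards [hA.2, hA'.2] with x
      simp only [hD, Set.mem_inter_iff, Set.mem_diff]; clear * -; tauto
    rcases tri (S := S) N ω with h | h | h
    · left
      have : Sep (A' \ A) (S.P ω) := by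
        constructor
        · exact hω.1.mono fun x hx => ⟨hx.1.1, hx.2⟩
        · have h' : ∀ᶠ x in cofinite, x ∈ S.P ω → x ∈ N := h
          intro h0; apply hω.2
          filter_upwards [h0, h'] with x
          simp only [hD, Set.mem_inter_iff, Set.mem_diff]; clear * -; tauto
      rcases sep_diff_or this with h' | h'
      · exact Or.inr ⟨h', h⟩
      · exact Or.inl ⟨h', h⟩
    · right
      refine ⟨?_, hωE⟩
      by_contra hωJ
      rcases hcr ω h hωJ with h' | h'
      · have h' : ∀ᶠ x in cofinite, x ∈ S.P ω → x ∈ A := h'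
        apply hω.1
        filter_upwards [h'] with x
        simp only [hD, Set.mem_inter_iff, Set.mem_diff]; clear * -; tauto
      · have h' : ∀ᶠ x in cofinite, x ∈ S.P ω → x ∉ A' := h'
        apply hω.1
        filter_upwards [h'] with x
        simp only [hD, Set.mem_inter_iff, Set.mem_diff]; clear * -; tauto
    · exfalso
      have h' : ∀ᶠ x in cofinite, x ∈ S.P ω → x ∉ N := h
      apply hω.1
      filter_upwards [h'] with x
      simp only [hD, Set.mem_inter_iff, Set.mem_diff]; clear * -; tauto
  have e1 := Set.ncard_le_ncard hsub
    (((fA.inter_of_left _).union (fA'.inter_of_left _)).union hJf.diff)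
  have e2 := Set.ncard_union_le ((S.sep A ∩ S.insd N) ∪ (S.sep A' ∩ S.insd N)) (J \ {E})
  have e3 := Set.ncard_union_le (S.sep A ∩ S.insd N) (S.sep A' ∩ S.insd N)
  simp only [c] at hc ⊢
  omega

set_option maxHeartbeats 1000000 in
/-- **Maximality claim**. -/
theorem claimC (hA0 : S.Min A0) (hE0 : Sep A0 (S.P E)) (hnc : ∃ a b : S.P E, a * b ≠ b * a)
    (hst : ∀ g : FreeGroup ι, g • E = E → g ∈ S.P E) :
    ∃ O, S.InC E A0 O ∧ ∀ A, S.InC E A0 A → SubF A O := by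
  by_contra hno
  push Not at hno
  have h00 : S.InC E A0 A0 := ⟨hA0, Eventually.of_forall fun _ _ => Iff.rfl⟩
  haveI : Nonempty (Ch S E A0) := ⟨⟨A0, h00⟩⟩
  haveI := ch_directed (S := S) hE0
  have hU0 : Unst S E A0 (N ([] : List (ι × Bool))) := by
    intro A
    obtain ⟨B, hB, hBA⟩ := hno A.1 A.2
    refine ⟨⟨B, hB⟩, (A.2.total hB hE0).resolve_right hBA, fun h => hBA ?_⟩
    filter_upwards [h] with x h1 h2
    by_contra h3
    exact h1 ⟨h2, h3, by simp⟩
  obtain ⟨w, d, hw0, hws, hwU⟩ := unst_ray hE0 hU0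
  have hlen : ∀ n, (w n).length = n := by
    intro n
    induction n with
    | zero => simp [hw0]
    | succ n ih => simp [hws, ih]
  have hpre : ∀ i j, i ≤ j → w i <+: w j := by
    intro i j hij
    induction j, hij using Nat.le_induction with
    | base => exact List.prefix_rfl
    | succ j _ ih => rw [hws]; exact ih.trans (List.prefix_append _ _)
  have hanti : ∀ i j, i ≤ j → N (w j) ⊆ N (w i) := fun i j h => N_mono (hpre i j h)
  have hred : ∀ n, FreeGroup.IsReduced (w n) := by
    intro n
    obtain ⟨A', _, hf⟩ := hwU n ⟨A0, h00⟩
    obtain ⟨x, hx⟩ := hf.exists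
    exact N_red hx.2.2
  have hnosub : ∀ (A : Set (FreeGroup ι)) (_ : S.InC E A0 A) n, ¬ N (w n) ⊆ A := by
    intro A hA n hsub
    obtain ⟨A', _, hf⟩ := hwU n ⟨A, hA⟩
    obtain ⟨x, hx⟩ := hf.exists
    exact hx.2.1 (hsub hx.2.2)
  have hdis : ∀ A : Ch S E A0, ∀ᶠ n in atTop, N (w n) ⊆ A.1ᶜ := by
    intro A
    obtain ⟨K, hK⟩ := deep A.2.1.1
    filter_upwards [eventually_ge_atTop K] with n hn
    have h1 := hK (w n) (by rw [hlen]; exact hn)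
    intro x hx hxA
    apply hnosub A.1 A.2 n
    intro y hy
    rw [h1 y hy, ← h1 x hx]; exact hxA
  -- finiteness of J
  have hJfin : {ω | TyJ S E A0 ω}.Finite := by
    by_contra hinf
    obtain ⟨t, ht, hcard⟩ := Set.Infinite.exists_subset_card_eq hinf (S.c A0 + 1)
    have : ∀ᶠ A : Ch S E A0 in atTop, ∀ ω ∈ t, ω ∈ S.sep A.1 :=
      (Filter.eventually_all_finset t).2 fun ω hω => ht hω
    obtain ⟨A, hA⟩ := this.exists
    have h1 := Set.ncard_le_ncard (s := (t : Set Ω)) (t := S.sep A.1) hA (S.sep_fin A.2.1.1)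
    rw [Set.ncard_coe_finset, hcard] at h1
    have h2 := A.2.1.c_eq hA0
    simp only [c] at h2 h1
    omega
  set J : Set Ω := {ω | TyJ S E A0 ω ∧ ∀ᶠ n in atTop, ω ∈ S.sep (N (w n))} with hJdef
  have hJf : J.Finite := hJfin.subset fun ω h => h.1
  have hstatus : ∀ ω ∈ {ω | TyJ S E A0 ω}, ∀ᶠ n in atTop,
      (ω ∈ J ∧ ω ∈ S.sep (N (w n))) ∨ (ω ∉ J ∧ ω ∈ S.insd (N (w n))ᶜ) := by
    intro ω hω
    have hω : TyJ S E A0 ω := hω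
    by_cases hout : ∃ n, ω ∈ S.insd (N (w n))ᶜ
    · obtain ⟨n, hn⟩ := hout
      have hev : ∀ᶠ n in atTop, ω ∈ S.insd (N (w n))ᶜ := by
        filter_upwards [eventually_ge_atTop n] with k hk
        exact insd_mono (Set.compl_subset_compl.2 (hanti n k hk)) hn
      have hnJ : ω ∉ J := by
        intro h
        obtain ⟨k, h1, h2⟩ := (hev.and h.2).exists
        exact insd_not_sep' h1 (by rw [sep_compl']; exact h2)
      filter_upwards [hev] with n hn using Or.inr ⟨hnJ, hn⟩
    · push Not at hout
      have hin : ∃ n, ω ∉ S.insd (N (w n)) := by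
        by_contra hin
        push Not at hin
        obtain ⟨A, hA⟩ := hω.exists
        obtain ⟨n, hn⟩ := (hdis A).exists
        exact insd_not_sep' (insd_mono hn (hin n)) (by rw [sep_compl']; exact hA)
      obtain ⟨n0, hn0⟩ := hin
      have hev : ∀ᶠ n in atTop, ω ∈ S.sep (N (w n)) := by
        filter_upwards [eventually_ge_atTop n0] with k hk
        rcases tri (S := S) (N (w k)) ω with h | h | h
        · exact absurd (insd_mono (hanti n0 k hk) h) hn0
        · exact h
        · exact absurd h (hout k)
      filter_upwards [hev] with n hn using Or.inl ⟨⟨hω, hev⟩, hn⟩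
  have hgood := ((Filter.eventually_all_finite hJfin).2 hstatus).and (hdis ⟨A0, h00⟩)
  obtain ⟨i0, hi0⟩ := eventually_atTop.1 hgood
  clear hgood hstatus
  -- separated crossing elements
  have hcross : ∀ n ≥ i0, ∀ᶠ A : Ch S E A0 in atTop, S.sep A.1 ∩ S.sep (N (w n)) = J := by
    intro n hn
    have h1 : ∀ ω ∈ S.sep (N (w n)), ∀ᶠ A : Ch S E A0 in atTop, (ω ∈ S.sep A.1 ↔ TyJ S E A0 ω) := by
      intro ω hω
      rcases types (S := S) (E := E) (A0 := A0) ω with h | h | h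
      · have h2 : ¬ TyJ S E A0 ω := by
          intro h3
          obtain ⟨A, k1, k2⟩ := (h.and h3).exists
          exact insd_not_sep' k1 k2
        filter_upwards [h] with A hA
        exact iff_of_false (insd_not_sep' hA) h2
      · have h4 : ∀ A : Ch S E A0, ω ∉ S.sep A.1 := fun A hA =>
          insd_not_sep' (h A) (by rw [sep_compl']; exact hA)
        have h2 : ¬ TyJ S E A0 ω := fun h3 => by
          obtain ⟨A, k1⟩ := h3.exists
          exact h4 A k1
        exact Eventually.of_forall fun A => iff_of_false (h4 A) h2
      · have h' : ∀ᶠ A : Ch S E A0 in atTop, ω ∈ S.sep A.1 := h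
        filter_upwards [h'] with A hA using iff_of_true hA h
    filter_upwards [(Filter.eventually_all_finite (S.sep_fin (N_ainv (w n)))).2 h1] with A hA
    ext ω
    constructor
    · rintro ⟨k1, k2⟩
      rcases (hi0 n hn).1 ω ((hA ω k2).1 k1) with h | h
      · exact h.1
      · exact absurd k2 (by rw [← sep_compl']; exact insd_not_sep' h.2)
    · intro hω
      rcases (hi0 n hn).1 ω hω.1 with h | h
      · exact ⟨(hA ω h.2).2 hω.1, h.2⟩
      · exact absurd hω h.1
  -- the number ν
  have hex : ∃ ν, ∃ n ≥ i0, ∃ᶠ A : Ch S E A0 in atTop, (S.sep A.1 ∩ S.insd (N (w n))).ncard ≤ ν := by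
    refine ⟨S.c A0, i0, le_refl _, (Eventually.of_forall fun A => ?_).frequently⟩
    rw [← A.2.1.c_eq hA0]
    exact Set.ncard_le_ncard Set.inter_subset_left (S.sep_fin A.2.1.1)
  classical
  obtain ⟨ν, ⟨i1, hi1, hfr1⟩, hmin⟩ : ∃ ν, (∃ n ≥ i0, ∃ᶠ A : Ch S E A0 in atTop, (S.sep A.1 ∩ S.insd (N (w n))).ncard ≤ ν) ∧
      ∀ ν' < ν, ¬ ∃ n ≥ i0, ∃ᶠ A : Ch S E A0 in atTop, (S.sep A.1 ∩ S.insd (N (w n))).ncard ≤ ν' :=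
    ⟨Nat.find hex, Nat.find_spec hex, fun ν' h => Nat.find_min hex h⟩
  have hge : ∀ n ≥ i0, ∀ᶠ A : Ch S E A0 in atTop, ν ≤ (S.sep A.1 ∩ S.insd (N (w n))).ncard := by
    intro n hn
    by_contra hcon
    rw [Filter.not_eventually] at hcon
    obtain ⟨A, hA⟩ := hcon.exists
    refine hmin (ν - 1) (by omega) ⟨n, hn, hcon.mono fun A hA => by omega⟩
  have hmono : ∀ (A : Ch S E A0) i j, i ≤ j →
      (S.sep A.1 ∩ S.insd (N (w j))).ncard ≤ (S.sep A.1 ∩ S.insd (N (w i))).ncard := by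
    intro A i j hij
    exact Set.ncard_le_ncard (Set.inter_subset_inter_right _ (insd_mono (hanti i j hij)))
      ((S.sep_fin A.2.1.1).inter_of_left _)
  -- pigeonhole
  let Y : Set Ω := ⋃ e : ι × Bool, S.sep (N [e])
  have hYf : Y.Finite := Set.finite_iUnion fun e => S.sep_fin (N_ainv _)
  haveI : Finite Y := hYf.to_subtype
  haveI : Finite J := hJf.to_subtype
  let u : ℕ → FreeGroup ι := fun n => FreeGroup.mk (w n)
  have hNu : ∀ n, N (w (n + 1)) = ltr (u (n + 1)) (N [linv (d n)])ᶜ := by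
    intro n
    have := hred (n + 1)
    simp only [u]
    rw [hws] at this ⊢
    exact N_eq_ltr this
  have hYmem : ∀ n ω, ω ∈ S.sep (N (w (n + 1))) → (u (n + 1))⁻¹ • ω ∈ Y := by
    intro n ω hω
    rw [hNu, mem_sep_ltr (N_ainv _).compl, sep_compl'] at hω
    exact Set.mem_iUnion.2 ⟨_, hω⟩
  have hJsep : ∀ n ≥ i0, ∀ ω ∈ J, ω ∈ S.sep (N (w n)) := by
    intro n hn ω hω
    rcases (hi0 n hn).1 ω hω.1 with h | h
    · exact h.2
    · exact absurd hω h.1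
  let dat : ℕ → (ι × Bool) × (Y → Prop) × (J → Y) := fun n =>
    (d (i1 + n), fun υ => Ty1 S E A0 (u (i1 + n + 1) • υ.1),
      fun ω => ⟨(u (i1 + n + 1))⁻¹ • ω.1, hYmem _ _ (hJsep _ (by omega) _ ω.2)⟩)
  obtain ⟨a, b, hab, hdat⟩ := Set.finite_univ.exists_lt_map_eq_of_forall_mem (f := dat)
    (fun n => Set.mem_univ _)
  have hd := congrArg Prod.fst hdat
  have ht := congrArg (fun p => p.2.1) hdat
  have hf := congrArg (fun p => p.2.2) hdat
  simp only [dat] at hd ht hf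
  set i := i1 + a with hi
  set j := i1 + b with hj
  have hij : i < j := by omega
  set g := u (j + 1) * (u (i + 1))⁻¹ with hg
  have hg1 : g ≠ 1 := by
    intro h
    rw [hg, mul_inv_eq_one] at h
    have h2 := congrArg (fun x => x.toWord.length) h
    simp only [u, FreeGroup.toWord_mk, (hred _).reduce_eq, hlen] at h2
    omega
  have hgN : ltr g (N (w (i + 1))) = N (w (j + 1)) := by
    rw [hNu, hNu, ltr_ltr, hd, hg, inv_mul_cancel_right]
  have hfix : ∀ ω ∈ J, g • ω = ω := by
    intro ω hω
    have h1 := congrArg Subtype.val (congrFun hf ⟨ω, hω⟩)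
    simp only at h1
    rw [hg, mul_smul, h1, smul_inv_smul]
  have hcr : ∀ᶠ A : Ch S E A0 in atTop, ∀ ω ∈ S.sep (N (w (j + 1))), ω ∉ J →
      (ω ∈ S.insd A.1 ∧ ω ∈ S.insd (ltr g A.1)) ∨ (Ty2 S E A0 ω ∧ ω ∈ S.insd A.1ᶜ ∧ ω ∈ S.insd (ltr g A.1)ᶜ) := by
    refine (Filter.eventually_all_finite (S.sep_fin (N_ainv (w (j + 1))))).2 ?_
    intro ω hω
    by_cases hωJ : ω ∈ J
    · exact Eventually.of_forall fun A h => absurd hωJ h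
    have htr : Ty1 S E A0 (g⁻¹ • ω) ↔ Ty1 S E A0 ω := by
      have h1 := congrFun ht ⟨(u (j + 1))⁻¹ • ω, hYmem j ω hω⟩
      simp only [smul_inv_smul] at h1
      rw [← h1, hg, mul_inv_rev, inv_inv, mul_smul]
    have hNoJ : ∀ ω' n, n ≥ i0 → ω' ∈ S.sep (N (w n)) → ω' ∉ J → ¬ TyJ S E A0 ω' := by
      intro ω' n hn h1 h2 h3
      rcases (hi0 n hn).1 ω' h3 with h | h
      · exact h2 h.1
      · exact insd_not_sep' h.2 (by rw [sep_compl']; exact h1)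
    have hω' : g⁻¹ • ω ∈ S.sep (N (w (i + 1))) := by
      rw [← mem_sep_ltr (N_ainv _), hgN]; exact hω
    have hω'J : g⁻¹ • ω ∉ J := by
      intro h
      have := hfix _ h
      rw [smul_inv_smul] at this
      rw [← this] at h; exact hωJ h
    have n1 := hNoJ ω (j + 1) (by omega) hω hωJ
    have n2 := hNoJ (g⁻¹ • ω) (i + 1) (by omega) hω' hω'J
    by_cases h1 : Ty1 S E A0 ω
    · have h2 := htr.2 h1
      have h1 : ∀ᶠ A : Ch S E A0 in atTop, ω ∈ S.insd A.1 := h1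
      have h2 : ∀ᶠ A : Ch S E A0 in atTop, g⁻¹ • ω ∈ S.insd A.1 := h2
      filter_upwards [h1, h2] with A k1 k2 _
      refine Or.inl ⟨k1, ?_⟩
      rw [← insd_ltr A.2.1.1 g, smul_inv_smul] at k2
      exact k2
    · have h2 : ¬ Ty1 S E A0 (g⁻¹ • ω) := fun h => h1 (htr.1 h)
      have k1 : Ty2 S E A0 ω := ((types ω).resolve_left h1).resolve_right n1
      have k2 : Ty2 S E A0 (g⁻¹ • ω) := ((types _).resolve_left h2).resolve_right n2
      refine Eventually.of_forall fun A _ => Or.inr ⟨k1, k1 A, ?_⟩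
      have k2 := k2 A
      rw [← insd_ltr A.2.1.1.compl g, smul_inv_smul] at k2
      exact k2
  -- choose A
  have hfreq : ∃ᶠ A : Ch S E A0 in atTop, (S.sep A.1 ∩ S.insd (N (w (i + 1)))).ncard ≤ ν :=
    hfr1.mono fun A h => (hmono A i1 (i + 1) (by omega)).trans h
  obtain ⟨A, hA1, ⟨hA2, hA3⟩, ⟨hA4, hA5⟩, hA6⟩ := (hfreq.and_eventually
    (((hge (i + 1) (by omega)).and (hge (j + 1) (by omega))).and
    (((hcross (i + 1) (by omega)).and (hcross (j + 1) (by omega))).and hcr))).exists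
  have hni : (S.sep A.1 ∩ S.insd (N (w (i + 1)))).ncard = ν := le_antisymm hA1 hA2
  have hnj : (S.sep A.1 ∩ S.insd (N (w (j + 1)))).ncard = ν :=
    le_antisymm ((hmono A (i + 1) (j + 1) (by omega)).trans hA1) hA3
  have hbound : S.c A.1 ≤ 2 * ν + (J \ {E}).ncard := by
    obtain ⟨A1, hAA1, hinf⟩ := hwU (j + 1) A
    have hfreq' : ∃ᶠ A : Ch S E A0 in atTop, (S.sep A.1 ∩ S.insd (N (w (j + 1)))).ncard ≤ ν :=
      hfr1.mono fun A h => (hmono A i1 (j + 1) (by omega)).trans h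
    obtain ⟨A', h1, h2, h3⟩ := (hfreq'.and_eventually ((eventually_ge_atTop A1).and hcr)).exists
    have h2' : SubF A1.1 A'.1 := h2
    refine card_bound_step (m := 0) (N_ainv (w (j + 1))) A.2 A'.2 (hinf.mp ?_) hA5 hnj.le h1 ?_
    · filter_upwards [h2'] with x k1 k2 using ⟨k1 k2.1, k2.2⟩
    · intro ω k1 k2
      rcases hA6 ω k1 k2 with k3 | k3
      · exact Or.inl k3.1
      · exact Or.inr (k3.1 A')
  have hEA : E ∈ S.sep A.1 := A.2.sepE hE0
  have hν : 1 ≤ ν := by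
    by_contra h0
    have h1 : insert E J ⊆ S.sep A.1 := by
      rw [Set.insert_subset_iff]
      refine ⟨hEA, ?_⟩
      rw [← hA5]; exact Set.inter_subset_left
    have h2 := Set.ncard_le_ncard h1 (S.sep_fin A.2.1.1)
    have h3 : (J \ {E}).ncard + 1 = (insert E J).ncard := by
      rw [← Set.insert_diff_singleton, Set.ncard_insert_of_notMem (by simp) hJf.diff]
    simp only [c] at hbound
    omega
  have hEJ : E ∈ J ∨ E ∈ S.insd (N (w (i + 1)))ᶜ := by
    rcases (hi0 (i + 1) (by omega)).1 E (Eventually.of_forall fun A => A.2.sepE hE0) with h | h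
    · exact Or.inl h.1
    · exact Or.inr h.2
  refine core (g := g) hE0 hnc hst A.2 hg1 (N_ainv (w (i + 1))) (N_ainv (w (j + 1))) hgN
    (hanti _ _ (by omega)) (N_infinite (hred _) (by
      intro h; have := hlen (j + 1); rw [h] at this; simp at this)) hA4 hA5 hni hnj hν hbound
    (fun ω k1 k2 => (hA6 ω k1 k2).imp id fun k => k.2)
    hfix (fun B hB => hnosub B hB _) (fun B hB => hnosub B hB _) hEJ ?_
  filter_upwards [A.2.2] with x h1 h2 h3 h4
  exact (hi0 (i + 1) (by omega)).2 h4 ((h1 h2).2 h3)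

end
end HSys
end MV


namespace MV

section
variable {F : Type} [Group F] [IsMulTorsionFree F]

lemma stab_sub {P : Subgroup F} (hnc : ∃ a b : P, a * b ≠ b * a) {A : Set F} (aA : AInv A)
    (hs : Sep A P) {y : F} (hy : y ∈ P) (h : ∀ᶠ x in cofinite, x ∈ P → (x ∈ A ↔ y * x ∈ A)) :
    y = 1 := by
  let B : Set P := {p | (p : F) ∈ A}
  have hinj : Function.Injective (fun p : P => (p : F)) := Subtype.val_injective
  have hB : AInv B := fun p => hinj.tendsto_cofinite.eventually (aA p)
  have key : ∀ q : F → Prop, (∃ᶠ x in cofinite, q x ∧ x ∈ P) → ∃ᶠ p : P in cofinite, q p := by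
    intro q h h'
    apply h
    rw [Filter.eventually_cofinite] at h' ⊢
    refine (h'.image Subtype.val).subset ?_
    intro x hx
    simp only [not_not, Set.mem_setOf_eq] at hx
    exact ⟨⟨x, hx.2⟩, by simpa using hx.1, rfl⟩
  have hBn : Nontriv B := ⟨key _ hs.1, key _ hs.2⟩
  have h1 : ∀ᶠ p : P in cofinite, (p ∈ B ↔ (⟨y, hy⟩ : P) * p ∈ B) := by
    have := hinj.tendsto_cofinite.eventually h
    filter_upwards [this] with p hp using hp p.2
  have := stab_lemma hnc hB hBn h1
  exact congrArg Subtype.val this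

lemma center_trivial (hnc : ∃ a b : F, a * b ≠ b * a) {A : Set F} (hA : AInv A) (hn : Nontriv A)
    {y : F} (hy : ∀ x, y * x = x * y) : y = 1 :=
  stab_lemma hnc hA hn (by filter_upwards [hA y] with x hx; rw [hy]; exact hx)

end

namespace HSys

/-- System of fixed subgroups of a family of automorphisms in one outer class -/
structure FixSys {F : Type} [Group F] {Ω : Type} [MulAction F Ω] (S : HSys F Ω) (α : Ω → MulAut F) :
    Prop where
  fix : ∀ ω x, x ∈ S.P ω ↔ α ω x = x
  inj : Function.Injective α
  conj : ∀ g ω, α (g • ω) = MulAut.conj g * α ω * (MulAut.conj g)⁻¹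
  inner : ∀ ω ω', ∃ x, α ω = MulAut.conj x * α ω'
  nc : ∀ ω, ∃ a b : S.P ω, a * b ≠ b * a

lemma aut_conj {F : Type} [Group F] (e : MulAut F) (x : F) :
    e * MulAut.conj x = MulAut.conj (e x) * e := by
  ext y; simp

section
variable {F : Type} [Group F] [IsMulTorsionFree F] {Ω : Type} [MulAction F Ω] {S : HSys F Ω}
  {α : Ω → MulAut F}

lemma FixSys.sigma (hF : FixSys S α) (E : Ω) : ∃ σ : Ω → Ω, ∀ ω, α (σ ω) = (α E)⁻¹ * α ω * α E := by
  choose x hx using fun ω => hF.inner ω E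
  refine ⟨fun ω => ((α E)⁻¹ (x ω)) • ω, fun ω => ?_⟩
  rw [hF.conj, hx ω]
  ext y
  simp [MulAut.conj_apply, mul_assoc]

lemma FixSys.sigma' (hF : FixSys S α) (E : Ω) : ∃ σ : Ω → Ω, ∀ ω, α (σ ω) = α E * α ω * (α E)⁻¹ := by
  choose x hx using fun ω => hF.inner ω E
  refine ⟨fun ω => (x ω)⁻¹ • ω, fun ω => ?_⟩
  rw [hF.conj, hx ω]
  ext y
  simp [MulAut.conj_apply, mul_assoc]

lemma FixSys.c_img_aux (hF : FixSys S α) {e : MulAut F} {σ : Ω → Ω} (hσ : ∀ ω, α (σ ω) = e⁻¹ * α ω * e)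
    {A : Set F} (hA : AInv A) : (∀ ω, ω ∈ S.sep (img e A) ↔ σ ω ∈ S.sep A) ∧
      Function.Injective σ ∧ S.c (img e A) ≤ S.c A := by
  have h1 : ∀ ω, ω ∈ S.sep (img e A) ↔ σ ω ∈ S.sep A := by
    intro ω
    apply MV.sep_img
    intro x
    rw [hF.fix, hF.fix, hσ]
    have : e (e.symm x) = x := e.apply_symm_apply x
    simp only [MulAut.mul_apply, this]
    exact (e.symm.injective.eq_iff (a := (α ω) x) (b := x)).symm
  have h2 : Function.Injective σ := by
    intro a b hab
    apply hF.inj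
    have h1 := hσ a
    rw [hab, hσ b] at h1
    simpa using h1.symm
  refine ⟨h1, h2, ?_⟩
  rw [c, c, ← Set.ncard_image_of_injective _ h2]
  apply Set.ncard_le_ncard _ (S.sep_fin hA)
  rintro _ ⟨ω, hω, rfl⟩
  exact (h1 ω).1 hω

lemma FixSys.img_min (hF : FixSys S α) {A : Set F} (hA : S.Min A) (E : Ω) : S.Min (img (α E) A) := by
  obtain ⟨σ, hσ⟩ := hF.sigma E
  exact hA.of_le (hA.1.img _) (hA.2.1.img _) (hF.c_img_aux hσ hA.1).2.2

lemma FixSys.img_min' (hF : FixSys S α) {A : Set F} (hA : S.Min A) (E : Ω) : S.Min (img (α E)⁻¹ A) := by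
  obtain ⟨σ, hσ⟩ := hF.sigma' E
  exact hA.of_le (hA.1.img _) (hA.2.1.img _) (hF.c_img_aux (e := (α E)⁻¹) (by simpa using hσ) hA.1).2.2

lemma FixSys.pow_fix (hF : FixSys S α) {E : Ω} {x : F} (hx : x ∈ S.P E) (n : ℕ) : ((α E) ^ n) x = x := by
  induction n with
  | zero => rfl
  | succ n ih => rw [pow_succ, MulAut.mul_apply, (hF.fix _ _).1 hx, ih]

lemma FixSys.pow_fix' (hF : FixSys S α) {E : Ω} {x : F} (hx : x ∈ S.P E) (n : ℕ) : ((α E) ^ n).symm x = x := by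
  rw [MulEquiv.symm_apply_eq]; exact (hF.pow_fix hx n).symm

lemma FixSys.img_inC (hF : FixSys S α) {A0 A : Set F} {E : Ω} (hA : S.InC E A0 A) : S.InC E A0 (img (α E) A) := by
  refine ⟨hF.img_min hA.1 E, ?_⟩
  filter_upwards [hA.2] with x h1 h2
  have := hF.pow_fix' h2 1
  rw [pow_one] at this
  rw [mem_img, this]; exact h1 h2

lemma FixSys.img_inC' (hF : FixSys S α) {A0 A : Set F} {E : Ω} (hA : S.InC E A0 A) : S.InC E A0 (img (α E)⁻¹ A) := by
  refine ⟨hF.img_min' hA.1 E, ?_⟩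
  filter_upwards [hA.2] with x h1 h2
  have : (α E)⁻¹.symm x = x := (hF.fix _ _).1 h2
  rw [mem_img, this]; exact h1 h2

lemma FixSys.eq_of_c_one (hF : FixSys S α) {A B : Set F} {E : Ω} (hA : S.Min A) (hB : S.InC E A B)
    (hE : Sep A (S.P E)) (hc : S.c A = 1) : EqF A B := by
  have h := hA.chain_aux hB.1 hE hB.2
  have hBc := hB.1.c_eq hA
  have key : ∀ X Y : Set F, S.Min X → S.Min Y → S.c (X \ Y) = 0 → S.c X = 1 → SubF X Y := by
    intro X Y hX hY h0 h1
    apply sub_or _ hX.2.1.2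
    intro hn
    have := hX.2.2 _ (hX.1.diff hY.1) hn
    omega
  exact (key A B hA hB.1 (by omega) hc).antisymm (key B A hB.1 hA (by omega) (by omega))

end

/-- **Theorem K**. -/
theorem FixSys.thmK {ι : Type} [DecidableEq ι] [Fintype ι] {Ω : Type} [MulAction (FreeGroup ι) Ω]
    {S : HSys (FreeGroup ι) Ω} {α : Ω → MulAut (FreeGroup ι)} (hF : FixSys S α)
    {A0 : Set (FreeGroup ι)} (hA0 : S.Min A0) {E : Ω} (hE0 : Sep A0 (S.P E)) :
    S.sep A0 = {E} ∧ EqF (img (α E) A0) A0 := by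
  have hncF : ∃ a b : FreeGroup ι, a * b ≠ b * a := by
    obtain ⟨a, b, h⟩ := hF.nc E
    exact ⟨a, b, fun h' => h (Subtype.ext h')⟩
  have conj_inj : ∀ x y : FreeGroup ι, MulAut.conj x = MulAut.conj y → x = y := by
    intro x y h
    have : y⁻¹ * x = 1 := by
      apply center_trivial hncF hA0.1 hA0.2.1
      intro z
      have h1 := congrArg (fun e : MulAut (FreeGroup ι) => e z) h
      simp only [MulAut.conj_apply] at h1
      have : x * z = y * z * y⁻¹ * x := by rw [← h1]; group
      rw [mul_assoc, this]; group
    exact (inv_mul_eq_one.1 this).symm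
  have hst : ∀ ω (g : FreeGroup ι), g • ω = ω → g ∈ S.P ω := by
    intro ω g hg
    have h1 := hF.conj g ω
    rw [hg, eq_mul_inv_iff_mul_eq, aut_conj] at h1
    exact (hF.fix _ _).2 (conj_inj _ _ (mul_right_cancel h1))
  obtain ⟨O, hO, hmax⟩ := claimC hA0 hE0 (hF.nc E) (hst E)
  have hθ : EqF (img (α E) O) O := by
    apply SubF.antisymm (hmax _ (hF.img_inC hO))
    have h1 := (hmax _ (hF.img_inC' hO)).img (α E)
    rwa [← img_mul, mul_inv_cancel, img_one] at h1
  have hθn : ∀ n : ℕ, EqF (img ((α E) ^ n) O) O := by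
    intro n
    induction n with
    | zero => exact EqF.refl _
    | succ n ih =>
      rw [pow_succ', img_mul]
      exact (ih.img _).trans hθ
  obtain ⟨σ, hσ⟩ := hF.sigma E
  obtain ⟨hs1, hs2, -⟩ := hF.c_img_aux hσ hO.1.1
  rw [sep_congr' hθ] at hs1
  have hsing : ∀ ω ∈ S.sep O, ω = E := by
    intro ω hω
    have hit : ∀ n, σ^[n] ω ∈ S.sep O := by
      intro n
      induction n with
      | zero => exact hω
      | succ n ih => rw [Function.iterate_succ_apply']; exact (hs1 _).1 ih
    obtain ⟨a, b, hab, heq⟩ := (S.sep_fin hO.1.1).exists_lt_map_eq_of_forall_mem hit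
    obtain ⟨n, rfl⟩ := Nat.exists_eq_add_of_lt hab
    rw [show a + n + 1 = a + (n + 1) by ring, Function.iterate_add_apply] at heq
    have heq := hs2.iterate a heq
    have hαit : ∀ k, α (σ^[k] ω) = ((α E) ^ k)⁻¹ * α ω * (α E) ^ k := by
      intro k
      induction k with
      | zero => simp
      | succ k ih =>
        rw [Function.iterate_succ_apply', hσ, ih, pow_succ]; group
    set N := n + 1 with hN
    set η := α ω with hη
    have hcomm : (α E) ^ N * η = η * (α E) ^ N := by
      have := hαit N
      rw [← heq, ← hη] at this
      nth_rewrite 1 [this]; group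
    obtain ⟨x, hx⟩ := hF.inner E ω
    rw [← hη] at hx
    have hpow : ∀ k : ℕ, ∃ y, (α E) ^ k = MulAut.conj y * η ^ k := by
      intro k
      induction k with
      | zero => exact ⟨1, by simp⟩
      | succ k ih =>
        obtain ⟨y, hy⟩ := ih
        refine ⟨x * η y, ?_⟩
        rw [pow_succ', hy, map_mul, pow_succ']
        nth_rewrite 1 [hx]
        rw [mul_assoc, ← mul_assoc η, aut_conj]; simp only [mul_assoc]
    obtain ⟨y, hy⟩ := hpow N
    have hyf : η y = y := by
      rw [hy, ← mul_assoc, aut_conj, mul_assoc, mul_assoc, ← pow_succ, ← pow_succ'] at hcomm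
      exact (conj_inj _ _ (mul_right_cancel hcomm)).symm
    have hyP : y ∈ S.P ω := (hF.fix _ _).2 hyf
    have h1 := hθn N
    rw [hy, img_mul] at h1
    have h2 := (((hO.1.1.img (η ^ N)).conj_eqF y).symm.trans h1)
    have h2' : ∀ᶠ x in cofinite, (y⁻¹ * x ∈ img (η ^ N) O ↔ x ∈ O) := h2
    have hy1 : y⁻¹ = 1 := by
      apply stab_sub (hF.nc ω) hO.1.1 hω (inv_mem hyP)
      filter_upwards [h2'] with z hz hzP
      rw [mem_img, hF.pow_fix' (mul_mem (inv_mem hyP) hzP)] at hz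
      exact hz.symm
    have hy1 : y = 1 := by simpa using hy1
    have hηN : EqF (img (η ^ N) O) O := by
      subst hy1; simpa [img_one] using h1
    have hη1 : S.InC ω O (img η O) := hF.img_inC ⟨hO.1, Eventually.of_forall fun _ _ => Iff.rfl⟩
    have hηO : EqF (img η O) O := by
      rcases hO.1.chain hη1.1 hω hη1.2 with h | h
      · have hk : ∀ k : ℕ, SubF (img η O) (img (η ^ (k + 1)) O) := by
          intro k
          induction k with
          | zero => simpa using SubF.refl _
          | succ k ih =>
            refine ih.trans ?_
            rw [pow_succ (η) (k+1), img_mul]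
            exact h.img _
        exact SubF.antisymm ((hk n).trans hηN.subF) h
      · have hk : ∀ k : ℕ, SubF (img (η ^ (k + 1)) O) (img η O) := by
          intro k
          induction k with
          | zero => simpa using SubF.refl _
          | succ k ih =>
            refine SubF.trans ?_ ih
            rw [pow_succ (η) (k+1), img_mul]
            exact h.img _
        exact SubF.antisymm h (hηN.symm.subF.trans (hk n))
    have hx1 : x⁻¹ = 1 := by
      apply stab_lemma hncF hO.1.1 hO.1.2.1
      have k1 : EqF (img (α E) O) (ltr x O) := by
        rw [hx, img_mul]
        exact ((hO.1.1.img η).conj_eqF x).trans (hηO.ltr x)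
      exact (hθ.symm.trans k1)
    have hx1 : x = 1 := by simpa using hx1
    subst hx1
    apply hF.inj
    rw [← hη, hx]; simp
  have hEO : E ∈ S.sep O := hO.sepE hE0
  have hc : S.c A0 = 1 := by
    rw [hA0.c_eq hO.1, c, Set.ncard_eq_one]
    exact ⟨E, Set.eq_singleton_iff_unique_mem.2 ⟨hEO, hsing⟩⟩
  refine ⟨?_, (hF.eq_of_c_one hA0 (hF.img_inC ⟨hA0, Eventually.of_forall fun _ _ => Iff.rfl⟩) hE0 hc).symm⟩
  rw [c, Set.ncard_eq_one] at hc
  obtain ⟨e, he⟩ := hc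
  have : E ∈ S.sep A0 := hE0
  rw [he] at this ⊢
  rw [Set.mem_singleton_iff.1 this]

end HSys
end MV


namespace MV
open FreeGroup (of)

section
variable {ι : Type} [DecidableEq ι]

/-- elements whose first letter lies in `Z` -/
def UU (Z : Set (ι × Bool)) : Set (FreeGroup ι) := {g | ∃ d ∈ Z, g.toWord.head? = some d}

lemma N_one_iff {d : ι × Bool} {g : FreeGroup ι} : g ∈ N [d] ↔ g.toWord.head? = some d := by
  rw [mem_N]
  cases h : g.toWord with
  | nil => simp
  | cons a l => simp [eq_comm]

lemma UU_single (d : ι × Bool) : UU {d} = N [d] := by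
  ext g; simp [UU, N_one_iff]

lemma mem_UU {Z : Set (ι × Bool)} {g : FreeGroup ι} : g ∈ UU Z ↔ ∃ d ∈ Z, g ∈ N [d] := by
  simp [UU, N_one_iff]

lemma one_notMem_UU (Z : Set (ι × Bool)) : (1 : FreeGroup ι) ∉ UU Z := by
  simp [UU]

lemma lt1_mem_UU {Z : Set (ι × Bool)} {d : ι × Bool} : lt1 d ∈ UU Z ↔ d ∈ Z := by
  simp only [UU, toWord_lt1, Set.mem_setOf_eq, List.head?_cons, Option.some.injEq]
  exact ⟨fun ⟨a, h, k⟩ => k ▸ h, fun h => ⟨d, h, rfl⟩⟩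

lemma lt1_ne_one (d : ι × Bool) : lt1 d ≠ 1 := by
  intro h
  have := congrArg FreeGroup.toWord h
  simp [toWord_lt1] at this

lemma lt1_inj {d d' : ι × Bool} : lt1 d = lt1 d' ↔ d = d' := by
  refine ⟨fun h => ?_, fun h => by rw [h]⟩
  have := congrArg FreeGroup.toWord h
  simpa [toWord_lt1] using this

lemma UU_mul {Z : Set (ι × Bool)} {h : FreeGroup ι} {t : ι × Bool} (h1 : h ≠ 1)
    (h2 : h * lt1 t ≠ 1) : h * lt1 t ∈ UU Z ↔ h ∈ UU Z := by
  have h1' : h.toWord ≠ [] := by simpa using h1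
  have h2' : (h * lt1 t).toWord ≠ [] := by simpa using h2
  simp only [UU, Set.mem_setOf_eq]
  rcases toWord_mul_lt1 h t with ⟨_, k⟩ | ⟨l, k1, k2⟩
  · rw [k, List.head?_append_of_ne_nil _ h1']
  · rw [k2] at h2' ⊢
    rw [k1, List.head?_append_of_ne_nil _ h2']

/-- two sets with the same coboundary -/
lemma coboundary_ext {G : Type} [Group G] (α : FreeGroup ι ≃* G) {A B : Set G}
    (h1 : (1 : G) ∈ A ↔ (1 : G) ∈ B)
    (h2 : ∀ g i, ((g ∈ A ↔ g * α (of i) ∈ A) ↔ (g ∈ B ↔ g * α (of i) ∈ B))) : A = B := by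
  have key : ∀ (w : FreeGroup ι) (g : G), (g ∈ A ↔ g ∈ B) → (g * α w ∈ A ↔ g * α w ∈ B) := by
    intro w
    induction w using FreeGroup.induction_on with
    | C1 => intro g; simp
    | of i => intro g hg; have := h2 g i; tauto
    | inv_of i _ =>
      intro g hg
      have := h2 (g * α ((of i)⁻¹)) i
      rw [mul_assoc, ← map_mul] at this
      simp only [inv_mul_cancel, map_one, mul_one] at this
      tauto
    | mul x y hx hy =>
      intro g hg
      rw [map_mul, ← mul_assoc]
      exact hy _ (hx _ hg)
  ext g
  obtain ⟨w, rfl⟩ := α.surjective g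
  simpa using key w 1 h1

/-- Whitehead endomorphism -/
def whHom (x : ι × Bool) (f : ι × Bool → ℤ) : FreeGroup ι →* FreeGroup ι :=
  FreeGroup.lift fun i => if i = x.1 then of i else
    lt1 x ^ (- f (i, true)) * of i * lt1 x ^ (f (i, false))

lemma whHom_x (x : ι × Bool) (f : ι × Bool → ℤ) : whHom x f (lt1 x) = lt1 x := by
  obtain ⟨i, b⟩ := x
  cases b <;> simp [whHom, lt1_true, lt1_false]

lemma whHom_of (x : ι × Bool) (f : ι × Bool → ℤ) (i : ι) : whHom x f (of i) = if i = x.1 then of i else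
    lt1 x ^ (- f (i, true)) * of i * lt1 x ^ (f (i, false)) := by simp [whHom]

lemma whHom_comp (x : ι × Bool) (f f' : ι × Bool → ℤ) (hf : ∀ d, f d + f' d = 0) :
    (whHom x f).comp (whHom x f') = MonoidHom.id _ := by
  ext i
  simp only [MonoidHom.comp_apply, whHom_of, MonoidHom.id_apply]
  by_cases h : i = x.1
  · simp [h, whHom_of]
  · simp only [h, if_false, map_mul, map_zpow, whHom_x, whHom_of]
    have h1 : f' (i, true) = - f (i, true) := by linarith [hf (i, true)]
    have h2 : f' (i, false) = - f (i, false) := by linarith [hf (i, false)]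
    rw [h1, h2]; group

/-- Whitehead automorphism -/
def wh (x : ι × Bool) (f : ι × Bool → ℤ) : MulAut (FreeGroup ι) :=
  MonoidHom.toMulEquiv (whHom x f) (whHom x (fun d => - f d))
    (whHom_comp _ _ _ (by simp)) (whHom_comp _ _ _ (by simp))

lemma wh_x (x : ι × Bool) (f : ι × Bool → ℤ) : wh x f (lt1 x) = lt1 x := whHom_x x f
lemma wh_of (x : ι × Bool) (f : ι × Bool → ℤ) (i : ι) : wh x f (of i) = if i = x.1 then of i else
    lt1 x ^ (- f (i, true)) * of i * lt1 x ^ (f (i, false)) := whHom_of x f i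

lemma N_mul_true {d : ι × Bool} {h : FreeGroup ι} {i : ι} (hi : i ≠ d.1) :
    h * of i ∈ N [d] ↔ h ∈ N [d] := by
  rw [← UU_single, ← lt1_true]
  by_cases h1 : h = 1
  · subst h1
    rw [one_mul, lt1_mem_UU]
    simp only [one_notMem_UU, iff_false, Set.mem_singleton_iff]
    rintro rfl; exact hi rfl
  by_cases h2 : h * lt1 (i, true) = 1
  · have : h = lt1 (i, false) := by rw [lt1_false, ← lt1_true]; exact eq_inv_of_mul_eq_one_left h2
    rw [h2, this, lt1_mem_UU]
    simp only [one_notMem_UU, false_iff, Set.mem_singleton_iff]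
    rintro rfl; exact hi rfl
  · exact UU_mul h1 h2

lemma N_mul_false {d : ι × Bool} {h : FreeGroup ι} {i : ι} (hi : i ≠ d.1) :
    h * (of i)⁻¹ ∈ N [d] ↔ h ∈ N [d] := by
  rw [← N_mul_true (h := h * (of i)⁻¹) hi]; simp

lemma N_mul_lt1' {d t : ι × Bool} {h : FreeGroup ι} (hi : t.1 ≠ d.1) :
    h * lt1 t ∈ N [d] ↔ h ∈ N [d] := by
  obtain ⟨i, b⟩ := t
  cases b
  · exact N_mul_false hi
  · exact N_mul_true hi

lemma N_mul_zpow {d t : ι × Bool} (hi : t.1 ≠ d.1) (k : ℤ) (h : FreeGroup ι) :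
    h * lt1 t ^ k ∈ N [d] ↔ h ∈ N [d] := by
  have hinv : ∀ h, h * (lt1 t)⁻¹ ∈ N [d] ↔ h ∈ N [d] := fun h => by
    rw [← N_mul_lt1' (h := h * (lt1 t)⁻¹) hi]; simp
  induction k using Int.induction_on with
  | zero => simp
  | succ k ih => rw [zpow_add_one, ← mul_assoc]; exact (N_mul_lt1' hi).trans ih
  | pred k ih => rw [zpow_sub_one, ← mul_assoc]; exact (hinv _).trans ih

lemma N_change_true {i : ι} {h : FreeGroup ι} :
    (h ∈ N [(i, true)] ↔ h * of i ∈ N [(i, true)]) ↔ h ≠ 1 := by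
  rw [← UU_single, ← lt1_true]
  by_cases h1 : h = 1
  · subst h1
    simp [one_notMem_UU, lt1_mem_UU]
  by_cases h2 : h * lt1 (i, true) = 1
  · have : h = lt1 (i, false) := by rw [lt1_false, ← lt1_true]; exact eq_inv_of_mul_eq_one_left h2
    rw [h2, this, lt1_mem_UU]
    simp [one_notMem_UU, lt1_ne_one]
  · simp [h1, UU_mul h1 h2]

/-- Whitehead image of another first-level half tree -/
lemma wh_N_other (x : ι × Bool) (f : ι × Bool → ℤ) {i : ι} (hi : i ≠ x.1) :
    img (wh x f) (N [(i, true)]) = ltr (lt1 x ^ (- f (i, true))) (N [(i, true)]) := by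
  have hxi : x.1 ≠ ((i, true) : ι × Bool).1 := fun h => hi h.symm
  apply coboundary_ext (wh x f)
  · simp only [mem_img, mem_ltr, map_one, mul_one]
    rw [show (lt1 x ^ (-f (i, true)))⁻¹ = 1 * lt1 x ^ f (i, true) by rw [zpow_neg]; simp, N_mul_zpow hxi]
  · intro g j
    obtain ⟨k, rfl⟩ := (wh x f).surjective g
    simp only [mem_img, mem_ltr, ← map_mul, MulEquiv.symm_apply_apply]
    rw [map_mul, wh_of]
    by_cases hji : j = i
    · subst hji
      rw [N_change_true, if_neg hi, ← mul_assoc, ← mul_assoc, N_mul_zpow hxi, ← mul_assoc]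
      rw [← N_mul_zpow hxi (- f (j, true)), N_change_true]
      have : (lt1 x ^ (-f (j, true)))⁻¹ * (wh x f) k * lt1 x ^ (-f (j, true)) = 1 ↔ k = 1 := by
        have := conj_eq_one_iff (a := (lt1 x ^ (-f (j, true)))⁻¹) (b := (wh x f) k)
        rw [inv_inv] at this
        rw [this]; simp
      exact not_congr this.symm
    · have hj : j ≠ ((i, true) : ι × Bool).1 := hji
      rw [N_mul_true hj]
      split_ifs with h
      · rw [← mul_assoc, N_mul_true hj]; simp
      · simp only [← mul_assoc]
        rw [N_mul_zpow hxi, N_mul_true hj, N_mul_zpow hxi]; simp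

lemma UU_change (Z : Set (ι × Bool)) (h : FreeGroup ι) (t : ι × Bool) :
    (h * lt1 t ∈ UU Z ↔ (h = 1 ∧ t ∈ Z) ∨ (h ≠ 1 ∧ h ≠ lt1 (linv t) ∧ h ∈ UU Z)) := by
  by_cases h1 : h = 1
  · subst h1; simp [lt1_mem_UU]
  by_cases h2 : h = lt1 (linv t)
  · subst h2; simp [lt1_linv, one_notMem_UU, lt1_ne_one]
  have : h * lt1 t ≠ 1 := by
    intro h3; apply h2; rw [lt1_linv]; exact eq_inv_of_mul_eq_one_left h3
  rw [UU_mul h1 this]; simp [h1, h2]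

open Classical in
/-- Whitehead image of the first-level half tree of the special letter -/
lemma wh_N_x {x : ι × Bool} {Z : Set (ι × Bool)} (hx : x ∈ Z) (hx' : linv x ∉ Z) :
    img (wh x (fun d => if d ∈ Z then 1 else 0)) (N [x]) = UU Z := by
  set f : ι × Bool → ℤ := fun d => if d ∈ Z then 1 else 0 with hf
  apply coboundary_ext (wh x f)
  · simp only [mem_img, map_one, ← UU_single, one_notMem_UU]
  · intro g j
    obtain ⟨k, rfl⟩ := (wh x f).surjective g
    simp only [mem_img, ← map_mul, MulEquiv.symm_apply_apply]
    rw [map_mul, wh_of]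
    by_cases hj : j = x.1
    · rw [if_pos hj]
      have e1 : (wh x f) k = 1 ↔ k = 1 := by simp
      have e2 : (wh x f) k = lt1 x ↔ k = lt1 x := by
        rw [← (wh x f).injective.eq_iff (a := k), wh_x]
      obtain ⟨i, b⟩ := x
      simp only at hj
      subst hj
      cases b
      · rw [← UU_single, show of j = lt1 (linv (j, false)) from rfl]
        rw [UU_change, UU_change, linv_linv]
        by_cases h1 : k = 1
        · subst h1; simp [one_notMem_UU, hx', linv_ne]
        by_cases h2 : k = lt1 (j, false)
        · subst h2
          rw [e2.2 rfl]
          simp [lt1_mem_UU, lt1_ne_one, hx]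
        · have h2' := mt e2.1 h2
          simp [h1, h2, h2']
      · rw [← UU_single, show of j = lt1 (j, true) from rfl]
        rw [UU_change, UU_change]
        have e3 : (wh (j, true) f) k = lt1 (linv (j, true)) ↔ k = lt1 (linv (j, true)) := by
          rw [lt1_linv, ← (wh (j, true) f).injective.eq_iff (a := k), map_inv, wh_x]
        by_cases h1 : k = 1
        · subst h1; simp [one_notMem_UU, hx]
        by_cases h2 : k = lt1 (linv (j, true))
        · rw [e3.2 h2]
          subst h2
          simp [lt1_mem_UU, lt1_ne_one, hx', linv_ne]
        · have h2' := mt e3.1 h2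
          simp [h1, h2, h2']
    · rw [if_neg hj, N_mul_true hj]
      generalize (wh x f) k = h
      simp only [true_iff, iff_self]
      have hxj : ∀ b, (j, b) ≠ x := fun b h => hj (by rw [← h])
      have hxj' : ∀ b, (j, b) ≠ linv x := fun b h => hj (by rw [show j = (linv x).1 by rw [← h]]; rfl)
      have s1 : ∀ h, h ≠ lt1 x → (h * (lt1 x)⁻¹ ∈ UU Z ↔ h ∈ UU Z) := by
        intro h hh
        rw [← lt1_linv, UU_change, linv_linv]
        by_cases h1 : h = 1
        · subst h1; simp [hx', one_notMem_UU]
        · simp [h1, hh]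
      have s2 : ∀ h, h ≠ 1 → (h * lt1 x ∈ UU Z ↔ h ∈ UU Z) := by
        intro h hh
        rw [UU_change]
        by_cases h1 : h = lt1 (linv x)
        · subst h1; simp [hx', lt1_mem_UU, lt1_ne_one]
        · simp [h1, hh]
      have s3 : ∀ h, h ≠ 1 → h ≠ lt1 (j, false) → (h * of j ∈ UU Z ↔ h ∈ UU Z) := by
        intro h h1 h2
        rw [← lt1_true, UU_change]; simp [linv, h1, h2]
      have t1 : of j ∈ UU Z ↔ (j, true) ∈ Z := by rw [← lt1_true, lt1_mem_UU]
      have t2 : (of j)⁻¹ ∈ UU Z ↔ (j, false) ∈ Z := by rw [← lt1_false, lt1_mem_UU]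
      have t3 : lt1 x ∈ UU Z := lt1_mem_UU.2 hx
      have t4 := one_notMem_UU Z
      have n1 : of j ≠ lt1 x := by rw [← lt1_true, Ne, lt1_inj]; exact hxj _
      have n2 : (of j)⁻¹ ≠ lt1 x := by rw [← lt1_false, Ne, lt1_inj]; exact hxj _
      have n3 : of j ≠ 1 := by rw [← lt1_true]; exact lt1_ne_one _
      have n4 : lt1 x ≠ 1 := lt1_ne_one _
      have n5 : (of j)⁻¹ * lt1 x ≠ 1 := fun h => n1 (inv_mul_eq_one.1 h)
      rw [lt1_false] at s3
      -- first half
      have a1 : ∀ h, h ≠ lt1 x ^ (f (j, true)) → h ≠ (of j)⁻¹ * lt1 x ^ (f (j, true)) →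
          (h * lt1 x ^ (- f (j, true)) * of j ∈ UU Z ↔ h ∈ UU Z) := by
        intro h h1 h2
        rw [s3]
        · by_cases hz : (j, true) ∈ Z
          · simp only [hf, hz, if_true, zpow_one, zpow_neg] at h1 ⊢
            exact s1 _ h1
          · simp [hf, hz]
        · intro h3; apply h1; rw [zpow_neg] at h3; exact mul_inv_eq_one.1 h3
        · intro h3; apply h2; rw [zpow_neg] at h3; exact mul_inv_eq_iff_eq_mul.1 h3
      have a2 : ∀ h, h ≠ 1 → (h * lt1 x ^ (f (j, false)) ∈ UU Z ↔ h ∈ UU Z) := by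
        intro h h1
        by_cases hz : (j, false) ∈ Z
        · simp only [hf, hz, if_true, zpow_one]; exact s2 _ h1
        · simp [hf, hz]
      rw [← mul_assoc, ← mul_assoc]
      by_cases c1 : h = lt1 x ^ (f (j, true))
      · subst c1
        rw [← zpow_add, add_neg_cancel, zpow_zero, one_mul, a2 _ n3, t1]
        by_cases hz : (j, true) ∈ Z
        · simp [hf, hz, t3]
        · simp [hf, hz, t4]
      by_cases c2 : h = (of j)⁻¹ * lt1 x ^ (f (j, true))
      · subst c2
        have e1 : (of j)⁻¹ * lt1 x ^ f (j, true) * lt1 x ^ (-f (j, true)) * of j = 1 := by group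
        rw [e1, one_mul]
        have e2 : (of j)⁻¹ * lt1 x ^ f (j, true) ∈ UU Z ↔ (j, false) ∈ Z := by
          rw [← t2]
          by_cases hz : (j, true) ∈ Z
          · simp only [hf, hz, if_true, zpow_one]; exact s2 _ (by simpa using n3)
          · simp [hf, hz]
        rw [e2]
        by_cases hz : (j, false) ∈ Z
        · simp [hf, hz, t3]
        · simp [hf, hz, t4]
      · rw [a2, a1 h c1 c2]
        intro h3
        apply c2
        rw [mul_eq_one_iff_eq_inv, zpow_neg, mul_inv_eq_iff_eq_mul] at h3
        exact h3

end
end MV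


namespace MV
open FreeGroup (of)

/-- the formal properties of a separation number -/
structure CutFn {F : Type} [Group F] (c : Set F → ℕ) : Prop where
  congr : ∀ A B, EqF A B → c A = c B
  ltr : ∀ A, AInv A → ∀ g, c (ltr g A) = c A
  compl : ∀ A, c Aᶜ = c A
  submod : ∀ A B, AInv A → AInv B → c (A ∩ B) + c (A ∪ B) ≤ c A + c B

lemma HSys.cutFn {F : Type} [Group F] {Ω : Type} [MulAction F Ω] (S : HSys F Ω) : CutFn S.c :=
  ⟨fun A B h => HSys.c_congr h, fun A h g => HSys.c_ltr h g, HSys.c_compl,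
    fun A B h h' => HSys.c_inter_union h h'⟩

lemma CutFn.img {F : Type} [Group F] {c : Set F → ℕ} (h : CutFn c) (e : MulAut F) :
    CutFn (fun A => c (MV.img e A)) :=
  ⟨fun A B hAB => h.congr _ _ (hAB.img e), fun A hA g => by
    simp only [img_ltr]; exact h.ltr _ (hA.img e) _, fun A => h.compl _,
    fun A B hA hB => h.submod _ _ (hA.img e) (hB.img e)⟩

section
variable {ι : Type} [DecidableEq ι] [Fintype ι]

lemma N_append {L : List (ι × Bool)} {d : ι × Bool} (h : FreeGroup.IsReduced (L ++ [d])) :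
    N (L ++ [d]) = ltr (FreeGroup.mk L) (N [d]) := by
  have h1 := N_eq_ltr (L := []) (d := d) (by simp)
  rw [List.nil_append] at h1
  rw [N_eq_ltr h, h1, ltr_ltr]
  congr 1

lemma UU_ainv (Z : Set (ι × Bool)) : AInv (UU Z) := by
  intro g
  have : ∀ᶠ x in cofinite, ∀ d : ι × Bool, (x ∈ N [d] ↔ x * g ∈ N [d]) :=
    eventually_all.2 fun d => N_ainv [d] g
  filter_upwards [this] with x hx
  rw [mem_UU, mem_UU]
  simp only [hx]

/-- not mixed -/
def Mono (U : Set (FreeGroup ι)) (L : List (ι × Bool)) : Prop := SubF (N L) U ∨ SubF (N L) Uᶜ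

def Mixed (U : Set (FreeGroup ι)) : Set (List (ι × Bool)) := {L | ¬ Mono U L}

lemma Mono.mono {U : Set (FreeGroup ι)} {L L' : List (ι × Bool)} (h : Mono U L) (hL : L <+: L') :
    Mono U L' :=
  h.imp (fun h => h.mono fun x hx hN => hx (N_mono hL hN)) (fun h => h.mono fun x hx hN => hx (N_mono hL hN))

lemma Mixed_compl (U : Set (FreeGroup ι)) : Mixed Uᶜ = Mixed U := by
  ext L; simp only [Mixed, Mono, Set.mem_setOf_eq, compl_compl]; rw [or_comm]

lemma mixed_finite {U : Set (FreeGroup ι)} (hU : AInv U) : (Mixed U).Finite := by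
  obtain ⟨K, hK⟩ := deep hU
  refine (List.finite_length_lt (ι × Bool) K).subset ?_
  intro L hL
  by_contra hcon
  simp only [Set.mem_setOf_eq, not_lt] at hcon
  apply hL
  have := hK L hcon
  by_cases h : FreeGroup.mk L ∈ U
  · left; exact Eventually.of_forall fun x hx => (this x hx).2 h
  · right; exact Eventually.of_forall fun x hx h' => h ((this x hx).1 h')

lemma N_disjoint {L L' : List (ι × Bool)} {x : FreeGroup ι} (h : x ∈ N L) (h' : x ∈ N L') :
    L <+: L' ∨ L' <+: L := by
  rcases le_total L.length L'.length with hl | hl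
  · exact Or.inl (List.prefix_of_prefix_length_le h h' hl)
  · exact Or.inr (List.prefix_of_prefix_length_le h' h hl)

lemma ev_ne (a : FreeGroup ι) : ∀ᶠ x in cofinite, x ≠ a := by
  simpa using (Set.finite_singleton a).compl_mem_cofinite

variable {c : Set (FreeGroup ι) → ℕ}

lemma lemmaN_step (hc : CutFn c)
    (hW : ∀ x (Z : Set (ι × Bool)), x ∈ Z → linv x ∉ Z → c (N [x]) ≤ c (UU Z))
    {U : Set (FreeGroup ι)} (hU : AInv U) {L : List (ι × Bool)} {l : ι × Bool}
    (hmix : ¬ Mono U (L ++ [l])) (hmono : ∀ d, Mono U (L ++ [l] ++ [d]))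
    (hl : SubF (N (L ++ [l] ++ [l])) U) (hn : Nontriv U) :
    (∃ Z, Nontriv (UU Z) ∧ c (UU Z) ≤ c U) ∨
    (AInv (U ∪ N (L ++ [l])) ∧ Nontriv (U ∪ N (L ++ [l])) ∧ c (U ∪ N (L ++ [l])) ≤ c U ∧
      Mixed (U ∪ N (L ++ [l])) ⊂ Mixed U) := by
  set w := L ++ [l] with hw
  set B := N w with hB
  have hred : FreeGroup.IsReduced w := by
    by_contra h
    apply hmix
    left
    exact Eventually.of_forall fun x hx => absurd (N_red hx) h
  have hredd : ∀ d, FreeGroup.IsReduced (w ++ [d]) ↔ d ≠ linv l := by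
    intro d
    rw [red_snoc hred]
    constructor
    · rintro h rfl; exact h L (by simp [hw])
    · intro h l' hl'
      rw [hw] at hl'
      have := List.append_inj_right' hl' rfl
      simp at this
      apply h; rw [this]; simp
  -- local description
  have hloc : ∀ V : Set (FreeGroup ι), (∀ d, Mono V (w ++ [d])) →
      EqF (V ∩ B) (ltr (FreeGroup.mk w) (UU {d | d ≠ linv l ∧ SubF (N (w ++ [d])) V})) := by
    intro V hV
    have h1 : ∀ᶠ x in cofinite, ∀ d, (SubF (N (w ++ [d])) V → x ∈ N (w ++ [d]) → x ∈ V) ∧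
        (¬ SubF (N (w ++ [d])) V → x ∈ N (w ++ [d]) → x ∉ V) := by
      refine eventually_all.2 fun d => ?_
      by_cases h : SubF (N (w ++ [d])) V
      · have h' : ∀ᶠ x in cofinite, x ∈ N (w ++ [d]) → x ∈ V := h
        filter_upwards [h'] with x hx using ⟨fun _ => hx, fun k => absurd h k⟩
      · have h' : ∀ᶠ x in cofinite, x ∈ N (w ++ [d]) → x ∉ V := (hV d).resolve_left h
        filter_upwards [h'] with x hx using ⟨fun k => absurd k h, fun _ => hx⟩
    filter_upwards [h1, ev_ne (FreeGroup.mk w)] with x hx hxw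
    rw [mem_ltr, mem_UU]
    constructor
    · rintro ⟨k1, k2⟩
      rcases N_children k2 with h | ⟨d, hd⟩
      · exact absurd h hxw
      · have hdd := N_red hd
        refine ⟨d, ⟨(hredd d).1 hdd, ?_⟩, ?_⟩
        · by_contra hcon
          exact (hx d).2 hcon hd k1
        · rw [N_append hdd] at hd; exact hd
    · rintro ⟨d, ⟨k1, k2⟩, k3⟩
      have : x ∈ N (w ++ [d]) := by
        rw [N_append ((hredd d).2 k1)]; exact k3
      exact ⟨(hx d).1 k2 this, N_mono (List.prefix_append _ _) this⟩
  have hUB := hloc U hmono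
  set D : Set (ι × Bool) := {d | d ≠ linv l ∧ SubF (N (w ++ [d])) U}
  have hlD : l ∈ D := ⟨fun h => linv_ne l h.symm, hl⟩
  have hlD' : linv l ∉ D := fun h => h.1 rfl
  have c1 : c (N [l]) ≤ c (U ∩ B) := by
    rw [hc.congr _ _ hUB, hc.ltr _ (UU_ainv _)]
    exact hW _ _ hlD hlD'
  have c2 : c B = c (N [l]) := by
    have h1 := N_eq_ltr (L := []) (d := l) (by simp)
    rw [List.nil_append] at h1
    rw [hB, N_eq_ltr hred, hc.ltr _ (N_ainv _).compl, h1, hc.ltr _ (N_ainv _).compl]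
  have c3 := hc.submod U B hU (N_ainv w)
  by_cases hout : ∃ᶠ x in cofinite, x ∉ U ∪ B
  · right
    refine ⟨hU.union (N_ainv w), ⟨hn.1.mono fun x hx => Or.inl hx, hout⟩, by omega, ?_⟩
    rw [Set.ssubset_iff_of_subset]
    · refine ⟨w, hmix, ?_⟩
      simp only [Mixed, Set.mem_setOf_eq, not_not]
      left
      exact Eventually.of_forall fun x hx => Or.inr hx
    · intro L' hL' hm
      apply hL'
      by_cases h1 : w <+: L'
      · left; exact Eventually.of_forall fun x hx => Or.inr (N_mono h1 hx)
      by_cases h2 : L' <+: w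
      · exact absurd (hm.mono h2) hmix
      · rcases hm with h | h
        · left; filter_upwards [h] with x hx hN using Or.inl (hx hN)
        · right
          filter_upwards [h] with x hx hN
          rintro (h3 | h3)
          · exact hx hN h3
          · rcases N_disjoint hN h3 with h4 | h4
            · exact h2 h4
            · exact h1 h4
  · left
    have hout' : ∀ᶠ x in cofinite, ¬ (x ∉ U ∪ B) := by simpa only [Filter.not_frequently] using hout
    have hmc : ∀ d, Mono Uᶜ (w ++ [d]) := fun d => by
      have := hmono d
      simp only [Mono, compl_compl] at this ⊢
      exact this.symm
    have h1 := hloc Uᶜ hmc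
    have h2 : EqF Uᶜ (Uᶜ ∩ B) := by
      filter_upwards [hout'] with x hx
      simp only [Set.mem_inter_iff, Set.mem_compl_iff, Set.mem_union] at hx ⊢
      clear * - hx; tauto
    have h3 := h2.trans h1
    refine ⟨{d | d ≠ linv l ∧ SubF (N (w ++ [d])) Uᶜ}, ?_, ?_⟩
    · have := (hn.compl.congr h3).ltr (FreeGroup.mk w)⁻¹
      rwa [ltr_ltr, inv_mul_cancel, ltr_one] at this
    · rw [← hc.ltr _ (UU_ainv _) (FreeGroup.mk w), ← hc.congr _ _ h3, hc.compl]

lemma lemmaN_aux (hc : CutFn c)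
    (hW : ∀ x (Z : Set (ι × Bool)), x ∈ Z → linv x ∉ Z → c (N [x]) ≤ c (UU Z))
    (n : ℕ) : ∀ U : Set (FreeGroup ι), AInv U → Nontriv U → (Mixed U).ncard ≤ n →
    ∃ Z, Nontriv (UU Z) ∧ c (UU Z) ≤ c U := by
  induction n with
  | zero =>
    intro U hU hn h0
    exfalso
    have : Mixed U = ∅ := (Set.ncard_eq_zero (mixed_finite hU)).1 (by omega)
    have h1 : Mono U [] := by
      by_contra h
      have : [] ∈ Mixed U := h
      simp_all
    rcases h1 with h | h
    · apply hn.2; filter_upwards [h] with x hx using fun h' => h' (hx (by simp))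
    · apply hn.1; filter_upwards [h] with x hx using hx (by simp)
  | succ n ih =>
    intro U hU hn hcard
    have hne : (Mixed U).Nonempty := by
      refine ⟨[], ?_⟩
      rintro (h | h)
      · apply hn.2; filter_upwards [h] with x hx using fun h' => h' (hx (by simp))
      · apply hn.1; filter_upwards [h] with x hx using hx (by simp)
    obtain ⟨w, hw, hmax⟩ := (mixed_finite hU).exists_maximalFor List.length _ hne
    have hmono : ∀ d, Mono U (w ++ [d]) := by
      intro d
      by_contra h
      have := hmax (j := w ++ [d]) h (by simp)
      simp at this
    rcases List.eq_nil_or_concat' w with rfl | ⟨L, l, rfl⟩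
    · refine ⟨{d | SubF (N [d]) U}, ?_⟩
      have hE : EqF U (UU {d | SubF (N [d]) U}) := by
        have h1 : ∀ᶠ x in cofinite, ∀ d, (SubF (N [d]) U → x ∈ N [d] → x ∈ U) ∧
            (¬ SubF (N [d]) U → x ∈ N [d] → x ∉ U) := by
          refine eventually_all.2 fun d => ?_
          by_cases h : SubF (N [d]) U
          · have h' : ∀ᶠ x in cofinite, x ∈ N [d] → x ∈ U := h
            filter_upwards [h'] with x hx using ⟨fun _ => hx, fun k => absurd h k⟩
          · have h' : ∀ᶠ x in cofinite, x ∈ N [d] → x ∉ U := (hmono d).resolve_left h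
            filter_upwards [h'] with x hx using ⟨fun k => absurd k h, fun _ => hx⟩
        filter_upwards [h1, ev_ne 1] with x hx hx1
        rw [mem_UU]
        constructor
        · intro k
          rcases N_children (L := []) (g := x) (by simp) with h | ⟨d, hd⟩
          · exact absurd h hx1
          · refine ⟨d, ?_, hd⟩
            by_contra hcon
            exact (hx d).2 hcon hd k
        · rintro ⟨d, hd, k⟩
          exact (hx d).1 hd k
      exact ⟨hn.congr hE, (hc.congr _ _ hE).ge⟩
    · have hmc : ∀ d, Mono Uᶜ (L ++ [l] ++ [d]) := fun d => by
        have := hmono d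
        simp only [Mono, compl_compl] at this ⊢
        exact this.symm
      rcases hmono l with h | h
      · rcases lemmaN_step hc hW hU hw hmono h hn with h1 | ⟨h1, h2, h3, h4⟩
        · exact h1
        · have := Set.ncard_lt_ncard h4 (mixed_finite hU)
          obtain ⟨Z, hZ, hZ'⟩ := ih _ h1 h2 (by omega)
          exact ⟨Z, hZ, hZ'.trans h3⟩
      · have hw' : ¬ Mono Uᶜ (L ++ [l]) := by
          have := hw
          rw [← Mixed_compl] at this; exact this
        rcases lemmaN_step hc hW hU.compl hw' hmc h hn.compl with h1 | ⟨h1, h2, h3, h4⟩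
        · rw [hc.compl] at h1; exact h1
        · rw [Mixed_compl U] at h4
          rw [hc.compl U] at h3
          have := Set.ncard_lt_ncard h4 (mixed_finite hU)
          obtain ⟨Z, hZ, hZ'⟩ := ih _ h1 h2 (by omega)
          exact ⟨Z, hZ, hZ'.trans h3⟩

end

section
variable {ι : Type} [DecidableEq ι] [Fintype ι]

lemma exists_wh_min {c : Set (FreeGroup ι) → ℕ} (hc : CutFn c) : ∃ e : MulAut (FreeGroup ι),
    ∀ x (Z : Set (ι × Bool)), x ∈ Z → linv x ∉ Z → c (img e (N [x])) ≤ c (img e (UU Z)) := by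
  classical
  let vol : MulAut (FreeGroup ι) → ℕ := fun e => ∑ i : ι, c (img e (N [(i, true)]))
  obtain ⟨e, he⟩ : ∃ e, ∀ e', vol e ≤ vol e' := ⟨Function.argmin vol, fun e' => Function.argmin_le vol e'⟩
  refine ⟨e, fun x Z hx hx' => ?_⟩
  set a := wh x (fun d => if d ∈ Z then 1 else 0) with ha
  have hc' := hc.img e
  have key : ∀ (c' : Set (FreeGroup ι) → ℕ), CutFn c' → ∀ b, c' (N [(x.1, b)]) = c' (N [x]) := by
    intro c' h b
    by_cases hb : b = x.2
    · rw [hb]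
    · have : (x.1, b) = linv x := by
        simp only [linv, Prod.mk.injEq, true_and]
        cases b <;> cases h2 : x.2 <;> simp_all
      rw [this]
      have h1 := N_eq_ltr (L := []) (d := x) (by simp)
      rw [List.nil_append] at h1
      rw [h1, h.ltr _ (N_ainv _).compl, h.compl]
  have h1 : vol (e * a) = ∑ i : ι, if i = x.1 then c (img e (UU Z)) else c (img e (N [(i, true)])) := by
    apply Finset.sum_congr rfl
    intro i _
    rw [img_mul]
    split_ifs with h
    · subst h
      rw [← wh_N_x hx hx']
      have h3 := key _ (hc'.img a) true
      exact h3
    · rw [ha, wh_N_other _ _ h]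
      exact hc'.ltr _ (N_ainv _) _
  have h2 := he (e * a)
  rw [h1, Finset.sum_ite, ] at h2
  have h3 : vol e = ∑ i : ι, if i = x.1 then c (img e (N [x])) else c (img e (N [(i, true)])) := by
    apply Finset.sum_congr rfl
    intro i _
    split_ifs with h
    · subst h; exact key _ hc' true
    · rfl
  rw [h3, Finset.sum_ite] at h2
  have h4 : (Finset.univ.filter fun i => i = x.1) = {x.1} := by ext; simp
  rw [h4] at h2
  simpa using h2

/-- **Lemma N**: a minimal set of standard form exists. -/
theorem lemmaN [Nonempty ι] {Ω : Type} [MulAction (FreeGroup ι) Ω] (S : HSys (FreeGroup ι) Ω) :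
    ∃ e : MulAut (FreeGroup ι), (∃ i, S.Min (img e (N [(i, true)]))) ∨
      ∃ X : Set ι, X.Nonempty ∧ Xᶜ.Nonempty ∧ S.Min (img e (UU {d | d.1 ∈ X})) := by
  obtain ⟨e, he⟩ := exists_wh_min S.cutFn
  refine ⟨e, ?_⟩
  have hNn : ∀ d : ι × Bool, Nontriv (N [d]) := fun d =>
    ⟨N_infinite (by simp) (by simp), N_compl_infinite (by simp)⟩
  obtain ⟨A, hA⟩ := HSys.exists_min (S := S) ⟨N [(Classical.arbitrary ι, true)], N_ainv _, hNn _⟩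
  obtain ⟨Z, hZ, hcZ⟩ := lemmaN_aux (S.cutFn.img e) he _ (img e⁻¹ A) (hA.1.img _) (hA.2.1.img _) le_rfl
  simp only [← img_mul, mul_inv_cancel, img_one] at hcZ
  by_cases hx : ∃ x ∈ Z, linv x ∉ Z
  · left
    obtain ⟨x, h1, h2⟩ := hx
    have h3 := he x Z h1 h2
    have h4 : S.Min (img e (N [x])) := hA.of_le ((N_ainv _).img _) ((hNn _).img _) (h3.trans hcZ)
    refine ⟨x.1, ?_⟩
    obtain ⟨i, b⟩ := x
    cases b
    · have h5 := N_eq_ltr (L := []) (d := (i, true)) (by simp)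
      rw [List.nil_append] at h5
      show S.Min (img e (N [(i, true)]))
      rw [h5, img_ltr, img_compl]
      exact h4.compl.ltr _
    · exact h4
  · right
    push Not at hx
    have hZX : Z = {d | d.1 ∈ {i | (i, true) ∈ Z}} := by
      ext ⟨i, b⟩
      cases b
      · simp only [Set.mem_setOf_eq]
        exact ⟨fun h => hx _ h, fun h => hx _ h⟩
      · rfl
    refine ⟨{i | (i, true) ∈ Z}, ?_, ?_, ?_⟩
    · by_contra hcon
      rw [Set.not_nonempty_iff_eq_empty] at hcon
      rw [hcon] at hZX
      apply hZ.1
      refine Eventually.of_forall fun x hx => ?_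
      rw [hZX, mem_UU] at hx
      simp at hx
    · by_contra hcon
      rw [Set.not_nonempty_iff_eq_empty, Set.compl_empty_iff] at hcon
      rw [hcon] at hZX
      apply hZ.2
      filter_upwards [ev_ne 1] with x hx1 hx
      apply hx
      rw [hZX, mem_UU]
      rcases N_children (L := []) (g := x) (by simp) with h | ⟨d, hd⟩
      · exact absurd h hx1
      · exact ⟨d, by simp, hd⟩
    · rw [← hZX]
      exact hA.of_le ((UU_ainv _).img _) (hZ.img _) hcZ

end
end MV


namespace MV
open FreeGroup (of)

/-- commutative subgroups of free groups are cyclic -/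
lemma comm_cyclic {F : Type} [Group F] [IsFreeGroup F] (H : Subgroup F)
    (h : ∀ a ∈ H, ∀ b ∈ H, a * b = b * a) : ∃ t, H = Subgroup.zpowers t := by
  have : IsFreeGroup H := inferInstance
  let X := IsFreeGroup.Generators H
  let e : FreeGroup X ≃* H := (IsFreeGroup.toFreeGroup H).symm
  have hcomm : ∀ a b : FreeGroup X, a * b = b * a := by
    intro a b
    apply e.injective
    rw [map_mul, map_mul]
    exact Subtype.ext (h _ (e a).2 _ (e b).2)
  have hsub : Subsingleton X := by
    refine ⟨fun a b => ?_⟩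
    by_contra hab
    classical
    have := congrArg FreeGroup.toWord (hcomm (of a) (of b))
    rw [show (of a : FreeGroup X) * of b = FreeGroup.mk [(a, true), (b, true)] from rfl,
      show (of b : FreeGroup X) * of a = FreeGroup.mk [(b, true), (a, true)] from rfl] at this
    simp [FreeGroup.toWord_mk, FreeGroup.reduce, hab, Ne.symm hab] at this
  have hcyc : ∃ g : FreeGroup X, ∀ x, x ∈ Subgroup.zpowers g := by
    rcases isEmpty_or_nonempty X with hX | ⟨⟨a⟩⟩
    · exact ⟨1, fun x => by
        have : x = 1 := Subsingleton.elim _ _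
        rw [this]; exact one_mem _⟩
    · haveI : Unique X := ⟨⟨a⟩, fun b => Subsingleton.elim _ _⟩
      exact IsCyclic.exists_generator
  obtain ⟨g, hg⟩ := hcyc
  refine ⟨(e g : F), le_antisymm ?_ ?_⟩
  · intro x hx
    obtain ⟨k, hk⟩ := Subgroup.mem_zpowers_iff.1 (hg (e.symm ⟨x, hx⟩))
    refine Subgroup.mem_zpowers_iff.2 ⟨k, ?_⟩
    have := congrArg (fun z => ((e z : H) : F)) hk
    simpa using this
  · rw [Subgroup.zpowers_le]; exact (e g).2

section
variable {ι : Type} [DecidableEq ι]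

lemma head_mul_mk (l : List (ι × Bool)) : ∀ a : FreeGroup ι, l.length < a.toWord.length →
    (a * FreeGroup.mk l).toWord.head? = a.toWord.head? := by
  induction l with
  | nil => intro a _; simp [← FreeGroup.one_eq_mk]
  | cons d l ih =>
    intro a ha
    have e1 : a * FreeGroup.mk (d :: l) = (a * lt1 d) * FreeGroup.mk l := by
      rw [mul_assoc]; rfl
    simp only [List.length_cons] at ha
    have h1 : a.toWord ≠ [] := by intro h; rw [h] at ha; simp at ha
    rcases toWord_mul_lt1 a d with ⟨_, k⟩ | ⟨m, k1, k2⟩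
    · rw [e1, ih _ (by rw [k]; simp; omega), k, List.head?_append_of_ne_nil _ h1]
    · have h2 : m.length = a.toWord.length - 1 := by rw [k1]; simp
      have h3 : m ≠ [] := by intro h; rw [h] at h2; simp at h2; omega
      rw [e1, ih _ (by rw [k2]; omega), k2, k1, List.head?_append_of_ne_nil _ h3]

lemma head_mul (a b : FreeGroup ι) (h : b.toWord.length < a.toWord.length) :
    (a * b).toWord.head? = a.toWord.head? := by
  have := head_mul_mk b.toWord a h
  rwa [FreeGroup.mk_toWord] at this

lemma length_mul (a b : FreeGroup ι) : (a * b).toWord.length ≤ a.toWord.length + b.toWord.length :=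
  FreeGroup.norm_mul_le a b

/-- the fixed subgroup -/
def Fix {F : Type} [Group F] (φ : F →* F) : Subgroup F where
  carrier := {g | φ g = g}
  mul_mem' := by intro a b ha hb; simp only [Set.mem_setOf_eq] at *; rw [map_mul, ha, hb]
  one_mem' := map_one φ
  inv_mem' := by intro a ha; simp only [Set.mem_setOf_eq] at *; rw [map_inv, ha]

lemma mem_Fix {F : Type} [Group F] {φ : F →* F} {g : F} : g ∈ Fix φ ↔ φ g = g := Iff.rfl

/-- flow step -/
def nxt (φ : FreeGroup ι →* FreeGroup ι) (p : FreeGroup ι) : FreeGroup ι :=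
  match (p⁻¹ * φ p).toWord.head? with
  | none => p
  | some d => p * lt1 d

lemma nxt_some {φ : FreeGroup ι →* FreeGroup ι} {p : FreeGroup ι} {d : ι × Bool}
    (h : (p⁻¹ * φ p).toWord.head? = some d) : nxt φ p = p * lt1 d := by
  simp [nxt, h]

lemma nxt_equiv {φ : FreeGroup ι →* FreeGroup ι} {h : FreeGroup ι} (hh : φ h = h) (p : FreeGroup ι) :
    nxt φ (h * p) = h * nxt φ p := by
  have : (h * p)⁻¹ * φ (h * p) = p⁻¹ * φ p := by rw [map_mul, hh]; group
  simp only [nxt, this]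
  split <;> simp [mul_assoc]

lemma nxt_iter {φ : FreeGroup ι →* FreeGroup ι} {h : FreeGroup ι} (hh : φ h = h) (k : ℕ) (p : FreeGroup ι) :
    (nxt φ)^[k] (h * p) = h * (nxt φ)^[k] p := by
  induction k with
  | zero => rfl
  | succ k ih => rw [Function.iterate_succ_apply', ih, nxt_equiv hh, Function.iterate_succ_apply']

/-- flow equivalence -/
def flo (φ : FreeGroup ι →* FreeGroup ι) (p q : FreeGroup ι) : Prop :=
  ∃ a b, (nxt φ)^[a] p = (nxt φ)^[b] q

lemma flo.symm {φ : FreeGroup ι →* FreeGroup ι} {p q : FreeGroup ι} (h : flo φ p q) : flo φ q p := by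
  obtain ⟨a, b, h⟩ := h; exact ⟨b, a, h.symm⟩
lemma flo.refl {φ : FreeGroup ι →* FreeGroup ι} (p : FreeGroup ι) : flo φ p p := ⟨0, 0, rfl⟩
lemma flo.trans {φ : FreeGroup ι →* FreeGroup ι} {p q r : FreeGroup ι} (h : flo φ p q)
    (h' : flo φ q r) : flo φ p r := by
  obtain ⟨a, b, h⟩ := h
  obtain ⟨c, d, h'⟩ := h'
  refine ⟨c + a, b + d, ?_⟩
  rw [Function.iterate_add_apply, h, ← Function.iterate_add_apply, add_comm c b,
    Function.iterate_add_apply, h', ← Function.iterate_add_apply]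
lemma flo.mul {φ : FreeGroup ι →* FreeGroup ι} {p q h : FreeGroup ι} (hp : flo φ p q)
    (hh : φ h = h) : flo φ (h * p) (h * q) := by
  obtain ⟨a, b, k⟩ := hp
  exact ⟨a, b, by rw [nxt_iter hh, nxt_iter hh, k]⟩
lemma flo.mul' {φ : FreeGroup ι →* FreeGroup ι} {p q h : FreeGroup ι} (hh : φ h = h)
    (hp : flo φ (h * p) (h * q)) : flo φ p q := by
  have := hp.mul (h := h⁻¹) (by rw [map_inv, hh])
  simpa using this

def floStab (φ : FreeGroup ι →* FreeGroup ι) (r : FreeGroup ι) : Subgroup (FreeGroup ι) where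
  carrier := {h | φ h = h ∧ flo φ r (h * r)}
  mul_mem' := by
    rintro a b ⟨ha, ha'⟩ ⟨hb, hb'⟩
    refine ⟨by rw [map_mul, ha, hb], ?_⟩
    rw [mul_assoc]
    exact ha'.trans (hb'.mul ha)
  one_mem' := ⟨map_one φ, by simpa using flo.refl r⟩
  inv_mem' := by
    rintro a ⟨ha, ha'⟩
    refine ⟨by rw [map_inv, ha], ?_⟩
    have := ha'.symm.mul (h := a⁻¹) (by rw [map_inv, ha])
    simpa using this

lemma floStab_comm (φ : FreeGroup ι →* FreeGroup ι) (r : FreeGroup ι) :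
    ∀ a ∈ floStab φ r, ∀ b ∈ floStab φ r, a * b = b * a := by
  have key : ∀ h ∈ floStab φ r, ∃ a b : ℕ, ∀ t, h * (nxt φ)^[t + b] r = (nxt φ)^[t + a] r := by
    rintro h ⟨h1, a, b, h2⟩
    refine ⟨a, b, fun t => ?_⟩
    rw [nxt_iter h1] at h2
    rw [Function.iterate_add_apply, Function.iterate_add_apply, h2, nxt_iter h1]
  intro h hh h' hh'
  obtain ⟨a, b, k⟩ := key h hh
  obtain ⟨a', b', k'⟩ := key h' hh'
  have e1 : h * h' * (nxt φ)^[b + b'] r = (nxt φ)^[a + a'] r := by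
    rw [mul_assoc, k' b, show b + a' = a' + b by ring, k, add_comm]
  have e2 : h' * h * (nxt φ)^[b + b'] r = (nxt φ)^[a + a'] r := by
    rw [mul_assoc, add_comm b b', k b', show b' + a = a + b' by ring, k']
  exact mul_right_cancel (e1.trans e2.symm)

variable [Fintype ι]

lemma flo_edge (φ : FreeGroup ι →* FreeGroup ι) : ∃ K : ℕ, ∀ p (x : ι × Bool),
    flo φ p (p * lt1 x) ∨ ((p⁻¹ * φ p).toWord.length ≤ K ∧
      ((p * lt1 x)⁻¹ * φ (p * lt1 x)).toWord.length ≤ K) := by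
  let C := Finset.univ.sup fun x : ι × Bool => (φ (lt1 x)).toWord.length
  have hC : ∀ x, (φ (lt1 x)).toWord.length ≤ C := fun x =>
    Finset.le_sup (f := fun x : ι × Bool => (φ (lt1 x)).toWord.length) (Finset.mem_univ x)
  refine ⟨2 * C + 1, fun p x => ?_⟩
  set u := p⁻¹ * φ p with hu
  have hv : (p * lt1 x)⁻¹ * φ (p * lt1 x) = lt1 (linv x) * u * φ (lt1 x) := by
    rw [map_mul, lt1_linv, hu]; group
  rw [hv]
  have hlen1 : (lt1 (linv x)).toWord.length = 1 := by rw [toWord_lt1]; rfl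
  by_cases hC' : u.toWord.length ≤ C
  · right
    have h1 := length_mul (lt1 (linv x) * u) (φ (lt1 x))
    have h2 := length_mul (lt1 (linv x)) u
    have h3 := hC x
    omega
  left
  rcases toWord_lt1_mul u (linv x) with ⟨h1, h2⟩ | ⟨l, h1, h2⟩
  · have h3 := head_mul (lt1 (linv x) * u) (φ (lt1 x)) (by
      have := hC x
      rw [h2]; simp; omega)
    rw [h2, List.head?_cons, ← hv] at h3
    refine ⟨0, 1, ?_⟩
    have := nxt_some h3
    simp only [Function.iterate_zero, id, Function.iterate_one]
    rw [this, lt1_linv]; simp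
  · rw [linv_linv] at h1
    refine ⟨1, 0, ?_⟩
    simp only [Function.iterate_zero, id, Function.iterate_one]
    exact nxt_some (by rw [← hu, h1]; rfl)

/-- **Fixed subgroups are finitely generated** (Goldstein–Turner). -/
theorem Fix_fg (φ : FreeGroup ι →* FreeGroup ι) : (Fix φ).FG := by
  classical
  obtain ⟨K, hK⟩ := flo_edge φ
  let I := {u : FreeGroup ι // u.toWord.length ≤ K ∧ ∃ p, p⁻¹ * φ p = u}
  haveI : Finite I := ((ball_finite (ι := ι) K).subset (fun u hu => hu.1)).to_subtype
  choose r hr using fun u : I => u.2.2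
  let u0 : I := ⟨1, by simp, 1, by simp⟩
  have hrep : ∀ p, (p⁻¹ * φ p).toWord.length ≤ K → ∃ (i : I) (h : FreeGroup ι), φ h = h ∧ p = h * r i := by
    intro p hp
    refine ⟨⟨_, hp, p, rfl⟩, p * (r ⟨_, hp, p, rfl⟩)⁻¹, ?_, by simp⟩
    have := hr ⟨_, hp, p, rfl⟩
    simp only at this
    rw [map_mul, map_inv]
    generalize r ⟨_, hp, p, rfl⟩ = q at *
    have e : φ q = q * (p⁻¹ * φ p) := by rw [← this]; group
    rw [e]; group
  choose t ht using fun i => comm_cyclic (floStab φ (r i)) (floStab_comm φ (r i))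
  let T1 : Set (FreeGroup ι) := {h | φ h = h ∧ ∃ (i j : I) (x : ι × Bool), r i * lt1 x = h * r j}
  let hij : I → I → FreeGroup ι := fun i j =>
    if h : ∃ h, φ h = h ∧ flo φ (r i) (h * r j) then h.choose else 1
  let T : Set (FreeGroup ι) := T1 ∪ Set.range (fun p : I × I => hij p.1 p.2) ∪ Set.range t ∪ {r u0}
  have hT1 : T1.Finite := by
    refine (Set.finite_range fun p : I × I × (ι × Bool) => r p.1 * lt1 p.2.2 * (r p.2.1)⁻¹).subset ?_
    rintro h ⟨_, i, j, x, hx⟩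
    exact ⟨(i, j, x), by simp only; rw [hx]; simp⟩
  have hTf : T.Finite := ((hT1.union (Set.finite_range _)).union (Set.finite_range _)).union (Set.finite_singleton _)
  have hu0 : φ (r u0) = r u0 := by
    have h : (r u0)⁻¹ * φ (r u0) = 1 := hr u0
    exact (inv_mul_eq_one.1 h).symm
  have hTfix : T ⊆ Fix φ := by
    rintro h (((hh | ⟨⟨i, j⟩, rfl⟩) | ⟨i, rfl⟩) | hh)
    · exact hh.1
    · simp only [hij]
      split_ifs with h
      · exact h.choose_spec.1
      · exact one_mem _
    · have : t i ∈ floStab φ (r i) := by rw [ht]; exact Subgroup.mem_zpowers _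
      exact this.1
    · rw [Set.mem_singleton_iff] at hh; subst hh; exact hu0
  set Q := Subgroup.closure T with hQ
  have hQfix : Q ≤ Fix φ := (Subgroup.closure_le _).2 hTfix
  have hkey : ∀ i j h, φ h = h → flo φ (r i) (h * r j) → h ∈ Q := by
    intro i j h h1 h2
    have hex : ∃ h, φ h = h ∧ flo φ (r i) (h * r j) := ⟨h, h1, h2⟩
    have e : hij i j = hex.choose := by simp only [hij]; rw [dif_pos hex]
    have k := hex.choose_spec
    rw [← e] at k
    have kQ : hij i j ∈ Q := Subgroup.subset_closure (Or.inl (Or.inl (Or.inr ⟨(i, j), rfl⟩)))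
    have : h * (hij i j)⁻¹ ∈ floStab φ (r i) := by
      refine ⟨by rw [map_mul, map_inv, h1, k.1], ?_⟩
      refine h2.trans ?_
      rw [mul_assoc]
      refine flo.mul ?_ h1
      have := k.2.symm.mul (h := (hij i j)⁻¹) (by rw [map_inv, k.1])
      simpa using this
    rw [ht] at this
    have hz : Subgroup.zpowers (t i) ≤ Q := by
      rw [Subgroup.zpowers_le]
      exact Subgroup.subset_closure (Or.inl (Or.inr ⟨i, rfl⟩))
    have := mul_mem (hz this) kQ
    simpa using this
  let C : Set (FreeGroup ι) := {p | ∃ q ∈ Q, ∃ i, flo φ p (q * r i)}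
  have hC1 : (1 : FreeGroup ι) ∈ C := by
    refine ⟨(r u0)⁻¹, inv_mem (Subgroup.subset_closure (Or.inr rfl)), u0, ?_⟩
    simpa using flo.refl _
  have hCstep : ∀ p ∈ C, ∀ x : ι × Bool, p * lt1 x ∈ C := by
    rintro p ⟨q, hq, i, hp⟩ x
    rcases hK p x with h | ⟨h1, h2⟩
    · exact ⟨q, hq, i, h.symm.trans hp⟩
    · obtain ⟨j, h, hh, hpj⟩ := hrep _ h1
      obtain ⟨k, h', hh', hpk⟩ := hrep _ h2
      have hqf := hQfix hq
      have a1 : q⁻¹ * h ∈ Q := by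
        apply hkey i j _ (by rw [map_mul, map_inv, hh, hqf])
        apply flo.mul' hqf
        rw [hpj] at hp
        simpa [mul_assoc] using hp.symm
      have a2 : h ∈ Q := by simpa using mul_mem hq a1
      have a3 : h⁻¹ * h' ∈ Q := by
        apply Subgroup.subset_closure
        refine Or.inl (Or.inl (Or.inl ⟨by rw [map_mul, map_inv, hh, hh'], j, k, x, ?_⟩))
        rw [hpj] at hpk
        rw [mul_assoc, ← hpk]; group
      have a4 : h' ∈ Q := by simpa using mul_mem a2 a3
      exact ⟨h', a4, k, by rw [hpk]; exact flo.refl _⟩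
  have hCall : ∀ w p : FreeGroup ι, p ∈ C → p * w ∈ C := by
    intro w
    induction w using FreeGroup.induction_on with
    | C1 => intro p hp; simpa using hp
    | of i => intro p hp; exact hCstep p hp (i, true)
    | inv_of i _ => intro p hp; exact hCstep p hp (i, false)
    | mul x y hx hy => intro p hp; rw [← mul_assoc]; exact hy _ (hx _ hp)
  have : Fix φ = Q := by
    apply le_antisymm _ hQfix
    intro h hh
    have hr0 : r u0 ∈ Q := Subgroup.subset_closure (Or.inr rfl)
    obtain ⟨q, hq, i, hp⟩ := hCall h 1 hC1
    rw [one_mul] at hp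
    have hqf := hQfix hq
    have hh : φ h = h := hh
    have a1 : q⁻¹ * (h * (r u0)⁻¹) ∈ Q := by
      apply hkey i u0 _ (by rw [map_mul, map_mul, map_inv, map_inv, hh, hqf, hu0])
      apply flo.mul' hqf
      simpa [mul_assoc] using hp.symm
    have := mul_mem (mul_mem hq a1) hr0
    simpa using this
  rw [this]
  exact ⟨hTf.toFinset, by simp [hQ]⟩

end
end MV


namespace MV
open FreeGroup (of)

/-- conjugate subgroup -/
def cj {F : Type} [Group F] (g : F) (P : Subgroup F) : Subgroup F where
  carrier := {x | g⁻¹ * x * g ∈ P}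
  mul_mem' := by
    intro a b ha hb
    have := P.mul_mem ha hb
    simpa [mul_assoc] using this
  one_mem' := by simp
  inv_mem' := by
    intro a ha
    have := P.inv_mem ha
    simpa [mul_assoc] using this

section
variable {F : Type} [Group F]

lemma mem_cj {g x : F} {P : Subgroup F} : x ∈ cj g P ↔ g⁻¹ * x * g ∈ P := Iff.rfl
lemma cj_one (P : Subgroup F) : cj 1 P = P := by ext x; simp [mem_cj]
lemma cj_cj (g h : F) (P : Subgroup F) : cj g (cj h P) = cj (g * h) P := by
  ext x; simp [mem_cj, mul_assoc]
lemma cj_mono {g : F} {P Q : Subgroup F} (h : P ≤ Q) : cj g P ≤ cj g Q := fun _ hx => h hx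
lemma mem_cj' {g x : F} {P : Subgroup F} (h : x ∈ P) : g * x * g⁻¹ ∈ cj g P := by
  rw [mem_cj]; simpa [mul_assoc] using h
lemma cj_eq_map (g : F) (P : Subgroup F) : cj g P = P.map (MulAut.conj g).toMonoidHom := by
  ext x; rw [mem_cj, Subgroup.mem_map]
  constructor
  · intro h; exact ⟨_, h, by simp [mul_assoc]⟩
  · rintro ⟨y, hy, rfl⟩; simpa [mul_assoc] using hy
lemma cj_of_mem {g : F} {P : Subgroup F} (h : g ∈ P) : cj g P = P := by
  ext x; rw [mem_cj]
  constructor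
  · intro hx
    have := P.mul_mem (P.mul_mem h hx) (P.inv_mem h)
    simpa [mul_assoc] using this
  · intro hx; exact P.mul_mem (P.mul_mem (P.inv_mem h) hx) h
lemma map_cj {G : Type} [Group G] (f : F →* G) (g : F) (P : Subgroup F) :
    (cj g P).map f = cj (f g) (P.map f) := by
  rw [cj_eq_map, cj_eq_map, Subgroup.map_map, Subgroup.map_map]
  congr 1
  ext x; simp

lemma cj_fg {g : F} {P : Subgroup F} (h : P.FG) : (cj g P).FG := by
  rw [cj_eq_map]
  classical
  obtain ⟨T, rfl⟩ := h
  exact ⟨T.image (MulAut.conj g).toMonoidHom, by rw [Finset.coe_image, MonoidHom.map_closure]⟩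

/-- finitely many conjugates are separated -/
lemma sep_cj_finite {P : Subgroup F} (hP : P.FG) {A : Set F} (hA : AInv A) :
    {Q : Subgroup F | ∃ g, Q = cj g P ∧ Sep A Q}.Finite := by
  obtain ⟨T, hT⟩ := hP
  let bad : Set F := ⋃ q ∈ T, {x | ¬ (x ∈ A ↔ x * q ∈ A)}
  have hbad : bad.Finite := T.finite_toSet.biUnion fun q _ => (by
    have := hA q
    rwa [Filter.eventually_cofinite] at this)
  refine (hbad.image (fun x => cj x P)).subset ?_
  rintro Q ⟨g, rfl, hs⟩
  by_contra hno
  have key : ∀ p ∈ P, ∀ x, (∀ y ∈ P, x * y ∉ bad) → (x ∈ A ↔ x * p ∈ A) := by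
    intro p hp
    rw [← hT] at hp
    induction hp using Subgroup.closure_induction with
    | mem q hq =>
      intro x hx
      by_contra hc
      apply hx 1 P.one_mem
      rw [mul_one]
      exact Set.mem_biUnion hq hc
    | one => intro x _; simp
    | mul a b ha hb iha ihb =>
      intro x hx
      rw [iha x hx, ihb (x * a) (fun y hy => by
        rw [mul_assoc]; exact hx _ (P.mul_mem (by rw [← hT]; exact ha) hy)), mul_assoc]
    | inv a ha iha =>
      intro x hx
      have := iha (x * a⁻¹) (fun y hy => by
        rw [mul_assoc]; exact hx _ (P.mul_mem (P.inv_mem (by rw [← hT]; exact ha)) hy))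
      rw [this]; simp
  have hg : ∀ y ∈ P, g * y ∉ bad := by
    intro y hy hb
    apply hno
    refine ⟨g * y, hb, ?_⟩
    show cj (g * y) P = cj g P
    rw [← cj_cj, cj_of_mem hy]
  have h1 : Sep (ltr g⁻¹ A) P := by
    refine (sep_ltr hA g⁻¹ (P := cj g P) (fun x => ?_)).2 hs
    rw [mem_cj]; simp [mul_assoc]
  obtain ⟨h2, h3⟩ := h1
  obtain ⟨x, hx, hxP⟩ := h2.exists
  obtain ⟨y, hy, hyP⟩ := h3.exists
  rw [mem_ltr, inv_inv] at hx hy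
  rw [← key x hxP g hg] at hx
  rw [← key y hyP g hg] at hy
  exact hy hx

/-- the set of conjugates of a list of subgroups -/
def Cjs {κ : Type} (P : κ → Subgroup F) : Type := {Q : Subgroup F // ∃ k g, Q = cj g (P k)}

instance {κ : Type} (P : κ → Subgroup F) : MulAction F (Cjs P) where
  smul g Q := ⟨cj g Q.1, by
    obtain ⟨k, h, hQ⟩ := Q.2
    exact ⟨k, g * h, by rw [hQ, cj_cj]⟩⟩
  one_smul Q := Subtype.ext (cj_one _)
  mul_smul g h Q := Subtype.ext (cj_cj g h _).symm

lemma Cjs_smul {κ : Type} {P : κ → Subgroup F} (g : F) (Q : Cjs P) : (g • Q).1 = cj g Q.1 := rfl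

/-- Hurwitz system attached to a finite list of finitely generated subgroups -/
def cjSys {κ : Type} [Finite κ] (P : κ → Subgroup F) (hP : ∀ k, (P k).FG) : HSys F (Cjs P) where
  P Q := Q.1
  equiv g Q x := Iff.rfl
  fin A hA := by
    have h : (⋃ k, {Q : Subgroup F | ∃ g, Q = cj g (P k) ∧ Sep A Q}).Finite :=
      Set.finite_iUnion fun k => sep_cj_finite (hP k) hA
    refine Set.Finite.of_finite_image (f := Subtype.val) (h.subset ?_) Subtype.val_injective.injOn
    rintro _ ⟨Q, hQ, rfl⟩
    obtain ⟨k, g, h⟩ := Q.2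
    exact Set.mem_iUnion.2 ⟨k, g, h, hQ⟩

lemma cjSys_c_zero {κ : Type} [Finite κ] {P : κ → Subgroup F} {hP : ∀ k, (P k).FG} {A : Set F}
    (hA : AInv A) : (cjSys P hP).c A = 0 ↔ ∀ k g, ¬ Sep A (cj g (P k)) := by
  unfold HSys.c
  rw [Set.ncard_eq_zero (show ((cjSys P hP).sep A).Finite from (cjSys P hP).fin A hA)]
  constructor
  · intro h k g hs
    have : (⟨cj g (P k), k, g, rfl⟩ : Cjs P) ∈ (cjSys P hP).sep A := hs
    rw [h] at this; exact this
  · intro h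
    rw [Set.eq_empty_iff_forall_notMem]
    rintro ⟨Q, k, g, rfl⟩ hQ
    exact h k g hQ

end

/-! Hopf property -/

/-- `G` is free of rank `r` -/
def Rk (r : ℕ) (G : Type) [Group G] : Prop := Nonempty (FreeGroup (Fin r) ≃* G)

lemma Rk.of_basis {X G : Type} [Group G] [Fintype X] {x : X → G}
    (h : Function.Bijective (FreeGroup.lift x)) : Rk (Fintype.card X) G :=
  ⟨(FreeGroup.freeGroupCongr (Fintype.equivFin X).symm).trans (MulEquiv.ofBijective _ h)⟩

lemma Rk.free {X : Type} [Fintype X] : Rk (Fintype.card X) (FreeGroup X) :=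
  ⟨FreeGroup.freeGroupCongr (Fintype.equivFin X).symm⟩

lemma Rk.iso {r : ℕ} {G H : Type} [Group G] [Group H] (h : Rk r G) (e : G ≃* H) : Rk r H :=
  ⟨h.some.trans e⟩

lemma Rk.equiv {r : ℕ} {G X : Type} [Group G] [Fintype X] (h : Rk r G) (hc : Fintype.card X = r) :
    Nonempty (FreeGroup X ≃* G) := by
  subst hc
  exact ⟨(FreeGroup.freeGroupCongr (Fintype.equivFin X)).trans h.some⟩

lemma Rk.unique {r s : ℕ} {G : Type} [Group G] (h : Rk r G) (h' : Rk s G) : r = s := by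
  have := Equiv.ofFreeGroupEquiv (h.some.trans h'.some.symm)
  simpa using Fintype.card_congr this

lemma Rk.card {r : ℕ} {G X : Type} [Group G] [Fintype X] {x : X → G} (h : Rk r G)
    (h' : Function.Bijective (FreeGroup.lift x)) : Fintype.card X = r :=
  (Rk.of_basis h').unique h

/-- free groups are residually finite -/
lemma resid_fin {ι : Type} [Fintype ι] [DecidableEq ι] (w : FreeGroup ι) (hw : w ≠ 1) :
    ∃ (Q : Type) (_ : Group Q) (_ : Finite Q) (h : FreeGroup ι →* Q), h w ≠ 1 := by
  classical
  let S : Set (FreeGroup ι) := {g | g.toWord.length ≤ w.toWord.length}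
  have hS : S.Finite := ball_finite _
  haveI : Fintype S := hS.fintype
  haveI : Finite {x | x ∈ S} := hS
  let e : ∀ i : ι, {x : S // of i * x.1 ∈ S} ≃ {x : S // (of i)⁻¹ * x.1 ∈ S} := fun i =>
    { toFun := fun x => ⟨⟨of i * x.1.1, x.2⟩, by simpa using x.1.2⟩
      invFun := fun x => ⟨⟨(of i)⁻¹ * x.1.1, x.2⟩, by simpa using x.1.2⟩
      left_inv := fun x => by ext; simp
      right_inv := fun x => by ext; simp }
  let h : FreeGroup ι →* Equiv.Perm S := FreeGroup.lift fun i => (e i).extendSubtype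
  have hgen : ∀ (d : ι × Bool) (x y : S), lt1 d * x.1 = y.1 → h (lt1 d) x = y := by
    rintro ⟨i, b⟩ x y hxy
    cases b
    · rw [lt1_false] at hxy ⊢
      rw [map_inv, Equiv.Perm.inv_eq_iff_eq]
      have hy : of i * y.1 ∈ S := by rw [← hxy]; simp
      have : h (of i) y = (e i).extendSubtype y := by simp [h]
      rw [this, Equiv.extendSubtype_apply_of_mem (e i) y hy]
      ext; simp [e, ← hxy]
    · rw [lt1_true] at hxy ⊢
      have hx : of i * x.1 ∈ S := by rw [hxy]; exact y.2
      have : h (of i) x = (e i).extendSubtype x := by simp [h]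
      rw [this, Equiv.extendSubtype_apply_of_mem (e i) x hx]
      ext; simp [e, ← hxy]
  have h1 : (1 : FreeGroup ι) ∈ S := by simp [S]
  have main : ∀ (L : List (ι × Bool)) (hL : FreeGroup.IsReduced L) (hlen : L.length ≤ w.toWord.length)
      (hm : FreeGroup.mk L ∈ S), h (FreeGroup.mk L) ⟨1, h1⟩ = ⟨FreeGroup.mk L, hm⟩ := by
    intro L
    induction L with
    | nil => intro _ _ _; show h 1 _ = _; rw [map_one]; rfl
    | cons d L ih =>
      intro hL hlen hm
      have hL' : FreeGroup.IsReduced L := isRed_sub hL ⟨[d], [], by simp⟩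
      have hlen' : L.length ≤ w.toWord.length := by simp at hlen; omega
      have hm' : FreeGroup.mk L ∈ S := by
        show (FreeGroup.mk L).toWord.length ≤ _
        rw [FreeGroup.toWord_mk, hL'.reduce_eq]; exact hlen'
      have hsplit : FreeGroup.mk (d :: L) = lt1 d * FreeGroup.mk L := by
        rw [lt1, FreeGroup.mul_mk]; rfl
      have : h (FreeGroup.mk (d :: L)) ⟨1, h1⟩ = h (lt1 d) (h (FreeGroup.mk L) ⟨1, h1⟩) := by
        rw [hsplit, map_mul]; rfl
      rw [this, ih hL' hlen' hm']
      exact hgen _ _ _ hsplit.symm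
  refine ⟨Equiv.Perm S, inferInstance, inferInstance, h, fun hc => hw ?_⟩
  have hwS : FreeGroup.mk w.toWord ∈ S := by simp [S, FreeGroup.mk_toWord]
  have := main w.toWord FreeGroup.isReduced_toWord le_rfl hwS
  have := congrArg Subtype.val this
  simp only [FreeGroup.mk_toWord, hc] at this
  exact this.symm

/-- free groups of finite rank are Hopfian -/
lemma hopf {ι : Type} [Finite ι] (f : FreeGroup ι →* FreeGroup ι) (hf : Function.Surjective f) :
    Function.Injective f := by
  classical
  haveI := Fintype.ofFinite ι
  rw [injective_iff_map_eq_one]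
  intro w hw
  by_contra hne
  obtain ⟨Q, _, _, h, hh⟩ := resid_fin w hne
  haveI : Finite (FreeGroup ι →* Q) := Finite.of_equiv (ι → Q) FreeGroup.lift
  have hinj : Function.Injective (fun k : FreeGroup ι →* Q => k.comp f) := by
    intro k l hkl
    ext1 x
    obtain ⟨y, hy⟩ := hf (of x)
    have := DFunLike.congr_fun hkl y
    simpa [hy] using this
  obtain ⟨k, hk⟩ := (Finite.injective_iff_surjective.1 hinj) h
  apply hh
  rw [← hk]
  simp [hw]

/-- a generating family of the right cardinality is a basis -/
lemma basis_of_gen {r : ℕ} {G X : Type} [Group G] [Fintype X] (hG : Rk r G)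
    (hc : Fintype.card X = r) {x : X → G} (hx : Subgroup.closure (Set.range x) = ⊤) :
    Function.Bijective (FreeGroup.lift x) := by
  obtain ⟨e⟩ := hG.equiv hc
  have hs : Function.Surjective (FreeGroup.lift x) := by
    rw [← MonoidHom.range_eq_top, FreeGroup.range_lift_eq_closure, hx]
  refine ⟨?_, hs⟩
  have := hopf (e.symm.toMonoidHom.comp (FreeGroup.lift x)) (by
    intro y
    obtain ⟨z, hz⟩ := hs (e y)
    exact ⟨z, by simp [hz]⟩)
  intro a b hab
  exact this (by simp [hab])

end MV


namespace MV
open FreeGroup (of)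

/-- standard free factor -/
def Fac {ι : Type} (Y : Set ι) : Subgroup (FreeGroup ι) := Subgroup.closure (of '' Y)

/-- letters of a factor -/
def Lt {ι : Type} (Y : Set ι) : Set (ι × Bool) := {d | d.1 ∈ Y}

section
variable {ι : Type} [DecidableEq ι]

lemma of_mem_Fac {Y : Set ι} {i : ι} (h : i ∈ Y) : of i ∈ Fac Y := Subgroup.subset_closure ⟨i, h, rfl⟩

lemma lt1_mem_Fac {Y : Set ι} {d : ι × Bool} (h : d.1 ∈ Y) : lt1 d ∈ Fac Y := by
  obtain ⟨i, b⟩ := d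
  cases b
  · rw [lt1_false]; exact inv_mem (of_mem_Fac h)
  · rw [lt1_true]; exact of_mem_Fac h

lemma mk_cons_lt1 (d : ι × Bool) (L : List (ι × Bool)) :
    FreeGroup.mk (d :: L) = lt1 d * FreeGroup.mk L := by
  rw [lt1, FreeGroup.mul_mk]; rfl

lemma mk_mem_Fac {Y : Set ι} (L : List (ι × Bool)) (h : ∀ d ∈ L, d.1 ∈ Y) :
    FreeGroup.mk L ∈ Fac Y := by
  induction L with
  | nil => exact one_mem _
  | cons d L ih =>
    rw [mk_cons_lt1]
    exact mul_mem (lt1_mem_Fac (h d (by simp))) (ih fun e he => h e (by simp [he]))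

lemma mem_Fac {Y : Set ι} {g : FreeGroup ι} : g ∈ Fac Y ↔ ∀ d ∈ g.toWord, d.1 ∈ Y := by
  constructor
  · intro h
    induction h using Subgroup.closure_induction with
    | mem x hx =>
      obtain ⟨i, hi, rfl⟩ := hx
      simpa using hi
    | one => simp
    | mul a b _ _ ha hb =>
      intro d hd
      have := (FreeGroup.toWord_mul_sublist a b).subset hd
      rcases List.mem_append.1 this with h | h
      · exact ha d h
      · exact hb d h
    | inv a _ ha =>
      intro d hd
      rw [FreeGroup.toWord_inv] at hd
      simp only [FreeGroup.invRev, List.mem_reverse, List.mem_map] at hd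
      obtain ⟨e, he, rfl⟩ := hd
      exact ha e he
  · intro h
    rw [← FreeGroup.mk_toWord (x := g)]
    exact mk_mem_Fac _ h

lemma toWord_fac_mul {Y : Set ι} {a h : FreeGroup ι} (ha : a ∈ Fac Y) (hh : h ∉ UU (Lt Y)) :
    (a * h).toWord = a.toWord ++ h.toWord := by
  have hr : FreeGroup.IsReduced (a.toWord ++ h.toWord) := by
    rw [FreeGroup.IsReduced, List.isChain_append]
    refine ⟨FreeGroup.isReduced_toWord, FreeGroup.isReduced_toWord, ?_⟩
    intro x hx y hy hxy
    exfalso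
    apply hh
    refine ⟨y, ?_, hy⟩
    have := mem_Fac.1 ha x (List.mem_of_getLast? hx)
    rw [hxy] at this
    exact this
  rw [FreeGroup.toWord_mul, hr.reduce_eq]

lemma fac_mul_mem {Y : Set ι} {a h : FreeGroup ι} (ha : a ∈ Fac Y) (h1 : a ≠ 1) (hh : h ∉ UU (Lt Y)) :
    a * h ∈ UU (Lt Y) := by
  have hne : a.toWord ≠ [] := by simpa using h1
  obtain ⟨d, L, hL⟩ := List.exists_cons_of_ne_nil hne
  refine ⟨d, mem_Fac.1 ha d (by simp [hL]), ?_⟩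
  rw [toWord_fac_mul ha hh, hL]; rfl

lemma fac_uniq {Y : Set ι} {a h : FreeGroup ι} (ha : a ∈ Fac Y) (hh : h ∉ UU (Lt Y))
    (hah : a * h ∉ UU (Lt Y)) : a = 1 := by
  by_contra h1
  exact hah (fac_mul_mem ha h1 hh)

lemma fac_decomp (Y : Set ι) (g : FreeGroup ι) : ∃ a ∈ Fac Y, ∃ h, g = a * h ∧ h ∉ UU (Lt Y) ∧
    g.toWord = a.toWord ++ h.toWord := by
  classical
  let p : ι × Bool → Bool := fun d => decide (d.1 ∈ Y)
  have hsplit : g.toWord.takeWhile p ++ g.toWord.dropWhile p = g.toWord := List.takeWhile_append_dropWhile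
  have ha : FreeGroup.mk (g.toWord.takeWhile p) ∈ Fac Y := mk_mem_Fac _ fun d hd => by
    have := List.mem_takeWhile_imp hd
    simpa [p] using this
  have hredd : FreeGroup.IsReduced (g.toWord.dropWhile p) :=
    isRed_sub (FreeGroup.isReduced_toWord (x := g)) (List.dropWhile_suffix p).isInfix
  have hh : FreeGroup.mk (g.toWord.dropWhile p) ∉ UU (Lt Y) := by
    rintro ⟨d, hd, hd'⟩
    rw [FreeGroup.toWord_mk, hredd.reduce_eq] at hd'
    have := List.head?_dropWhile_not p g.toWord
    rw [hd'] at this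
    have hd2 : d.1 ∈ Y := hd
    simp [p, hd2] at this
  have hg : g = FreeGroup.mk (g.toWord.takeWhile p) * FreeGroup.mk (g.toWord.dropWhile p) := by
    rw [FreeGroup.mul_mk, hsplit, FreeGroup.mk_toWord]
  refine ⟨_, ha, _, hg, hh, ?_⟩
  have := toWord_fac_mul ha hh
  rw [← hg] at this
  exact this

lemma notMem_UU_Lt {Y : Set ι} {g : FreeGroup ι} : g ∉ UU (Lt Y) ↔ g = 1 ∨ g ∈ UU (Lt Yᶜ) := by
  constructor
  · intro h
    rw [or_iff_not_imp_left]
    intro h1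
    have hne : g.toWord ≠ [] := by simpa using h1
    obtain ⟨d, L, hL⟩ := List.exists_cons_of_ne_nil hne
    refine ⟨d, fun hd => h ⟨d, hd, ?_⟩, ?_⟩ <;> rw [hL] <;> rfl
  · rintro (rfl | ⟨d, hd, hd'⟩)
    · exact one_notMem_UU _
    · rintro ⟨e, he, he'⟩
      rw [hd'] at he'
      obtain rfl := Option.some.inj he'
      exact hd he

lemma fac_notMem_UU {Y : Set ι} {Z : Set (ι × Bool)} (hZ : ∀ d ∈ Z, d.1 ∉ Y) {a : FreeGroup ι}
    (ha : a ∈ Fac Y) : a ∉ UU Z := by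
  rintro ⟨d, hd, hd'⟩
  exact hZ d hd (mem_Fac.1 ha d (List.mem_of_head? hd'))

/-- right invariance under the complementary factor -/
lemma UU_right {Y : Set ι} {Z : Set (ι × Bool)} (hZ : ∀ d ∈ Z, d.1 ∉ Y) {a : FreeGroup ι}
    (ha : a ∈ Fac Y) (g : FreeGroup ι) : g * a ∈ UU Z ↔ g ∈ UU Z := by
  induction ha using Subgroup.closure_induction generalizing g with
  | mem x hx =>
    obtain ⟨i, hi, rfl⟩ := hx
    rw [← lt1_true, UU_change]
    constructor
    · rintro (⟨_, h⟩ | ⟨_, _, h⟩)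
      · exact absurd hi (hZ _ h)
      · exact h
    · intro h
      right
      refine ⟨?_, ?_, h⟩
      · rintro rfl; exact one_notMem_UU _ h
      · rintro rfl; rw [lt1_mem_UU] at h; exact hZ _ h hi
  | one => simp
  | mul a b _ _ ha hb => rw [← mul_assoc, hb, ha]
  | inv a _ ha => rw [← ha, inv_mul_cancel_right]

lemma Lt_disj (Y : Set ι) : ∀ d ∈ Lt Yᶜ, d.1 ∉ Y := fun d hd => hd
lemma Lt_disj' (Y : Set ι) : ∀ d ∈ Lt Y, d.1 ∉ Yᶜ := fun d hd h => h hd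

/-- malnormality of factors -/
lemma Fac_malnormal {Y : Set ι} {g a : FreeGroup ι} (ha : a ∈ Fac Y) (h1 : a ≠ 1)
    (h : g * a * g⁻¹ ∈ Fac Y) : g ∈ Fac Y := by
  obtain ⟨b, hb, w, rfl, hw, -⟩ := fac_decomp Y g
  rcases notMem_UU_Lt.1 hw with rfl | hw'
  · simpa using hb
  · exfalso
    have h2 : w * a * w⁻¹ ∈ Fac Y := by
      have := mul_mem (mul_mem (inv_mem hb) h) hb
      simpa [mul_assoc] using this
    have h3 : w * a * w⁻¹ * w ∈ UU (Lt Y) := fac_mul_mem h2 (by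
      intro hc; apply h1; simpa using hc) hw
    rw [inv_mul_cancel_right] at h3
    have h4 := (UU_right (Lt_disj Y) ha w).2 hw'
    exact (notMem_UU_Lt.2 (Or.inr h4)) h3

/-- not separated, with all translates -/
def NSep {F : Type} [Group F] (U : Set F) (P : Subgroup F) : Prop := ∀ g, ¬ Sep U (cj g P)

lemma NSep.ltr {F : Type} [Group F] {U : Set F} (hU : AInv U) {P : Subgroup F} (h : NSep U P) (k : F) :
    ¬ Sep (ltr k U) P := by
  intro hs
  refine h k⁻¹ ((sep_ltr hU k (fun x => ?_)).1 hs)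
  rw [mem_cj]; simp [mul_assoc]

lemma NSep.of_ltr {F : Type} [Group F] {U : Set F} (hU : AInv U) {P : Subgroup F}
    (h : ∀ k, ¬ Sep (MV.ltr k U) P) : NSep U P := by
  intro g hs
  refine h g⁻¹ ((sep_ltr hU g⁻¹ (fun x => ?_)).2 hs)
  rw [mem_cj]; simp [mul_assoc]

lemma NSep.cj {F : Type} [Group F] {U : Set F} {P : Subgroup F} (h : NSep U P) (g : F) :
    NSep U (cj g P) := fun k hk => by rw [cj_cj] at hk; exact h _ hk

lemma NSep.congr {F : Type} [Group F] {U V : Set F} (hUV : EqF U V) {P : Subgroup F} (h : NSep U P) :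
    NSep V P := fun g hg => h g (hg.congr hUV.symm)

lemma NSep.compl {F : Type} [Group F] {U : Set F} {P : Subgroup F} (h : NSep U P) :
    NSep Uᶜ P := fun g hg => h g (sep_compl.1 hg)

lemma NSep.union {F : Type} [Group F] {U V : Set F} {P : Subgroup F} (h : NSep U P) (h' : NSep V P) :
    NSep (U ∪ V) P := fun g hg => (sep_union_or hg).elim (h g) (h' g)

lemma NSep.ltr_set {F : Type} [Group F] {U : Set F} (hU : AInv U) {P : Subgroup F} (h : NSep U P)
    (k : F) : NSep (MV.ltr k U) P :=
  NSep.of_ltr (hU.ltr k) fun l => by rw [ltr_ltr]; exact h.ltr hU _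

lemma freq_of_seq {F : Type} {p : F → Prop} (f : ℕ → F) (hf : Function.Injective f) (h : ∀ n, p (f n)) :
    ∃ᶠ x in cofinite, p x := by
  rw [Filter.frequently_cofinite_iff_infinite]
  exact (Set.infinite_range_of_injective hf).mono (by rintro _ ⟨n, rfl⟩; exact h n)

lemma pow_inj' {F : Type} [Group F] [IsMulTorsionFree F] {p : F} (hp : p ≠ 1) :
    Function.Injective (fun n : ℕ => p ^ n) := by
  intro a b h
  by_contra hab
  have : p ^ ((a : ℤ) - b) = 1 := by rw [zpow_sub]; simp; exact mul_inv_eq_one.2 h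
  have h0 : ((a : ℤ) - b) ≠ 0 := by omega
  exact hp ((IsMulTorsionFree.zpow_eq_one_iff_left h0).1 this)

variable [Fintype ι]

lemma ell_mem {Y : Set ι} {Z : Set (ι × Bool)} (hZ : ∀ d ∈ Z, d.1 ∉ Y) {P : Subgroup (FreeGroup ι)}
    (hP : NSep (UU Z) P) {p : FreeGroup ι} (hp : p ∈ P) (hpY : p ∈ Fac Y) (hp1 : p ≠ 1)
    {a w : FreeGroup ι} (ha : a ∈ Fac Y) (hq : a * w ∈ P) : w ∉ UU Z := by
  intro hw
  refine hP.ltr (UU_ainv Z) a ⟨?_, ?_⟩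
  · refine freq_of_seq (fun n => a * w * p ^ n)
      (fun m n h => pow_inj' hp1 (mul_left_cancel h)) fun n => ⟨?_, mul_mem hq (pow_mem hp n)⟩
    rw [mem_ltr, show a⁻¹ * (a * w * p ^ n) = w * p ^ n by group, UU_right hZ (pow_mem hpY n)]
    exact hw
  · refine freq_of_seq (fun n => p ^ n) (pow_inj' hp1) fun n => ⟨?_, pow_mem hp n⟩
    rw [mem_ltr]
    exact fac_notMem_UU hZ (mul_mem (inv_mem ha) (pow_mem hpY n))

/-- a nonseparated subgroup meeting a factor lies in it -/
lemma ell_le {Y : Set ι} {P : Subgroup (FreeGroup ι)} (hP : NSep (UU (Lt Yᶜ)) P) {p : FreeGroup ι}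
    (hp : p ∈ P) (hpY : p ∈ Fac Y) (hp1 : p ≠ 1) : P ≤ Fac Y := by
  intro q hq
  obtain ⟨a, ha, w, rfl, hw, -⟩ := fac_decomp Y q
  have := ell_mem (Lt_disj Y) hP hp hpY hp1 ha hq
  rcases notMem_UU_Lt.1 hw with rfl | h
  · simpa using ha
  · exact absurd h this

lemma UU_Lt_compl_eqF (Y : Set ι) : EqF (UU (Lt Y))ᶜ (UU (Lt Yᶜ)) := by
  filter_upwards [ev_long 0] with x hx
  rw [Set.mem_compl_iff, notMem_UU_Lt]
  constructor
  · rintro (rfl | h)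
    · simp at hx
    · exact h
  · exact Or.inr

lemma NSep.swap {Y : Set ι} {P : Subgroup (FreeGroup ι)} (h : NSep (UU (Lt Y)) P) :
    NSep (UU (Lt Yᶜ)) P := h.compl.congr (UU_Lt_compl_eqF Y)

lemma cyc_iff {L : List (ι × Bool)} : FreeGroup.IsCyclicallyReduced L ↔ FreeGroup.IsReduced (L ++ L) := by
  rw [FreeGroup.isCyclicallyReduced_iff, FreeGroup.IsReduced, FreeGroup.IsReduced, List.isChain_append]
  tauto

lemma cyc_sep {Z : Set (ι × Bool)} {M : List (ι × Bool)} (hM : FreeGroup.IsCyclicallyReduced M)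
    {P : Subgroup (FreeGroup ι)} (hP : FreeGroup.mk M ∈ P) {u v : ι × Bool} (hu : M.head? = some u)
    (hv : M.getLast? = some v) (hu' : u ∈ Z) (hv' : linv v ∉ Z) : Sep (UU Z) P := by
  have hne : M ≠ [] := by rintro rfl; simp at hu
  have hw : ∀ n, (FreeGroup.mk M ^ n).toWord = (List.replicate n M).flatten := by
    intro n
    rw [FreeGroup.pow_mk, FreeGroup.toWord_mk, (hM.flatten_replicate n).isReduced.reduce_eq]
  have h1 : FreeGroup.mk M ≠ 1 := by
    intro h
    have := hw 1
    rw [h] at this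
    simp at this
    exact hne this
  have hinj := pow_inj' h1
  constructor
  · refine freq_of_seq (fun n => FreeGroup.mk M ^ (n + 1)) (fun a b h => by simpa using hinj h)
      fun n => ⟨⟨u, hu', ?_⟩, pow_mem hP _⟩
    rw [hw, List.head?_flatten_replicate (by omega), hu]
  · refine freq_of_seq (fun n => (FreeGroup.mk M ^ (n + 1))⁻¹)
      (fun a b h => by simpa using hinj (inv_injective h))
      fun n => ⟨?_, inv_mem (pow_mem hP _)⟩
    rintro ⟨d, hd, hd'⟩
    rw [FreeGroup.toWord_inv, hw, FreeGroup.invRev, List.head?_reverse, List.getLast?_map,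
      List.getLast?_flatten_replicate (by omega), hv] at hd'
    apply hv'
    have : linv v = d := by simpa [linv] using hd'
    rw [this]; exact hd

lemma rot_aux {α : Type} (p : α → Prop) (L : List α) (h1 : ∃ a ∈ L, p a) (h2 : ∀ a ∈ L.head?, ¬ p a) :
    ∃ L' : List α, L'.IsRotated L ∧ (∃ u, L'.head? = some u ∧ p u) ∧ ∃ v, L'.getLast? = some v ∧ ¬ p v := by
  classical
  let q : α → Bool := fun d => decide (¬ p d)
  have hsplit : L.takeWhile q ++ L.dropWhile q = L := List.takeWhile_append_dropWhile
  refine ⟨L.dropWhile q ++ L.takeWhile q, ?_, ?_, ?_⟩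
  · conv_rhs => rw [← hsplit]
    exact List.isRotated_append
  · cases hd : L.dropWhile q with
    | nil =>
      exfalso
      obtain ⟨a, ha, hpa⟩ := h1
      rw [← hsplit, hd, List.append_nil] at ha
      have := List.mem_takeWhile_imp ha
      simp [q] at this
      exact this hpa
    | cons u D =>
      refine ⟨u, rfl, ?_⟩
      have := List.head?_dropWhile_not q L
      rw [hd] at this
      simpa [q] using this
  · cases L with
    | nil => simp at h1
    | cons a L =>
      have ha := h2 a (by simp)
      have hne : (a :: L).takeWhile q ≠ [] := by simp [q, List.takeWhile_cons, ha]
      refine ⟨_, by rw [List.getLast?_append_of_ne_nil _ hne, List.getLast?_eq_getLast_of_ne_nil hne], ?_⟩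
      have := List.mem_takeWhile_imp (List.getLast_mem hne)
      simpa [q] using this

lemma rot_exists {α : Type} (p : α → Prop) (L : List α) (h1 : ∃ a ∈ L, p a) (h2 : ∃ a ∈ L, ¬ p a) :
    ∃ L' : List α, L'.IsRotated L ∧ (∃ u, L'.head? = some u ∧ p u) ∧ ∃ v, L'.getLast? = some v ∧ ¬ p v := by
  obtain ⟨b, hb, hpb⟩ := h2
  obtain ⟨s, t, rfl⟩ := List.append_of_mem hb
  obtain ⟨L', h3, h4⟩ := rot_aux p (b :: t ++ s) (by
      obtain ⟨a, ha, hpa⟩ := h1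
      refine ⟨a, ?_, hpa⟩
      simp only [List.mem_append] at ha ⊢
      exact ha.symm) (by
      intro a ha
      have : b = a := by simpa using ha
      exact this ▸ hpb)
  exact ⟨L', h3.trans List.isRotated_append, h4⟩

lemma cyc_rot {L L' : List (ι × Bool)} (h : L'.IsRotated L) (hL : FreeGroup.IsCyclicallyReduced L) :
    FreeGroup.IsCyclicallyReduced L' ∧ ∃ g, FreeGroup.mk L' = g * FreeGroup.mk L * g⁻¹ := by
  obtain ⟨n, hn, rfl⟩ := List.isRotated_iff_mod.1 h.symm
  rw [List.rotate_eq_drop_append_take hn]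
  have hsplit := List.take_append_drop n L
  set A := L.take n
  set B := L.drop n
  rw [← hsplit] at hL
  constructor
  · rw [cyc_iff]
    have := (hL.flatten_replicate 3).isReduced
    refine isRed_sub this ⟨A, B, ?_⟩
    simp [List.replicate_succ]
  · refine ⟨(FreeGroup.mk A)⁻¹, ?_⟩
    rw [← hsplit, ← FreeGroup.mul_mk, ← FreeGroup.mul_mk]
    group

/-- nonseparated subgroups are elliptic -/
theorem ell {Y : Set ι} {P : Subgroup (FreeGroup ι)} (hP : NSep (UU (Lt Yᶜ)) P) (hne : P ≠ ⊥) :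
    ∃ g, cj g P ≤ Fac Y ∨ cj g P ≤ Fac Yᶜ := by
  obtain ⟨q, hq, hq1⟩ := Subgroup.ne_bot_iff_exists_ne_one.1 hne |>.elim
    fun q hq => (⟨q.1, q.2, fun h => hq (Subtype.ext h)⟩ : ∃ q, q ∈ P ∧ q ≠ 1)
  set R := FreeGroup.reduceCyclically q.toWord with hR
  have hRc : FreeGroup.IsCyclicallyReduced R :=
    FreeGroup.reduceCyclically.isCyclicallyReduced FreeGroup.isReduced_toWord
  obtain ⟨g, hg⟩ : ∃ g, FreeGroup.mk R = g * q * g⁻¹ := by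
    have := FreeGroup.reduceCyclically.conj_conjugator_reduceCyclically q.toWord
    have h2 := congrArg FreeGroup.mk this
    rw [FreeGroup.mk_toWord, ← FreeGroup.mul_mk, ← FreeGroup.mul_mk, ← FreeGroup.inv_mk, ← hR] at h2
    generalize FreeGroup.mk (FreeGroup.reduceCyclically.conjugator q.toWord) = C at h2
    refine ⟨C⁻¹, ?_⟩
    generalize FreeGroup.mk R = M at h2 ⊢
    clear * - h2
    subst h2
    group
  have hqg : FreeGroup.mk R ∈ cj g P := by rw [hg]; exact mem_cj' hq
  have hR1 : FreeGroup.mk R ≠ 1 := by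
    rw [hg]; intro h; apply hq1; simpa using h
  by_cases h1 : ∃ d ∈ R, d.1 ∈ Yᶜ
  · by_cases h2 : ∃ d ∈ R, ¬ d.1 ∈ Yᶜ
    · exfalso
      obtain ⟨L, hL, ⟨u, hu, hu'⟩, v, hv, hv'⟩ := rot_exists (fun d : ι × Bool => d.1 ∈ Yᶜ) R h1 h2
      obtain ⟨hLc, k, hk⟩ := cyc_rot hL hRc
      have : FreeGroup.mk L ∈ cj k (cj g P) := by rw [hk]; exact mem_cj' hqg
      rw [cj_cj] at this
      exact hP _ (cyc_sep hLc this hu hv hu' hv')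
    · push Not at h2
      refine ⟨g, Or.inr (ell_le ?_ hqg (mk_mem_Fac _ h2) hR1)⟩
      exact (hP.cj g).swap
  · push Not at h1
    refine ⟨g, Or.inl (ell_le (hP.cj g) hqg (mk_mem_Fac _ fun d hd => ?_) hR1)⟩
    exact not_not.1 (h1 d hd)

end
end MV


namespace MV
open FreeGroup (of)

section
variable {ι : Type} [DecidableEq ι]

lemma NSep.map {F : Type} [Group F] {U : Set F} {P : Subgroup F} (h : NSep U P) (φ : MulAut F) :
    NSep (MV.img φ U) (P.map φ.toMonoidHom) := by
  intro g hs
  refine h (φ.symm g) ((sep_img φ (fun x => ?_)).1 hs)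
  rw [mem_cj, mem_cj, Subgroup.mem_map]
  constructor
  · rintro ⟨p, hp, hpx⟩
    have : p = φ.symm (g⁻¹ * x * g) := by rw [← hpx]; simp
    rw [this] at hp
    simpa using hp
  · intro hp
    exact ⟨_, hp, by simp⟩

/-- right stabilisers of half-spaces -/
lemma stab_N {i : ι} {u : FreeGroup ι} (h : ∀ k, k ∈ N [(i, true)] ↔ k * u ∈ N [(i, true)]) :
    u ∈ Fac ({i}ᶜ : Set ι) := by
  obtain ⟨a, ha, v, rfl, hv, -⟩ := fac_decomp ({i}ᶜ : Set ι) u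
  rcases notMem_UU_Lt.1 hv with rfl | hv
  · simpa using ha
  exfalso
  rw [compl_compl] at hv
  obtain ⟨⟨j, c⟩, hj, hd⟩ := hv
  have hj' : j = i := hj
  subst hj'
  have haN : a⁻¹ ∉ N [(j, true)] := by
    rw [← UU_single]; exact fac_notMem_UU (Y := ({j}ᶜ : Set ι)) (by rintro d rfl; simp) (inv_mem ha)
  cases c
  · have h1 := h (of j * a⁻¹)
    rw [← UU_single, UU_right (Y := ({j}ᶜ : Set ι)) (by rintro d rfl; simp) (inv_mem ha), UU_single] at h1
    have h2 : of j ∈ N [(j, true)] := by rw [N_one_iff, ← lt1_true, toWord_lt1]; rfl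
    have h3 := h1.1 h2
    have e : of j * a⁻¹ * (a * v) = lt1 (j, true) * v := by rw [lt1_true]; group
    rw [e, N_one_iff] at h3
    rcases toWord_lt1_mul v (j, true) with ⟨h4, h5⟩ | ⟨l, h4, h5⟩
    · cases hw : v.toWord with
      | nil => simp [hw] at hd
      | cons d l =>
        rw [hw] at hd
        simp at hd
        exact h4 l (by rw [hw, hd]; rfl)
    · rw [h5] at h3
      have := FreeGroup.isReduced_toWord (x := v)
      rw [h4] at this
      cases l with
      | nil => simp at h3
      | cons d l =>
        simp at h3; subst h3
        simp [FreeGroup.IsReduced, linv] at this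
  · have h1 := (h a⁻¹).2 (by rw [N_one_iff]; simpa using hd)
    exact haN h1

lemma stab_UU {Y : Set ι} {u : FreeGroup ι} (h : ∀ k, k ∈ UU (Lt Yᶜ) ↔ k * u ∈ UU (Lt Yᶜ)) :
    u ∈ Fac Y := by
  obtain ⟨a, ha, v, rfl, hv, -⟩ := fac_decomp Y u
  rcases notMem_UU_Lt.1 hv with rfl | hv
  · simpa using ha
  exfalso
  exact fac_notMem_UU (Lt_disj Y) (inv_mem ha) ((h a⁻¹).2 (by simpa using hv))

lemma stab_UU' {Y : Set ι} {u : FreeGroup ι} (h : ∀ k, k ∈ UU (Lt Y) ↔ k * u ∈ UU (Lt Y)) :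
    u ∈ Fac Yᶜ := stab_UU (Y := Yᶜ) (by rw [compl_compl]; exact h)

lemma eq_of_inv {F : Type} [Group F] {H : Subgroup F} (hH : (H : Set F).Infinite) {U V : Set F}
    (hU : ∀ h ∈ H, ∀ k, k ∈ U ↔ k * h ∈ U) (hV : ∀ h ∈ H, ∀ k, k ∈ V ↔ k * h ∈ V) (hUV : EqF U V) : U = V := by
  ext k
  have h1 : ∃ᶠ x in cofinite, x ∈ (H : Set F) := Filter.frequently_cofinite_iff_infinite.2 hH
  obtain ⟨h, hh, hh'⟩ := (h1.and_eventually (ev_left k hUV)).exists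
  rw [hU h hh k, hh', ← hV h hh k]

lemma infinite_of_ne {H : Subgroup (FreeGroup ι)} {p : FreeGroup ι} (hp : p ∈ H) (h1 : p ≠ 1) :
    (H : Set (FreeGroup ι)).Infinite :=
  (Set.infinite_range_of_injective (pow_inj' h1)).mono (by rintro _ ⟨n, rfl⟩; exact pow_mem hp n)

variable [Fintype ι]

lemma NSep_Fac {Y : Set ι} {Z : Set (ι × Bool)} (hZ : ∀ d ∈ Z, d.1 ∉ Y) : NSep (UU Z) (Fac Y) := by
  refine NSep.of_ltr (UU_ainv Z) fun k hs => ?_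
  obtain ⟨x, hx, hx'⟩ := hs.1.exists
  obtain ⟨y, hy, hy'⟩ := hs.2.exists
  rw [mem_ltr, UU_right hZ hx'] at hx
  rw [mem_ltr, UU_right hZ hy'] at hy
  exact hy hx

/-- ellipticity for a half-tree -/
theorem ellI {i : ι} {P : Subgroup (FreeGroup ι)} (hP : NSep (N [(i, true)]) P) (hne : P ≠ ⊥) :
    ∃ g, cj g P ≤ Fac ({i}ᶜ : Set ι) := by
  have h1 : NSep (N [(i, false)]) P := by
    have := N_eq_ltr (L := []) (d := (i, false)) (by simp)
    simp only [List.nil_append] at this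
    rw [this]
    exact (hP.compl).ltr_set (N_ainv _).compl _
  have h2 : NSep (UU (Lt ({i}ᶜᶜ : Set ι))) P := by
    have e : UU (Lt ({i}ᶜᶜ : Set ι)) = N [(i, true)] ∪ N [(i, false)] := by
      ext g
      rw [mem_UU, compl_compl]
      constructor
      · rintro ⟨⟨j, c⟩, hj, hg⟩
        have hj' : j = i := hj
        subst hj'
        cases c
        · exact Or.inr hg
        · exact Or.inl hg
      · rintro (h | h)
        · exact ⟨_, rfl, h⟩
        · exact ⟨_, rfl, h⟩
    rw [e]; exact hP.union h1
  obtain ⟨g, hg | hg⟩ := ell h2 hne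
  · exact ⟨g, hg⟩
  · exfalso
    rw [compl_compl] at hg
    obtain ⟨q, hq, hq1⟩ := Subgroup.ne_bot_iff_exists_ne_one.1 hne |>.elim
      fun q hq => (⟨q.1, q.2, fun h => hq (Subtype.ext h)⟩ : ∃ q, q ∈ P ∧ q ≠ 1)
    have hz : Fac ({i} : Set ι) = Subgroup.zpowers (of i) := by
      rw [Fac, Set.image_singleton, Subgroup.zpowers_eq_closure]
    have hq' := mem_cj' (g := g) hq
    have hq2 := hg hq'
    rw [hz] at hq2
    obtain ⟨m, hm⟩ := Subgroup.mem_zpowers_iff.1 hq2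
    have hm0 : m ≠ 0 := by
      rintro rfl
      apply hq1; simpa using hm.symm
    have hin : ∃ n : ℕ, n ≠ 0 ∧ of i ^ n ∈ cj g P := by
      refine ⟨m.natAbs, by simpa using hm0, ?_⟩
      rw [← zpow_natCast]
      rcases Int.natAbs_eq m with h | h
      · rw [← h, hm]; exact hq'
      · have : ((m.natAbs : ℕ) : ℤ) = -m := by omega
        rw [this, zpow_neg, hm]; exact inv_mem hq'
    obtain ⟨n, hn, hin⟩ := hin
    have hoi : (of i ^ n : FreeGroup ι) ≠ 1 := by
      intro h
      have := congrArg FreeGroup.toWord h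
      rw [FreeGroup.toWord_of_pow] at this
      simp [hn] at this
    refine hP g ⟨?_, ?_⟩
    · refine freq_of_seq (fun k : ℕ => (of i ^ n) ^ (k+1)) (fun a b h => by simpa using pow_inj' hoi h) fun k => ?_
      refine ⟨?_, pow_mem hin _⟩
      rw [← pow_mul, N_one_iff, FreeGroup.toWord_of_pow]
      have : n * (k+1) ≠ 0 := by positivity
      obtain ⟨t, ht⟩ := Nat.exists_eq_succ_of_ne_zero this
      rw [ht]; rfl
    · refine freq_of_seq (fun k : ℕ => ((of i ^ n) ^ (k+1))⁻¹) (fun a b h => by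
        simpa using pow_inj' hoi (inv_injective h)) fun k => ?_
      refine ⟨?_, inv_mem (pow_mem hin _)⟩
      rw [← pow_mul, N_one_iff, FreeGroup.toWord_inv, FreeGroup.toWord_of_pow]
      intro h
      have := List.mem_of_head? h
      simp [FreeGroup.invRev] at this

lemma img_right {F : Type} [Group F] {W : Set F} {A : Subgroup F}
    (h : ∀ a ∈ A, ∀ k, k ∈ W ↔ k * a ∈ W) (φ : MulAut F) :
    ∀ a ∈ A.map φ.toMonoidHom, ∀ k, k ∈ MV.img φ W ↔ k * a ∈ MV.img φ W := by
  rintro _ ⟨a, ha, rfl⟩ k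
  rw [mem_img, mem_img, map_mul]
  simpa using h a ha _

lemma map_inf {A : Subgroup (FreeGroup ι)} {a : FreeGroup ι} (ha : a ∈ A) (h1 : a ≠ 1) (φ : MulAut (FreeGroup ι)) :
    ((A.map φ.toMonoidHom : Subgroup (FreeGroup ι)) : Set (FreeGroup ι)).Infinite :=
  infinite_of_ne (p := φ a) ⟨a, ha, rfl⟩ (by simpa using h1)

lemma ne_bot_of_inf {F : Type} [Group F] {A : Subgroup F} (h : (A : Set F).Infinite) : A ≠ ⊥ := by
  rintro rfl
  exact h (by simp)

lemma rightshift_eqF {F : Type} [Group F] {W : Set F} (hW : AInv W) (h : F) : EqF W {k | k * h ∈ W} := hW h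

theorem splitI_aux {i : ι} (hi : ∃ j, j ≠ i) (φ : MulAut (FreeGroup ι))
    (hW : EqF (img φ (N [(i, true)])) (N [(i, true)])) : img φ (N [(i, true)]) = N [(i, true)] := by
  obtain ⟨j, hj⟩ := hi
  set W := N [(i, true)] with hWd
  set A := Fac ({i}ᶜ : Set ι) with hA
  have hWA : ∀ a ∈ A, ∀ k, k ∈ W ↔ k * a ∈ W := by
    intro a ha k
    rw [hWd, ← UU_single, UU_right (Y := ({i}ᶜ : Set ι)) (by rintro d rfl; simp) ha]
  have hAW : ∀ a ∈ A, a ∉ W := by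
    intro a ha
    rw [hWd, ← UU_single]; exact fac_notMem_UU (Y := ({i}ᶜ : Set ι)) (by rintro d rfl; simp) ha
  have hinf := map_inf (A := A) (of_mem_Fac (show j ∈ ({i}ᶜ : Set ι) from hj)) (FreeGroup.of_ne_one _) φ
  have hNS : NSep W (A.map φ.toMonoidHom) := by
    refine NSep.congr hW ?_
    apply NSep.map
    rw [hWd, ← UU_single]
    exact NSep_Fac (by rintro d rfl; simp)
  obtain ⟨g, hg⟩ := ellI hNS (ne_bot_of_inf hinf)
  have hgA : ∀ a ∈ A.map φ.toMonoidHom, g * a * g⁻¹ ∈ A := fun a ha => hg (mem_cj' ha)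
  have hV : img φ W = {k | k * g⁻¹ ∈ W} := by
    refine eq_of_inv hinf (img_right hWA φ) ?_ (hW.trans (rightshift_eqF (N_ainv _) _))
    intro a ha k
    simp only [Set.mem_setOf_eq]
    rw [hWA _ (hgA a ha) (k * g⁻¹)]
    have : k * g⁻¹ * (g * a * g⁻¹) = k * a * g⁻¹ := by group
    rw [this]
  have hgW : g⁻¹ ∉ W := by
    intro h
    have : (1 : FreeGroup ι) ∈ img φ W := by rw [hV]; simpa using h
    rw [mem_img, map_one, hWd, ← UU_single] at this
    exact one_notMem_UU _ this
  have hx0 : ∀ k, k * of i ∈ W ↔ k ∈ W ∨ k = 1 := by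
    intro k
    have h1 := N_change_true (i := i) (h := k)
    by_cases hk : k = 1
    · subst hk
      simp [hWd, N_one_iff]
    · rw [← h1.2 hk]; simp [hk, hWd]
  have hx : ∀ l, l * (g * φ (of i) * g⁻¹) ∈ W ↔ l ∈ W ∨ l = g⁻¹ := by
    intro l
    have e1 : l * (g * φ (of i) * g⁻¹) ∈ W ↔ l * g * φ (of i) ∈ img φ W := by
      rw [hV]; simp only [Set.mem_setOf_eq, mul_assoc]
    have e2 : l ∈ W ↔ l * g ∈ img φ W := by
      rw [hV]; simp
    rw [e1, e2, mem_img, mem_img, map_mul]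
    have := hx0 (φ.symm (l * g))
    rw [MulEquiv.symm_apply_apply, this]
    rw [EmbeddingLike.map_eq_one_iff, mul_eq_one_iff_eq_inv]
  set u := g * φ (of i) * g⁻¹ with hu
  have hgA' : g⁻¹ ∈ A := by
    by_contra hgn
    obtain ⟨a, ha, v, hav, hv, -⟩ := fac_decomp ({i}ᶜ : Set ι) u
    have h1 : a⁻¹ * u = v := by rw [hav]; group
    rcases notMem_UU_Lt.1 hv with rfl | hv
    · have := (hx g⁻¹).2 (Or.inr rfl)
      rw [hav, mul_one, ← hWA a ha] at this
      exact hgW this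
    · rw [compl_compl] at hv
      obtain ⟨⟨j', c⟩, hj', hd⟩ := hv
      have hj'' : j' = i := hj'
      subst hj''
      cases c
      · have h2 := (hx (of j' * a⁻¹)).2 (Or.inl (by
          rw [← hWA _ (inv_mem ha), hWd, N_one_iff, ← lt1_true, toWord_lt1]; rfl))
        have e : of j' * a⁻¹ * u = lt1 (j', true) * v := by rw [lt1_true, hav]; group
        rw [e, hWd, N_one_iff] at h2
        rcases toWord_lt1_mul v (j', true) with ⟨h4, h5⟩ | ⟨l, h4, h5⟩
        · cases hw : v.toWord with
          | nil => simp [hw] at hd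
          | cons d l =>
            rw [hw] at hd
            simp at hd
            exact h4 l (by rw [hw, hd]; rfl)
        · rw [h5] at h2
          have := FreeGroup.isReduced_toWord (x := v)
          rw [h4] at this
          cases l with
          | nil => simp at h2
          | cons d l =>
            simp at h2; subst h2
            simp [FreeGroup.IsReduced, linv] at this
      · have h2 := (hx a⁻¹).1 (by rw [h1, hWd, N_one_iff]; exact hd)
        rcases h2 with h2 | h2
        · exact hAW _ (inv_mem ha) h2
        · exact hgn (h2 ▸ inv_mem ha)
  rw [hV]
  ext k
  exact (hWA _ hgA' k).symm

theorem splitII_aux {X : Set ι} (hX : X.Nonempty) (hX' : Xᶜ.Nonempty) (φ : MulAut (FreeGroup ι))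
    (hW : EqF (img φ (UU (Lt X))) (UU (Lt X))) : img φ (UU (Lt X)) = UU (Lt X) := by
  obtain ⟨i, hi⟩ := hX
  obtain ⟨j, hj⟩ := hX'
  set W := UU (Lt X) with hWd
  set A := Fac Xᶜ with hA
  set B := Fac X with hB
  have hWA : ∀ a ∈ A, ∀ k, k ∈ W ↔ k * a ∈ W := fun a ha k => (UU_right (Lt_disj' X) ha k).symm
  have hAW : ∀ a ∈ A, a ∉ W := fun a ha => fac_notMem_UU (Lt_disj' X) ha
  have hWB : ∀ b ∈ B, ∀ k, (k ∈ W ∨ k = 1) ↔ (k * b ∈ W ∨ k * b = 1) := by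
    intro b hb k
    have := UU_right (Lt_disj X) hb k
    have h1 := notMem_UU_Lt (Y := Xᶜ) (g := k)
    have h2 := notMem_UU_Lt (Y := Xᶜ) (g := k * b)
    rw [compl_compl] at h1 h2
    rw [hWd]; clear * - this h1 h2; tauto
  have h1W : (1 : FreeGroup ι) ∉ W := one_notMem_UU _
  have hinf := map_inf (A := A) (of_mem_Fac (show j ∈ Xᶜ from hj)) (FreeGroup.of_ne_one _) φ
  have hNS : NSep W (A.map φ.toMonoidHom) :=
    NSep.congr hW (NSep.map (NSep_Fac (Lt_disj' X)) φ)
  obtain ⟨g, hg⟩ := ell (Y := X) hNS.swap (ne_bot_of_inf hinf)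
  have hone : (1 : FreeGroup ι) ∉ img φ W := by rw [mem_img, map_one]; exact h1W
  -- right invariance of V ∪ {1}
  have hVB : ∀ b ∈ B, ∀ k, (k ∈ img φ W ∨ k = 1) ↔ (k * φ b ∈ img φ W ∨ k * φ b = 1) := by
    intro b hb k
    have := hWB b hb (φ.symm k)
    have e1 : φ.symm k * b = φ.symm (k * φ b) := by simp
    rw [e1, EmbeddingLike.map_eq_one_iff, EmbeddingLike.map_eq_one_iff] at this
    exact this
  rcases hg with hg | hg
  · -- second case of the plan
    exfalso
    have hgA : ∀ a ∈ A.map φ.toMonoidHom, g * a * g⁻¹ ∈ B := fun a ha => hg (mem_cj' ha)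
    have hV : img φ W = {k | k * g⁻¹ ∈ W ∨ k * g⁻¹ = 1} := by
      refine eq_of_inv hinf (img_right hWA φ) ?_ (hW.trans ((rightshift_eqF (UU_ainv _) g⁻¹).trans ?_))
      · intro a ha k
        simp only [Set.mem_setOf_eq]
        rw [hWB _ (hgA a ha) (k * g⁻¹)]
        have : k * g⁻¹ * (g * a * g⁻¹) = k * a * g⁻¹ := by group
        rw [this]
      · have : ∀ᶠ k in cofinite, k ≠ g := by simp [Filter.eventually_cofinite]
        filter_upwards [this] with k hk
        simp only [Set.mem_setOf_eq, mul_inv_eq_one, hk, or_false]; rfl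
    have hg1 : g⁻¹ ∉ W ∧ g⁻¹ ≠ 1 := by
      rw [hV] at hone
      simpa using hone
    have hx : ∀ b ∈ B, ∀ l, (l ∈ W ∨ l = 1 ∨ l = g⁻¹) ↔ (l * (g * φ b * g⁻¹) ∈ W ∨
        l * (g * φ b * g⁻¹) = 1 ∨ l * (g * φ b * g⁻¹) = g⁻¹) := by
      intro b hb l
      have h := hVB b hb (l * g)
      rw [hV] at h
      simp only [Set.mem_setOf_eq, mul_inv_cancel_right] at h
      have e1 : l * g = 1 ↔ l = g⁻¹ := mul_eq_one_iff_eq_inv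
      have e2 : l * g * φ b * g⁻¹ = l * (g * φ b * g⁻¹) := by group
      have e3 : l * g * φ b = 1 ↔ l * (g * φ b * g⁻¹) = g⁻¹ := by
        rw [← e2, mul_eq_right]
      rw [e1, e2, e3, or_assoc, or_assoc] at h
      exact h
    have hnot : ∀ b ∈ B, b ≠ 1 → g * φ b * g⁻¹ ∉ B := by
      intro b hb hb1 hu
      have h := (hx b hb g⁻¹).1 (Or.inr (Or.inr rfl))
      have h2 := hWB _ hu g⁻¹
      rcases h with h | h | h
      · rcases h2.2 (Or.inl h) with h | h
        · exact hg1.1 h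
        · exact hg1.2 h
      · rcases h2.2 (Or.inr h) with h | h
        · exact hg1.1 h
        · exact hg1.2 h
      · rw [mul_eq_left, conj_eq_one_iff, EmbeddingLike.map_eq_one_iff] at h
        exact hb1 h
    have hin : ∀ b ∈ B, b ≠ 1 → (g * φ b * g⁻¹) * g ∈ B := by
      intro b hb hb1
      obtain ⟨c, hc, v, hcv, hv, -⟩ := fac_decomp X (g * φ b * g⁻¹)
      have h := (hx b hb c⁻¹).1 (by
        have := (hWB c⁻¹ (inv_mem hc) 1).1 (Or.inr rfl)
        rw [one_mul] at this
        tauto)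
      have e : c⁻¹ * (g * φ b * g⁻¹) = v := by rw [hcv]; group
      rw [e] at h
      rcases h with h | h | h
      · exact absurd h hv
      · exfalso
        rw [h, mul_one] at hcv
        exact hnot b hb hb1 (hcv ▸ hc)
      · rw [hcv, h]; simpa using hc
    have hi1 : (of i : FreeGroup ι) ≠ 1 := (FreeGroup.of_ne_one _)
    have hi2 : (of i * of i : FreeGroup ι) ≠ 1 := by
      intro h
      have h3 : (of i : FreeGroup ι) ^ 2 = (of i) ^ 0 := by rw [pow_two, h, pow_zero]
      have := pow_inj' hi1 h3
      simp at this
    have hiB : of i ∈ B := of_mem_Fac hi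
    have h1 := hin _ hiB hi1
    have h2 := hin _ (mul_mem hiB hiB) hi2
    apply hnot _ hiB hi1
    have := mul_mem h2 (inv_mem h1)
    rw [map_mul] at this
    have e : g * (φ (of i) * φ (of i)) * g⁻¹ * g * (g * φ (of i) * g⁻¹ * g)⁻¹ = g * φ (of i) * g⁻¹ := by group
    rwa [e] at this
  · have hgA : ∀ a ∈ A.map φ.toMonoidHom, g * a * g⁻¹ ∈ A := fun a ha => hg (mem_cj' ha)
    have hV : img φ W = {k | k * g⁻¹ ∈ W} := by
      refine eq_of_inv hinf (img_right hWA φ) ?_ (hW.trans (rightshift_eqF (UU_ainv _) _))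
      intro a ha k
      simp only [Set.mem_setOf_eq]
      rw [hWA _ (hgA a ha) (k * g⁻¹)]
      have : k * g⁻¹ * (g * a * g⁻¹) = k * a * g⁻¹ := by group
      rw [this]
    have hgW : g⁻¹ ∉ W := by
      rw [hV] at hone
      simpa using hone
    have hx : ∀ b ∈ B, ∀ l, (l ∈ W ∨ l = g⁻¹) ↔ (l * (g * φ b * g⁻¹) ∈ W ∨
        l * (g * φ b * g⁻¹) = g⁻¹) := by
      intro b hb l
      have h := hVB b hb (l * g)
      rw [hV] at h
      simp only [Set.mem_setOf_eq, mul_inv_cancel_right] at h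
      have e1 : l * g = 1 ↔ l = g⁻¹ := mul_eq_one_iff_eq_inv
      have e2 : l * g * φ b * g⁻¹ = l * (g * φ b * g⁻¹) := by group
      have e3 : l * g * φ b = 1 ↔ l * (g * φ b * g⁻¹) = g⁻¹ := by
        rw [← e2, mul_eq_right]
      rw [e1, e2, e3] at h
      exact h
    have hgA' : g⁻¹ ∈ A := by
      have hiB : of i ∈ B := of_mem_Fac hi
      have hi1 : (of i : FreeGroup ι) ≠ 1 := (FreeGroup.of_ne_one _)
      obtain ⟨a, ha, v, hav, hv, -⟩ := fac_decomp Xᶜ (g * φ (of i) * g⁻¹)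
      have e : a⁻¹ * (g * φ (of i) * g⁻¹) = v := by rw [hav]; group
      rcases notMem_UU_Lt.1 hv with rfl | hv
      · exfalso
        rw [mul_one] at hav
        rcases (hx _ hiB g⁻¹).1 (Or.inr rfl) with h | h
        · rw [hav, ← hWA a ha] at h
          exact hgW h
        · rw [mul_eq_left, conj_eq_one_iff, EmbeddingLike.map_eq_one_iff] at h
          exact hi1 h
      · rw [compl_compl] at hv
        rcases (hx _ hiB a⁻¹).2 (Or.inl (by rw [e]; exact hv)) with h | h
        · exact absurd h (hAW _ (inv_mem ha))
        · rw [← h]; exact inv_mem ha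
    rw [hV]
    ext k
    exact (hWA _ hgA' k).symm

lemma mem_iff_of_img {F : Type} [Group F] {W : Set F} {φ : MulAut F} (h : img φ W = W) (g : F) :
    φ g ∈ W ↔ g ∈ W := by
  conv_lhs => rw [← h, mem_img]
  simp

theorem splitI {i : ι} (hi : ∃ j, j ≠ i) (φ : MulAut (FreeGroup ι))
    (hW : EqF (img φ (N [(i, true)])) (N [(i, true)])) :
    (∀ g, φ g ∈ N [(i, true)] ↔ g ∈ N [(i, true)]) ∧
    (∀ g, φ g ∈ Fac ({i}ᶜ : Set ι) ↔ g ∈ Fac ({i}ᶜ : Set ι)) ∧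
    (of i)⁻¹ * φ (of i) ∈ Fac ({i}ᶜ : Set ι) := by
  have h := mem_iff_of_img (splitI_aux hi φ hW)
  have hWA : ∀ a ∈ Fac ({i}ᶜ : Set ι), ∀ k, k ∈ N [(i, true)] ↔ k * a ∈ N [(i, true)] := by
    intro a ha k
    rw [← UU_single, UU_right (Y := ({i}ᶜ : Set ι)) (by rintro d rfl; simp) ha]
  have hx0 : ∀ k, k * of i ∈ N [(i, true)] ↔ k ∈ N [(i, true)] ∨ k = 1 := by
    intro k
    have h1 := N_change_true (i := i) (h := k)
    by_cases hk : k = 1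
    · subst hk
      simp [N_one_iff]
    · rw [← h1.2 hk]; simp [hk]
  refine ⟨h, fun g => ⟨fun hg => stab_N fun k => ?_, fun hg => stab_N fun k => ?_⟩, stab_N fun k => ?_⟩
  · rw [← h k, ← h (k * g), map_mul]; exact hWA _ hg _
  · obtain ⟨k, rfl⟩ := φ.surjective k
    rw [← map_mul, h, h]; exact hWA _ hg _
  · have h1 := hx0 (k * (of i)⁻¹)
    rw [inv_mul_cancel_right] at h1
    rw [h1]
    obtain ⟨l, hl⟩ := φ.surjective (k * (of i)⁻¹)
    rw [← mul_assoc, ← hl, ← map_mul, h, h, hx0, EmbeddingLike.map_eq_one_iff]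

theorem splitII {X : Set ι} (hX : X.Nonempty) (hX' : Xᶜ.Nonempty) (φ : MulAut (FreeGroup ι))
    (hW : EqF (img φ (UU (Lt X))) (UU (Lt X))) :
    (∀ g, φ g ∈ Fac X ↔ g ∈ Fac X) ∧ (∀ g, φ g ∈ Fac Xᶜ ↔ g ∈ Fac Xᶜ) := by
  have h := mem_iff_of_img (splitII_aux hX hX' φ hW)
  have h' : ∀ g, φ g ∈ UU (Lt Xᶜ) ↔ g ∈ UU (Lt Xᶜ) := by
    intro g
    have h1 := h g
    have h2 := notMem_UU_Lt (Y := X) (g := g)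
    have h3 := notMem_UU_Lt (Y := X) (g := φ g)
    have h4 := one_notMem_UU (ι := ι) (Lt Xᶜ)
    rw [EmbeddingLike.map_eq_one_iff] at h3
    by_cases hg : g = 1
    · subst hg; simp [h4]
    · simp only [hg, false_or] at h2 h3
      rw [← h2, ← h3, h1]
  constructor
  · intro g
    refine ⟨fun hg => stab_UU fun k => ?_, fun hg => stab_UU fun k => ?_⟩
    · rw [← h' k, ← h' (k * g), map_mul]; exact (UU_right (Lt_disj X) hg _).symm
    · obtain ⟨k, rfl⟩ := φ.surjective k
      rw [← map_mul, h', h']; exact (UU_right (Lt_disj X) hg _).symm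
  · intro g
    refine ⟨fun hg => stab_UU' fun k => ?_, fun hg => stab_UU' fun k => ?_⟩
    · rw [← h k, ← h (k * g), map_mul]; exact (UU_right (Lt_disj' X) hg _).symm
    · obtain ⟨k, rfl⟩ := φ.surjective k
      rw [← map_mul, h, h]; exact (UU_right (Lt_disj' X) hg _).symm
end
end MV


namespace MV
open FreeGroup (of)

/-- fixed subgroup of an automorphism -/
def FixA {F : Type} [Group F] (φ : MulAut F) : Subgroup F := Fix φ.toMonoidHom

lemma mem_FixA {F : Type} [Group F] {φ : MulAut F} {g : F} : g ∈ FixA φ ↔ φ g = g := Iff.rfl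

section
variable {ι : Type} [DecidableEq ι]

lemma fixII_pres {X : Set ι} (φ : MulAut (FreeGroup ι)) (hA : ∀ g ∈ Fac Xᶜ, φ g ∈ Fac Xᶜ)
    (hB : ∀ g ∈ Fac X, φ g ∈ Fac X) : ∀ n (g : FreeGroup ι), g.toWord.length ≤ n →
    (g ∈ UU (Lt X) → φ g ∈ UU (Lt X)) ∧ (g ∈ UU (Lt Xᶜ) → φ g ∈ UU (Lt Xᶜ)) := by
  intro n
  induction n with
  | zero =>
    intro g hg
    have : g = 1 := by simpa using hg
    subst this
    exact ⟨fun h => absurd h (one_notMem_UU _), fun h => absurd h (one_notMem_UU _)⟩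
  | succ n ih =>
    have key : ∀ Y : Set ι, (∀ g ∈ Fac Y, φ g ∈ Fac Y) → (∀ g : FreeGroup ι, g.toWord.length ≤ n →
        g ∈ UU (Lt Yᶜ) → φ g ∈ UU (Lt Yᶜ)) → ∀ g : FreeGroup ι, g.toWord.length ≤ n + 1 →
        g ∈ UU (Lt Y) → φ g ∈ UU (Lt Y) := by
      intro Y hY ih g hg hgU
      obtain ⟨a, ha, h, hgah, hh, hlen⟩ := fac_decomp Y g
      have ha1 : a ≠ 1 := by rintro rfl; apply hh; rw [hgah, one_mul] at hgU; exact hgU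
      have hl : 0 < a.toWord.length := List.length_pos_iff.2 (by simpa using ha1)
      have hφh : φ h ∉ UU (Lt Y) := by
        rw [notMem_UU_Lt]
        rcases notMem_UU_Lt.1 hh with rfl | h'
        · left; simp
        · right; apply ih _ _ h'
          have := congrArg List.length hlen
          rw [List.length_append] at this
          omega
      rw [hgah, map_mul]
      exact fac_mul_mem (hY a ha) (by simpa using ha1) hφh
    intro g hg
    refine ⟨key X hB (fun g hg => (ih g hg).2) g hg, key Xᶜ hA (fun g hg h => ?_) g hg⟩
    rw [compl_compl] at h ⊢
    exact (ih g hg).1 h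

theorem fixII {X : Set ι} (φ : MulAut (FreeGroup ι)) (hA : ∀ g ∈ Fac Xᶜ, φ g ∈ Fac Xᶜ)
    (hB : ∀ g ∈ Fac X, φ g ∈ Fac X) : FixA φ = (FixA φ ⊓ Fac X) ⊔ (FixA φ ⊓ Fac Xᶜ) := by
  apply le_antisymm _ (sup_le inf_le_left inf_le_left)
  have step : ∀ Y : Set ι, (∀ g ∈ Fac Y, φ g ∈ Fac Y) → (∀ g, g ∈ UU (Lt Yᶜ) → φ g ∈ UU (Lt Yᶜ)) →
      ∀ g, φ g = g → g ∈ UU (Lt Y) → ∃ a h, φ a = a ∧ a ∈ Fac Y ∧ φ h = h ∧ g = a * h ∧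
        h.toWord.length < g.toWord.length := by
    intro Y hY hU g hg hgU
    obtain ⟨a, ha, h, hgah, hh, hlen⟩ := fac_decomp Y g
    have ha1 : a ≠ 1 := by rintro rfl; apply hh; rw [hgah, one_mul] at hgU; exact hgU
    have hl : 0 < a.toWord.length := List.length_pos_iff.2 (by simpa using ha1)
    have hφh : φ h ∉ UU (Lt Y) := by
      rw [notMem_UU_Lt]
      rcases notMem_UU_Lt.1 hh with rfl | h'
      · left; simp
      · right; exact hU _ h'
    have e : a⁻¹ * φ a * φ h = h := by
      rw [mul_assoc, ← map_mul, ← hgah, hg, hgah]; group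
    have e2 : a⁻¹ * φ a = 1 := fac_uniq (mul_mem (inv_mem ha) (hY a ha)) hφh (by rw [e]; exact hh)
    have e3 : φ a = a := (inv_mul_eq_one.1 e2).symm
    refine ⟨a, h, e3, ha, by rwa [e2, one_mul] at e, hgah, ?_⟩
    have := congrArg List.length hlen
    rw [List.length_append] at this
    omega
  have hp := fun g => fixII_pres φ hA hB _ g le_rfl
  suffices ∀ n, ∀ g : FreeGroup ι, g.toWord.length ≤ n → φ g = g →
      g ∈ (FixA φ ⊓ Fac X) ⊔ (FixA φ ⊓ Fac Xᶜ) from fun g hg => this _ g le_rfl hg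
  intro n
  induction n with
  | zero =>
    intro g hg _
    have : g = 1 := by simpa using hg
    subst this
    exact one_mem _
  | succ n ih =>
    intro g hg hfix
    by_cases hX : g ∈ UU (Lt X)
    · obtain ⟨a, h, h1, h2, h3, rfl, h5⟩ := step X hB (fun g => (hp g).2) g hfix hX
      exact mul_mem (Subgroup.mem_sup_left ⟨h1, h2⟩) (ih h (by omega) h3)
    · rcases notMem_UU_Lt.1 hX with rfl | hX
      · exact one_mem _
      · obtain ⟨a, h, h1, h2, h3, rfl, h5⟩ := step Xᶜ hA (fun g h => by
          rw [compl_compl] at h ⊢; exact (hp g).1 h) g hfix hX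
        exact mul_mem (Subgroup.mem_sup_right ⟨h1, h2⟩) (ih h (by omega) h3)

variable [Fintype ι]

theorem fixI {i : ι} (φ : MulAut (FreeGroup ι)) (hW : ∀ g, φ g ∈ N [(i, true)] ↔ g ∈ N [(i, true)])
    (hA : ∀ g ∈ Fac ({i}ᶜ : Set ι), φ g ∈ Fac ({i}ᶜ : Set ι)) {b : FreeGroup ι} (hb : b ∈ Fac ({i}ᶜ : Set ι))
    (hx : φ (of i) = of i * b) (hn : ∀ g ∈ Fac ({i}ᶜ : Set ι), b ≠ g * (φ g)⁻¹) :
    FixA φ = (FixA φ ⊓ Fac ({i}ᶜ : Set ι)) ⊔ cj (of i) (FixA (MulAut.conj b * φ) ⊓ Fac ({i}ᶜ : Set ι)) := by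
  set A := Fac ({i}ᶜ : Set ι) with hAd
  have hWm : ∀ g, g ∈ N [(i, false)] ↔ of i * g ∉ N [(i, true)] := by
    intro g
    have := N_eq_ltr (L := []) (d := (i, false)) (by simp)
    simp only [List.nil_append] at this
    rw [this, mem_ltr]
    have e : (FreeGroup.mk [(i, false)])⁻¹ = of i := by rw [FreeGroup.inv_mk]; rfl
    rw [e]; rfl
  have hW' : ∀ g, b * φ g ∈ N [(i, false)] ↔ g ∈ N [(i, false)] := by
    intro g
    rw [hWm, hWm, ← hW (of i * g), map_mul, hx, mul_assoc]
  have hnU : ∀ g, g ∈ N [(i, true)] ∨ g ∈ N [(i, false)] → g ∉ UU (Lt ({i}ᶜ : Set ι)) := by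
    rintro g hg ⟨d, hd, hd'⟩
    simp only [N_one_iff] at hg
    rcases hg with hg | hg <;> (rw [hg] at hd'; simp at hd'; subst hd'; exact hd rfl)
  have hcases : ∀ h : FreeGroup ι, h ∉ UU (Lt ({i}ᶜ : Set ι)) → h = 1 ∨ h ∈ N [(i, true)] ∨ h ∈ N [(i, false)] := by
    intro h hh
    rcases notMem_UU_Lt.1 hh with h1 | h1
    · exact Or.inl h1
    · right
      rw [compl_compl] at h1
      obtain ⟨⟨j, c⟩, hj, hd⟩ := h1
      have hj' : j = i := hj
      subst hj'
      simp only [N_one_iff]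
      cases c <;> simp [hd]
  have huniq : ∀ {a a' h h' : FreeGroup ι}, a ∈ A → a' ∈ A → h ∉ UU (Lt ({i}ᶜ : Set ι)) →
      h' ∉ UU (Lt ({i}ᶜ : Set ι)) → a * h = a' * h' → a = a' ∧ h = h' := by
    intro a a' h h' ha ha' hh hh' e
    have e1 : a'⁻¹ * a * h = h' := by rw [mul_assoc, e]; group
    have e2 := fac_uniq (mul_mem (inv_mem ha') ha) hh (by rw [e1]; exact hh')
    have e3 : a = a' := (inv_mul_eq_one.1 e2).symm
    exact ⟨e3, by rwa [e2, one_mul] at e1⟩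
  apply le_antisymm
  · suffices ∀ n, ∀ g : FreeGroup ι, g.toWord.length ≤ n → φ g = g →
        g ∈ (FixA φ ⊓ A) ⊔ cj (of i) (FixA (MulAut.conj b * φ) ⊓ A) from fun g hg => this _ g le_rfl hg
    intro n
    induction n with
    | zero =>
      intro g hg _
      have : g = 1 := by simpa using hg
      subst this
      exact one_mem _
    | succ n ih =>
      intro g hg hfix
      obtain ⟨a, ha, h, hgah, hh, hlen⟩ := fac_decomp ({i}ᶜ : Set ι) g
      have hfix' : a * h = φ a * φ h := by rw [← map_mul, ← hgah, hfix]
      rcases hcases h hh with rfl | h1 | h1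
      · rw [mul_one] at hgah; subst hgah
        exact Subgroup.mem_sup_left ⟨hfix, ha⟩
      · obtain ⟨e1, e2⟩ := huniq ha (hA a ha) hh (hnU _ (Or.inl ((hW h).2 h1))) hfix'
        set k := (of i)⁻¹ * h with hk
        have hhk : h = of i * k := by rw [hk]; group
        have hk1 : k = b * φ k := by
          rw [hhk, map_mul, hx, mul_assoc] at e2
          exact mul_left_cancel e2
        have hklen : h.toWord.length = k.toWord.length + 1 := by
          rw [N_one_iff] at h1
          rcases toWord_lt1_mul h (i, false) with ⟨h4, h5⟩ | ⟨l, h4, h5⟩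
          · exfalso
            cases hw : h.toWord with
            | nil => simp [hw] at h1
            | cons d l => rw [hw] at h1; simp at h1; exact h4 l (by rw [hw, h1]; rfl)
          · have : lt1 (i, false) * h = k := by rw [lt1_false]
            rw [this] at h5
            rw [h4, h5]; rfl
        obtain ⟨a2, ha2, h2, hk2, hh2, hlen2⟩ := fac_decomp ({i}ᶜ : Set ι) k
        have hk3 : a2 * h2 = b * φ a2 * φ h2 := by
          rw [mul_assoc, ← map_mul, ← hk2]; exact hk1
        rcases hcases h2 hh2 with rfl | h3 | h3
        · exfalso
          refine hn a2 ha2 ?_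
          rw [map_one, mul_one, mul_one] at hk3
          rw [eq_mul_inv_iff_mul_eq]; exact hk3.symm
        · exfalso
          refine hn a2 ha2 ?_
          rw [eq_mul_inv_iff_mul_eq]
          exact (huniq ha2 (mul_mem hb (hA a2 ha2)) hh2 (hnU _ (Or.inl ((hW h2).2 h3))) hk3).1.symm
        · have e3 := huniq (a' := b * φ a2 * b⁻¹) (h' := b * φ h2) ha2
            (mul_mem (mul_mem hb (hA a2 ha2)) (inv_mem hb)) hh2 (hnU _ (Or.inr ((hW' h2).2 h3)))
            (by rw [hk3]; group)
          have hx2 : φ (of i * h2) = of i * h2 := by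
            rw [map_mul, hx, mul_assoc, ← e3.2]
          have hlen3 : (of i * h2).toWord.length < h2.toWord.length := by
            rw [N_one_iff] at h3
            rcases toWord_lt1_mul h2 (i, true) with ⟨h4, h5⟩ | ⟨l, h4, h5⟩
            · exfalso
              cases hw : h2.toWord with
              | nil => simp [hw] at h3
              | cons d l => rw [hw] at h3; simp at h3; exact h4 l (by rw [hw, h3]; rfl)
            · rw [lt1_true] at h5
              rw [h4, h5]; simp
          have hg' : g = a * (of i * a2 * (of i)⁻¹) * (of i * h2) := by
            rw [hgah, hhk, hk2]; group
          rw [hg']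
          refine mul_mem (mul_mem (Subgroup.mem_sup_left ⟨e1.symm, ha⟩)
            (Subgroup.mem_sup_right (mem_cj' ⟨?_, ha2⟩))) (ih _ ?_ hx2)
          · show b * φ a2 * b⁻¹ = a2
            exact e3.1.symm
          · have l1 := congrArg List.length hlen
            have l2 := congrArg List.length hlen2
            rw [List.length_append] at l1 l2
            omega
      · exfalso
        have e3 := huniq (a' := φ a * b⁻¹) (h' := b * φ h) ha
            (mul_mem (hA a ha) (inv_mem hb)) hh (hnU _ (Or.inr ((hW' h).2 h1)))
            (by rw [hfix']; group)
        refine hn a⁻¹ (inv_mem ha) ?_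
        rw [map_inv, inv_inv, eq_inv_mul_iff_mul_eq]
        exact mul_eq_of_eq_mul_inv e3.1
  · refine sup_le inf_le_left ?_
    intro g hg
    rw [mem_cj] at hg
    have h1 : b * φ ((of i)⁻¹ * g * of i) * b⁻¹ = (of i)⁻¹ * g * of i := hg.1
    rw [map_mul, map_mul, map_inv, hx] at h1
    rw [mem_FixA]
    have : φ g = of i * (b * ((of i * b)⁻¹ * φ g * (of i * b)) * b⁻¹) * (of i)⁻¹ := by group
    rw [this, h1]; group
end
end MV


namespace MV
open FreeGroup (of)

/-- not a proper power -/
def NPP {G : Type} [Group G] (y : G) : Prop := ¬ ∃ (h : G) (m : ℕ), 2 ≤ m ∧ y = h ^ m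

/-- The subgroup `K` has the required shape with respect to some basis. -/
def Nice (G : Type) [Group G] (K : Subgroup G) : Prop :=
  ∃ (X J : Type) (_ : Fintype X) (_ : Fintype J) (x : X → G) (lab : X → Option J) (y : J → G)
    (w : X → G) (ht : X → ℕ), Function.Bijective (FreeGroup.lift x) ∧
    K = Subgroup.closure (Set.range y ∪ {g | ∃ k, lab k = none ∧ g = (x k)⁻¹ * w k * x k}) ∧
    (∀ j, NPP (y j) ∧ y j ∈ Subgroup.closure (x '' {k | lab k = some j})) ∧
    ∀ k, lab k = none → w k ∈ Subgroup.closure (x '' {k' | lab k' ≠ none ∨ ht k' < ht k})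

lemma closure_of_surj {X G : Type} [Group G] {x : X → G} (h : Function.Bijective (FreeGroup.lift x)) :
    Subgroup.closure (Set.range x) = ⊤ := by
  rw [← FreeGroup.range_lift_eq_closure, MonoidHom.range_eq_top]
  exact h.2

lemma range_closure {X G H : Type} [Group G] [Group H] {x : X → G}
    (h : Subgroup.closure (Set.range x) = ⊤) (f : G →* H) :
    f.range = Subgroup.closure (Set.range (fun i => f (x i))) := by
  rw [MonoidHom.range_eq_map, ← h, MonoidHom.map_closure, ← Set.range_comp]; rfl

/-- master construction -/
lemma Nice.master {G1 G2 G E : Type} [Group G1] [Group G2] [Group G] [Fintype E]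
    {K1 : Subgroup G1} {K2 : Subgroup G2} (h1 : Nice G1 K1) (h2 : Nice G2 K2) {r1 r2 r : ℕ}
    (R1 : Rk r1 G1) (R2 : Rk r2 G2) (R : Rk r G) (hr : r = r1 + r2 + Fintype.card E)
    (f1 : G1 →* G) (f2 : G2 →* G) (t : E → G) (u : E → G)
    (hgen : f1.range ⊔ f2.range ⊔ Subgroup.closure (Set.range t) = ⊤)
    (hu : ∀ e, u e ∈ f1.range ⊔ f2.range) :
    Nice G (K1.map f1 ⊔ K2.map f2 ⊔ Subgroup.closure (Set.range fun e => t e * u e * (t e)⁻¹)) := by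
  obtain ⟨X1, J1, _, _, x1, lab1, y1, w1, ht1, hb1, hK1, hy1, hw1⟩ := h1
  obtain ⟨X2, J2, _, _, x2, lab2, y2, w2, ht2, hb2, hK2, hy2, hw2⟩ := h2
  let x : (X1 ⊕ X2) ⊕ E → G := Sum.elim (Sum.elim (fun i => f1 (x1 i)) (fun i => f2 (x2 i))) (fun e => (t e)⁻¹)
  have hf1 := range_closure (closure_of_surj hb1) f1
  have hf2 := range_closure (closure_of_surj hb2) f2
  have hb : Function.Bijective (FreeGroup.lift x) := by
    refine basis_of_gen R ?_ ?_
    · simp only [Fintype.card_sum]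
      rw [R1.card hb1, R2.card hb2, hr]
    · rw [eq_top_iff, ← hgen, hf1, hf2]
      refine sup_le (sup_le ?_ ?_) ?_
      · rw [Subgroup.closure_le]; rintro _ ⟨i, rfl⟩
        exact Subgroup.subset_closure ⟨Sum.inl (Sum.inl i), rfl⟩
      · rw [Subgroup.closure_le]; rintro _ ⟨i, rfl⟩
        exact Subgroup.subset_closure ⟨Sum.inl (Sum.inr i), rfl⟩
      · rw [Subgroup.closure_le]; rintro _ ⟨i, rfl⟩
        have : (t i)⁻¹ ∈ Subgroup.closure (Set.range x) := Subgroup.subset_closure ⟨Sum.inr i, rfl⟩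
        simpa using inv_mem this
  let e := MulEquiv.ofBijective _ hb
  have he : ∀ k, e.symm (x k) = of k := by
    intro k; rw [MulEquiv.symm_apply_eq]; simp [e]
  have ret : ∀ {G' X' : Type} [Group G'] (f' : G' →* G) (x' : X' → G') (hx' : Function.Bijective (FreeGroup.lift x'))
      (σ : (X1 ⊕ X2) ⊕ E → G') (hσ : ∀ i, ∃ k, x k = f' (x' i) ∧ σ k = x' i) (y : G'), NPP y → NPP (f' y) := by
    rintro G' X' _ f' x' hx' σ hσ y hy ⟨h, m, hm, hym⟩
    let ρ : G →* G' := (FreeGroup.lift σ).comp e.symm.toMonoidHom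
    have hρ : ∀ g, ρ (f' g) = g := by
      intro g
      have : (ρ.comp f').comp (FreeGroup.lift x') = FreeGroup.lift x' := by
        ext i
        obtain ⟨k, hk, hk'⟩ := hσ i
        simp only [MonoidHom.comp_apply, FreeGroup.lift_apply_of, ρ]
        rw [← hk]
        have := he k
        simp only [MulEquiv.toMonoidHom_eq_coe, MonoidHom.coe_coe]
        rw [he, FreeGroup.lift_apply_of, hk']
      obtain ⟨v, rfl⟩ := hx'.2 g
      exact DFunLike.congr_fun this v
    exact hy ⟨ρ h, m, hm, by rw [← map_pow, ← hym, hρ]⟩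
  let M : ℕ := (∑ i, ht1 i) + (∑ i, ht2 i) + 1
  have hM1 : ∀ i, ht1 i < M := fun i => by
    have := Finset.single_le_sum (f := ht1) (fun i _ => Nat.zero_le _) (Finset.mem_univ i)
    simp only [M]; omega
  have hM2 : ∀ i, ht2 i < M := fun i => by
    have := Finset.single_le_sum (f := ht2) (fun i _ => Nat.zero_le _) (Finset.mem_univ i)
    simp only [M]; omega
  let lab : (X1 ⊕ X2) ⊕ E → Option (J1 ⊕ J2) := Sum.elim (Sum.elim (fun i => (lab1 i).map Sum.inl)
    (fun i => (lab2 i).map Sum.inr)) (fun _ => none)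
  let w : (X1 ⊕ X2) ⊕ E → G := Sum.elim (Sum.elim (fun i => f1 (w1 i)) (fun i => f2 (w2 i))) u
  let ht : (X1 ⊕ X2) ⊕ E → ℕ := Sum.elim (Sum.elim ht1 ht2) (fun _ => M)
  let y : J1 ⊕ J2 → G := Sum.elim (fun j => f1 (y1 j)) (fun j => f2 (y2 j))
  refine ⟨(X1 ⊕ X2) ⊕ E, J1 ⊕ J2, inferInstance, inferInstance, x, lab, y, w, ht, hb, ?_, ?_, ?_⟩
  · apply le_antisymm
    · refine sup_le (sup_le ?_ ?_) ?_
      · rw [hK1, MonoidHom.map_closure, Subgroup.closure_le]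
        rintro _ ⟨g, ⟨j, rfl⟩ | ⟨k, hk, rfl⟩, rfl⟩
        · exact Subgroup.subset_closure (Or.inl ⟨Sum.inl j, rfl⟩)
        · refine Subgroup.subset_closure (Or.inr ⟨Sum.inl (Sum.inl k), ?_, ?_⟩)
          · simp [lab, hk]
          · simp [x, w]
      · rw [hK2, MonoidHom.map_closure, Subgroup.closure_le]
        rintro _ ⟨g, ⟨j, rfl⟩ | ⟨k, hk, rfl⟩, rfl⟩
        · exact Subgroup.subset_closure (Or.inl ⟨Sum.inr j, rfl⟩)
        · refine Subgroup.subset_closure (Or.inr ⟨Sum.inl (Sum.inr k), ?_, ?_⟩)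
          · simp [lab, hk]
          · simp [x, w]
      · rw [Subgroup.closure_le]
        rintro _ ⟨k, rfl⟩
        refine Subgroup.subset_closure (Or.inr ⟨Sum.inr k, ?_, ?_⟩)
        · simp [lab]
        · simp [x, w]
    · rw [Subgroup.closure_le]
      rintro _ (⟨j | j, rfl⟩ | ⟨(k | k) | k, hk, rfl⟩)
      · refine Subgroup.mem_sup_left (Subgroup.mem_sup_left ⟨y1 j, ?_, rfl⟩)
        rw [hK1]; exact Subgroup.subset_closure (Or.inl ⟨j, rfl⟩)
      · refine Subgroup.mem_sup_left (Subgroup.mem_sup_right ⟨y2 j, ?_, rfl⟩)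
        rw [hK2]; exact Subgroup.subset_closure (Or.inl ⟨j, rfl⟩)
      · refine Subgroup.mem_sup_left (Subgroup.mem_sup_left ⟨(x1 k)⁻¹ * w1 k * x1 k, ?_, by simp [x, w]⟩)
        rw [hK1]; exact Subgroup.subset_closure (Or.inr ⟨k, by simpa [lab] using hk, rfl⟩)
      · refine Subgroup.mem_sup_left (Subgroup.mem_sup_right ⟨(x2 k)⁻¹ * w2 k * x2 k, ?_, by simp [x, w]⟩)
        rw [hK2]; exact Subgroup.subset_closure (Or.inr ⟨k, by simpa [lab] using hk, rfl⟩)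
      · exact Subgroup.mem_sup_right (Subgroup.subset_closure ⟨k, by simp [x, w]⟩)
  · have mv1 : ∀ (S : Set X1) (T : Set ((X1 ⊕ X2) ⊕ E)), (∀ k ∈ S, Sum.inl (Sum.inl k) ∈ T) → ∀ g,
        g ∈ Subgroup.closure (x1 '' S) → f1 g ∈ Subgroup.closure (x '' T) := by
      intro S T hST g hg
      have := Subgroup.mem_map_of_mem f1 hg
      rw [MonoidHom.map_closure] at this
      refine Subgroup.closure_mono ?_ this
      rintro _ ⟨_, ⟨k, hk, rfl⟩, rfl⟩
      exact ⟨_, hST k hk, rfl⟩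
    have mv2 : ∀ (S : Set X2) (T : Set ((X1 ⊕ X2) ⊕ E)), (∀ k ∈ S, Sum.inl (Sum.inr k) ∈ T) → ∀ g,
        g ∈ Subgroup.closure (x2 '' S) → f2 g ∈ Subgroup.closure (x '' T) := by
      intro S T hST g hg
      have := Subgroup.mem_map_of_mem f2 hg
      rw [MonoidHom.map_closure] at this
      refine Subgroup.closure_mono ?_ this
      rintro _ ⟨_, ⟨k, hk, rfl⟩, rfl⟩
      exact ⟨_, hST k hk, rfl⟩
    rintro (j | j)
    · refine ⟨ret f1 x1 hb1 (Sum.elim (Sum.elim x1 1) 1) (fun i => ⟨Sum.inl (Sum.inl i), rfl, rfl⟩) _ (hy1 j).1, ?_⟩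
      refine mv1 _ _ ?_ _ (hy1 j).2
      intro k hk
      simp only [Set.mem_setOf_eq] at hk
      simp [lab, hk]
    · refine ⟨ret f2 x2 hb2 (Sum.elim (Sum.elim 1 x2) 1) (fun i => ⟨Sum.inl (Sum.inr i), rfl, rfl⟩) _ (hy2 j).1, ?_⟩
      refine mv2 _ _ ?_ _ (hy2 j).2
      intro k hk
      simp only [Set.mem_setOf_eq] at hk
      simp [lab, hk]
  · rintro ((k | k) | k) hk
    · have h := Subgroup.mem_map_of_mem f1 (hw1 k (by simpa [lab] using hk))
      rw [MonoidHom.map_closure] at h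
      refine Subgroup.closure_mono ?_ h
      rintro _ ⟨_, ⟨i, hi, rfl⟩, rfl⟩
      refine ⟨Sum.inl (Sum.inl i), ?_, rfl⟩
      simpa [lab, ht] using hi
    · have h := Subgroup.mem_map_of_mem f2 (hw2 k (by simpa [lab] using hk))
      rw [MonoidHom.map_closure] at h
      refine Subgroup.closure_mono ?_ h
      rintro _ ⟨_, ⟨i, hi, rfl⟩, rfl⟩
      refine ⟨Sum.inl (Sum.inr i), ?_, rfl⟩
      simpa [lab, ht] using hi
    · have h := hu k
      rw [hf1, hf2, ← Subgroup.closure_union] at h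
      refine Subgroup.closure_mono ?_ h
      rintro _ (⟨i, rfl⟩ | ⟨i, rfl⟩)
      · exact ⟨Sum.inl (Sum.inl i), Or.inr (hM1 i), rfl⟩
      · exact ⟨Sum.inl (Sum.inr i), Or.inr (hM2 i), rfl⟩

lemma Nice.bot {G : Type} [Group G] {r : ℕ} (R : Rk r G) : Nice G ⊥ := by
  obtain ⟨e⟩ := R
  refine ⟨Fin r, Empty, inferInstance, inferInstance, fun i => e (of i), fun _ => none, Empty.elim, fun _ => 1,
    fun _ => 0, ?_, ?_, fun j => j.elim, fun k _ => one_mem _⟩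
  · have : FreeGroup.lift (fun i => e (of i)) = e.toMonoidHom := by ext; simp
    rw [this]; exact e.bijective
  · symm; rw [eq_bot_iff, Subgroup.closure_le]
    rintro _ (⟨j, _⟩ | ⟨k, -, rfl⟩)
    · exact j.elim
    · simp

lemma Nice.cyc {G : Type} [Group G] {r : ℕ} (R : Rk r G) {y : G} (hy : NPP y) :
    Nice G (Subgroup.zpowers y) := by
  obtain ⟨e⟩ := R
  have hb : Function.Bijective (FreeGroup.lift (fun i : Fin r => e (of i))) := by
    have : FreeGroup.lift (fun i => e (of i)) = e.toMonoidHom := by ext; simp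
    rw [this]; exact e.bijective
  refine ⟨Fin r, Unit, inferInstance, inferInstance, fun i => e (of i), fun _ => some (), fun _ => y, fun _ => 1,
    fun _ => 0, hb, ?_, fun j => ⟨hy, ?_⟩, fun k _ => one_mem _⟩
  · rw [Subgroup.zpowers_eq_closure]
    congr 1
    ext g; simp [eq_comm]
  · have := closure_of_surj hb
    simp [this]

lemma Rk.zero : Rk 0 (FreeGroup Empty) := Rk.free (X := Empty)

lemma Nice.rk {G : Type} [Group G] {K : Subgroup G} (h : Nice G K) : ∃ r, Rk r G := by
  obtain ⟨X1, J1, _, _, x1, lab1, y1, w1, ht1, hb1, hK1, hy1, hw1⟩ := h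
  exact ⟨_, Rk.of_basis hb1⟩

/-- adding generators -/
lemma Nice.ext {G1 G E : Type} [Group G1] [Group G] [Fintype E]
    {K1 : Subgroup G1} (h1 : Nice G1 K1) {r1 r : ℕ}
    (R1 : Rk r1 G1) (R : Rk r G) (hr : r = r1 + Fintype.card E)
    (f1 : G1 →* G) (t : E → G) (u : E → G)
    (hgen : f1.range ⊔ Subgroup.closure (Set.range t) = ⊤)
    (hu : ∀ e, u e ∈ f1.range) :
    Nice G (K1.map f1 ⊔ Subgroup.closure (Set.range fun e => t e * u e * (t e)⁻¹)) := by
  have := Nice.master h1 (Nice.bot Rk.zero) R1 Rk.zero R (by rw [hr]; rfl) f1 1 t u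
    (by rw [eq_top_iff, ← hgen]; exact sup_le_sup_right le_sup_left _)
    (fun e => Subgroup.mem_sup_left (hu e))
  simpa using this

lemma Nice.iso {G H : Type} [Group G] [Group H] {K : Subgroup G} (h : Nice G K) (e : G ≃* H) :
    Nice H (K.map e.toMonoidHom) := by
  obtain ⟨r, R⟩ := h.rk
  have := h.ext (E := Empty) R (R.iso e) (by simp) e.toMonoidHom Empty.elim Empty.elim
    (by rw [MonoidHom.range_eq_top.2 e.surjective]; simp) (fun e => e.elim)
  rw [Set.range_eq_empty] at this
  simpa using this

lemma Nice.cj {G : Type} [Group G] {K : Subgroup G} (h : Nice G K) (g : G) : Nice G (cj g K) := by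
  rw [cj_eq_map]; exact h.iso _

end MV


namespace MV
open FreeGroup (of)

/-- a list of subgroups of `F` such that every graph-of-groups type assembly is nice -/
def NiceSys (F : Type) [Group F] {κ : Type} [Fintype κ] (P : κ → Subgroup F) : Prop :=
  ∀ (G : Type) [Group G] (f : F →* G) (g : κ → G) (m r : ℕ), Rk m F → Rk r G →
    r + 1 = m + Fintype.card κ →
    f.range ⊔ Subgroup.closure (Set.range fun p : κ × κ => (g p.1)⁻¹ * g p.2) = ⊤ →
    Nice G (⨆ k, cj (g k) ((P k).map f))

lemma cj_iSup {G : Type} {κ : Sort*} [Group G] (g : G) (P : κ → Subgroup G) : cj g (⨆ k, P k) = ⨆ k, cj g (P k) := by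
  simp only [cj_eq_map, Subgroup.map_iSup]

lemma cj_sup {G : Type} [Group G] (g : G) (P Q : Subgroup G) : cj g (P ⊔ Q) = cj g P ⊔ cj g Q := by
  simp only [cj_eq_map, Subgroup.map_sup]

section
variable {F : Type} [Group F] {κ : Type} [Fintype κ] {P : κ → Subgroup F}

lemma NiceSys.intro (k0 : κ) (h : ∀ (G : Type) [Group G] (f : F →* G) (g : κ → G) (m r : ℕ), Rk m F → Rk r G →
    r + 1 = m + Fintype.card κ → g k0 = 1 → f.range ⊔ Subgroup.closure (Set.range g) = ⊤ →
    Nice G (⨆ k, cj (g k) ((P k).map f))) : NiceSys F P := by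
  intro G _ f g m r hF hG hr hgen
  have := h G f (fun k => (g k0)⁻¹ * g k) m r hF hG hr (by simp) (by
    rw [eq_top_iff, ← hgen]
    refine sup_le le_sup_left ?_
    rw [Subgroup.closure_le]
    rintro _ ⟨⟨k, l⟩, rfl⟩
    refine Subgroup.mem_sup_right ?_
    have h1 : (g k0)⁻¹ * g k ∈ Subgroup.closure (Set.range fun k => (g k0)⁻¹ * g k) :=
      Subgroup.subset_closure ⟨k, rfl⟩
    have h2 : (g k0)⁻¹ * g l ∈ Subgroup.closure (Set.range fun k => (g k0)⁻¹ * g k) :=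
      Subgroup.subset_closure ⟨l, rfl⟩
    have := mul_mem (inv_mem h1) h2
    simpa [mul_assoc] using this)
  have := this.cj (g k0)
  rw [cj_iSup] at this
  simpa [cj_cj] using this

lemma NiceSys.model (h : NiceSys F P) {m : ℕ} (hF : Rk m F) (k0 : κ) :
    ∃ (Gm : Type) (_ : Group Gm) (K : Subgroup Gm) (r : ℕ), Rk r Gm ∧ r + 1 = m + Fintype.card κ ∧ Nice Gm K ∧
      ∀ (G : Type) [Group G] (f : F →* G) (g : κ → G), g k0 = 1 → ∃ h : Gm →* G,
        h.range = f.range ⊔ Subgroup.closure (Set.range g) ∧ K.map h = ⨆ k, cj (g k) ((P k).map f) := by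
  classical
  obtain ⟨e⟩ := hF
  let T := Fin m ⊕ {k : κ // k ≠ k0}
  let fm : F →* FreeGroup T := (FreeGroup.lift fun i => of (Sum.inl i)).comp e.symm.toMonoidHom
  let gm : κ → FreeGroup T := fun k => if h : k = k0 then 1 else of (Sum.inr ⟨k, h⟩)
  have hgm0 : gm k0 = 1 := by simp [gm]
  have hgm : ∀ k : {k : κ // k ≠ k0}, gm k.1 = of (Sum.inr k) := fun k => by simp [gm, k.2]
  have hfm : ∀ i, fm (e (of i)) = of (Sum.inl i) := fun i => by simp [fm]
  have hcard : Fintype.card T + 1 = m + Fintype.card κ := by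
    simp only [T, Fintype.card_sum, Fintype.card_fin, Fintype.card_subtype_compl, Fintype.card_unique]
    have : 0 < Fintype.card κ := Fintype.card_pos_iff.2 ⟨k0⟩
    omega
  have hN := h (FreeGroup T) fm gm m (Fintype.card T) ⟨e⟩ Rk.free hcard (by
    rw [eq_top_iff, ← FreeGroup.closure_range_of T, Subgroup.closure_le]
    rintro _ ⟨i | k, rfl⟩
    · refine Subgroup.mem_sup_left ⟨_, hfm i⟩
    · refine Subgroup.mem_sup_right (Subgroup.subset_closure ⟨(k0, k.1), ?_⟩)
      simp only [hgm0, hgm]; simp)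
  refine ⟨FreeGroup T, inferInstance, _, _, Rk.free, hcard, hN, ?_⟩
  intro G _ f g hg0
  let h : FreeGroup T →* G := FreeGroup.lift (Sum.elim (fun i => f (e (of i))) (fun k => g k.1))
  have hf : h.comp fm = f := by
    ext x
    obtain ⟨x, rfl⟩ := e.surjective x
    have : (h.comp fm).comp e.toMonoidHom = f.comp e.toMonoidHom := by
      ext i
      simp only [MonoidHom.comp_apply, MulEquiv.toMonoidHom_eq_coe, MonoidHom.coe_coe, hfm]
      simp [h]
    exact DFunLike.congr_fun this x
  have hg : ∀ k, h (gm k) = g k := by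
    intro k
    by_cases hk : k = k0
    · subst hk; rw [hgm0, hg0, map_one]
    · have := hgm ⟨k, hk⟩
      simp only at this
      rw [this]; simp [h]
  refine ⟨h, ?_, ?_⟩
  · apply le_antisymm
    · rw [range_closure (FreeGroup.closure_range_of T), Subgroup.closure_le]
      rintro _ ⟨i | k, rfl⟩
      · refine Subgroup.mem_sup_left ⟨e (of i), ?_⟩
        simp [h]
      · refine Subgroup.mem_sup_right (Subgroup.subset_closure ⟨k.1, ?_⟩)
        simp [h]
    · refine sup_le ?_ ?_
      · rintro _ ⟨x, rfl⟩; rw [← hf]; exact ⟨_, rfl⟩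
      · rw [Subgroup.closure_le]; rintro _ ⟨k, rfl⟩
        exact ⟨_, hg k⟩
  · rw [Subgroup.map_iSup]
    refine iSup_congr fun k => ?_
    rw [map_cj, hg, Subgroup.map_map, hf]

lemma NiceSys.transport (h : NiceSys F P) {F' κ' : Type} [Group F'] [Fintype κ'] (e : F ≃* F') (σ : κ' ≃ κ)
    (c : κ' → F') {P' : κ' → Subgroup F'} (hP' : ∀ k, P' k = cj (c k) ((P (σ k)).map e.toMonoidHom)) :
    NiceSys F' P' := by
  intro G _ f g m r hF hG hr hgen
  have := h G (f.comp e.toMonoidHom) (fun k => g (σ.symm k) * f (c (σ.symm k))) m r (hF.iso e.symm) hG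
    (by rw [hr, Fintype.card_congr σ]) (by
      have hfr : (f.comp e.toMonoidHom).range = f.range := by
        rw [MonoidHom.range_comp, MonoidHom.range_eq_top.2 e.surjective, ← MonoidHom.range_eq_map]
      rw [hfr, eq_top_iff, ← hgen]
      refine sup_le le_sup_left ?_
      rw [Subgroup.closure_le]
      rintro _ ⟨⟨k, l⟩, rfl⟩
      set S := f.range ⊔ Subgroup.closure (Set.range fun p : κ × κ =>
        (g (σ.symm p.1) * f (c (σ.symm p.1)))⁻¹ * (g (σ.symm p.2) * f (c (σ.symm p.2))))
      have h1 : ∀ k, f (c k) ∈ S := fun k => Subgroup.mem_sup_left ⟨_, rfl⟩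
      have h2 : (g k * f (c k))⁻¹ * (g l * f (c l)) ∈ S :=
        Subgroup.mem_sup_right (Subgroup.subset_closure ⟨(σ k, σ l), by simp⟩)
      have := mul_mem (mul_mem (h1 k) h2) (inv_mem (h1 l))
      have e : f (c k) * ((g k * f (c k))⁻¹ * (g l * f (c l))) * (f (c l))⁻¹ = (g k)⁻¹ * g l := by group
      rwa [e] at this)
  convert this using 1
  rw [← σ.iSup_comp]
  refine iSup_congr fun k => ?_
  rw [hP', map_cj, cj_cj, Subgroup.map_map]
  simp

/-- one conjugate of a single nice subgroup -/
lemma NiceSys.single [Unique κ] (h : ∀ m, Rk m F → Nice F (P default)) : NiceSys F P := by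
  refine NiceSys.intro default ?_
  intro G _ f g m r hF hG hr hg hgen
  have hr' : r = m := by simpa using hr
  subst hr'
  have hsurj : Function.Surjective f := by
    rw [← MonoidHom.range_eq_top, eq_top_iff, ← hgen]
    refine sup_le le_rfl ?_
    rw [Subgroup.closure_le]; rintro _ ⟨k, rfl⟩
    rw [Unique.eq_default k, hg]; exact one_mem _
  obtain ⟨e⟩ := hF
  have hb : Function.Bijective (FreeGroup.lift fun i => f (e (of i))) := by
    refine basis_of_gen hG (by simp) ?_
    rw [← MonoidHom.range_eq_top.2 hsurj, range_closure (x := fun i => e (of i)) ?_ f]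
    rw [← (MonoidHom.range_eq_top (f := e.toMonoidHom)).2 e.surjective]
    exact (range_closure (FreeGroup.closure_range_of _) e.toMonoidHom).symm
  have hb' : Function.Bijective (f.comp e.toMonoidHom) := by
    convert hb using 2
    ext i; simp
  have hbf : Function.Bijective f := by
    refine ⟨?_, hsurj⟩
    intro a b hab
    obtain ⟨a, rfl⟩ := e.surjective a
    obtain ⟨b, rfl⟩ := e.surjective b
    rw [hb'.1 hab]
  have := (h _ ⟨e⟩).iso (MulEquiv.ofBijective f hbf)
  rw [iSup_unique, hg, cj_one]
  exact this

/-- R1: a cyclic member -/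
lemma NiceSys.R1 [DecidableEq κ] (k0 k1 : κ) (hk : k0 ≠ k1) (y : F) (hy : P k1 = Subgroup.zpowers y)
    (h : NiceSys F (fun k : {k // k ≠ k1} => P k.1)) : NiceSys F P := by
  refine NiceSys.intro k0 ?_
  intro G _ f g m r hF hG hr hg hgen
  obtain ⟨Gm, _, K, rm, hRm, hrm, hN, hM⟩ := h.model hF ⟨k0, hk⟩
  obtain ⟨h', hh1, hh2⟩ := hM G f (fun k => g k.1) hg
  have hcard : Fintype.card {k // k ≠ k1} + 1 = Fintype.card κ := by
    simp only [Fintype.card_subtype_compl, Fintype.card_unique]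
    have : 0 < Fintype.card κ := Fintype.card_pos_iff.2 ⟨k0⟩
    omega
  have := hN.ext (E := Unit) hRm hG (by rw [Fintype.card_unit]; omega) h' (fun _ => g k1) (fun _ => f y) (by
      rw [eq_top_iff, ← hgen, hh1]
      refine sup_le (le_sup_left.trans le_sup_left) ?_
      rw [Subgroup.closure_le]; rintro _ ⟨k, rfl⟩
      by_cases hk : k = k1
      · subst hk; exact Subgroup.mem_sup_right (Subgroup.subset_closure ⟨(), rfl⟩)
      · exact Subgroup.mem_sup_left (Subgroup.mem_sup_right (Subgroup.subset_closure ⟨⟨k, hk⟩, rfl⟩)))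
    (fun _ => by rw [hh1]; exact Subgroup.mem_sup_left ⟨_, rfl⟩)
  convert this using 1
  have e1 : (Subgroup.closure (Set.range fun _ : Unit => g k1 * f y * (g k1)⁻¹)) =
      cj (g k1) ((P k1).map f) := by
    rw [hy, cj_eq_map, MonoidHom.map_zpowers, MonoidHom.map_zpowers, Subgroup.zpowers_eq_closure]
    simp
  rw [e1, hh2]
  apply le_antisymm
  · refine iSup_le fun k => ?_
    by_cases hk : k = k1
    · subst hk; exact le_sup_right
    · exact le_trans (le_iSup (fun k : {k // k ≠ k1} => cj (g k.1) ((P k.1).map f)) ⟨k, hk⟩) le_sup_left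
  · refine sup_le (iSup_le fun k => ?_) ?_
    · exact le_iSup (fun k => cj (g k) ((P k).map f)) k.1
    · exact le_iSup (fun k => cj (g k) ((P k).map f)) k1

/-- R2/R3 -/
lemma NiceSys.R3 {F1 F2 κ1 κ2 E : Type} [Group F1] [Group F2] [Fintype κ1] [Fintype κ2] [Fintype E]
    {P1 : κ1 → Subgroup F1} {P2 : κ2 → Subgroup F2} (h1 : NiceSys F1 P1) (h2 : NiceSys F2 P2)
    {m1 m2 : ℕ} (R1 : Rk m1 F1) (R2 : Rk m2 F2) (RF : Rk (m1 + m2) F) (i1 : F1 →* F) (i2 : F2 →* F)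
    (hi : i1.range ⊔ i2.range = ⊤) (σ1 : κ1 → κ) (σ2 : κ2 → κ) (hσ : ∀ k, (∃ j, σ1 j = k) ∨ ∃ j, σ2 j = k)
    (a : κ1) (b : κ2) (hab : σ1 a = σ2 b ∨ Nonempty E)
    (hc : Fintype.card κ + 1 = Fintype.card κ1 + Fintype.card κ2 + Fintype.card E)
    (hP1 : ∀ j, (P1 j).map i1 ≤ P (σ1 j)) (hP2 : ∀ j, (P2 j).map i2 ≤ P (σ2 j))
    (hP : ∀ k, P k ≤ (⨆ j, ⨆ (_ : σ1 j = k), (P1 j).map i1) ⊔ (⨆ j, ⨆ (_ : σ2 j = k), (P2 j).map i2)) :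
    NiceSys F P := by
  refine NiceSys.intro (σ1 a) ?_
  intro G _ f g m r hF hG hr hg hgen
  have hm := hF.unique RF
  obtain ⟨G1, _, K1, r1, hR1, hr1, hN1, hM1⟩ := h1.model R1 a
  obtain ⟨G2, _, K2, r2, hR2, hr2, hN2, hM2⟩ := h2.model R2 b
  set u := g (σ2 b) with hu
  obtain ⟨j1, hj1, hj1'⟩ := hM1 G (f.comp i1) (fun k => g (σ1 k)) hg
  obtain ⟨j2, hj2, hj2'⟩ := hM2 G (f.comp i2) (fun k => u⁻¹ * g (σ2 k)) (by simp [hu])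
  have hjm : K2.map ((MulAut.conj u).toMonoidHom.comp j2) = ⨆ k, cj (g (σ2 k)) ((P2 k).map (f.comp i2)) := by
    rw [← Subgroup.map_map, ← cj_eq_map, hj2', cj_iSup]
    simp [cj_cj]
  have hjr : ((MulAut.conj u).toMonoidHom.comp j2).range = cj u j2.range := by
    rw [MonoidHom.range_comp, cj_eq_map]
  have := Nice.master hN1 hN2 hR1 hR2 hG (E := E) (by omega) j1 ((MulAut.conj u).toMonoidHom.comp j2)
    (fun _ => u) (fun _ => 1) (by
      rw [hjr, eq_top_iff, ← hgen]
      set S := j1.range ⊔ cj u j2.range ⊔ Subgroup.closure (Set.range fun _ : E => u) with hS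
      have huS : u ∈ S := by
        rcases hab with h | ⟨⟨e⟩⟩
        · rw [hu, ← h, hg]; exact one_mem _
        · exact Subgroup.mem_sup_right (Subgroup.subset_closure ⟨e, rfl⟩)
      have h1S : j1.range ≤ S := le_sup_left.trans le_sup_left
      have h2S : j2.range ≤ S := by
        intro x hx
        have : u * x * u⁻¹ ∈ S := Subgroup.mem_sup_left (Subgroup.mem_sup_right (mem_cj' hx))
        have := mul_mem (mul_mem (inv_mem huS) this) huS
        have e : u⁻¹ * (u * x * u⁻¹) * u = x := by group
        rwa [e] at this
      refine sup_le ?_ ?_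
      · rw [MonoidHom.range_eq_map, ← hi, Subgroup.map_sup, ← MonoidHom.range_comp, ← MonoidHom.range_comp]
        refine sup_le (le_trans ?_ h1S) (le_trans ?_ h2S)
        · rw [hj1]; exact le_sup_left
        · rw [hj2]; exact le_sup_left
      · rw [Subgroup.closure_le]; rintro _ ⟨k, rfl⟩
        rcases hσ k with ⟨j, rfl⟩ | ⟨j, rfl⟩
        · apply h1S; rw [hj1]; exact Subgroup.mem_sup_right (Subgroup.subset_closure ⟨j, rfl⟩)
        · have : u⁻¹ * g (σ2 j) ∈ S := by
            apply h2S; rw [hj2]; exact Subgroup.mem_sup_right (Subgroup.subset_closure ⟨j, rfl⟩)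
          have := mul_mem huS this
          simpa using this)
    (fun _ => one_mem _)
  convert this using 1
  have e0 : Subgroup.closure (Set.range fun e : E => u * 1 * u⁻¹) = ⊥ := by
    rw [eq_bot_iff, Subgroup.closure_le]; rintro _ ⟨k, rfl⟩; simp
  rw [e0, sup_bot_eq, hj1', hjm]
  apply le_antisymm
  · refine iSup_le fun k => ?_
    refine le_trans (cj_mono (Subgroup.map_mono (hP k))) ?_
    rw [Subgroup.map_sup, cj_sup]
    refine sup_le_sup ?_ ?_
    · rw [Subgroup.map_iSup, cj_iSup]
      refine iSup_le fun j => ?_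
      rw [Subgroup.map_iSup, cj_iSup]
      refine iSup_le fun hj => ?_
      subst hj
      rw [Subgroup.map_map]
      exact le_iSup (fun j => cj (g (σ1 j)) ((P1 j).map (f.comp i1))) j
    · rw [Subgroup.map_iSup, cj_iSup]
      refine iSup_le fun j => ?_
      rw [Subgroup.map_iSup, cj_iSup]
      refine iSup_le fun hj => ?_
      subst hj
      rw [Subgroup.map_map]
      exact le_iSup (fun j => cj (g (σ2 j)) ((P2 j).map (f.comp i2))) j
  · refine sup_le (iSup_le fun j => ?_) (iSup_le fun j => ?_)
    · refine le_trans ?_ (le_iSup (fun k => cj (g k) ((P k).map f)) (σ1 j))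
      rw [← Subgroup.map_map]
      exact cj_mono (Subgroup.map_mono (hP1 j))
    · refine le_trans ?_ (le_iSup (fun k => cj (g k) ((P k).map f)) (σ2 j))
      rw [← Subgroup.map_map]
      exact cj_mono (Subgroup.map_mono (hP2 j))

/-- R2': enlarge the group by a free factor -/
lemma NiceSys.R2' {F1 F2 : Type} [Group F1] [Group F2]
    {P1 : κ → Subgroup F1} (h1 : NiceSys F1 P1) {m1 m2 : ℕ} (R1 : Rk m1 F1) (R2 : Rk m2 F2) (RF : Rk (m1 + m2) F)
    (i1 : F1 →* F) (i2 : F2 →* F) (hi : i1.range ⊔ i2.range = ⊤) (a : κ)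
    (hP : ∀ k, P k = (P1 k).map i1) : NiceSys F P := by
  refine NiceSys.intro a ?_
  intro G _ f g m r hF hG hr hg hgen
  have hm := hF.unique RF
  obtain ⟨G1, _, K1, r1, hR1, hr1, hN1, hM1⟩ := h1.model R1 a
  obtain ⟨j1, hj1, hj1'⟩ := hM1 G (f.comp i1) g hg
  obtain ⟨e2⟩ := R2
  have hgen2 : Subgroup.closure (Set.range fun i => e2 (of i)) = ⊤ := by
    rw [← (MonoidHom.range_eq_top (f := e2.toMonoidHom)).2 e2.surjective]
    exact (range_closure (FreeGroup.closure_range_of _) e2.toMonoidHom).symm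
  have := hN1.ext (E := Fin m2) hR1 hG (by rw [Fintype.card_fin]; omega) j1
    (fun e => f (i2 (e2 (of e)))) (fun _ => 1) (by
      have := range_closure hgen2 (f.comp i2)
      simp only [MonoidHom.comp_apply] at this
      rw [← this, eq_top_iff, ← hgen, hj1]
      refine sup_le ?_ (le_sup_right.trans le_sup_left)
      rw [MonoidHom.range_eq_map, ← hi, Subgroup.map_sup, ← MonoidHom.range_comp, ← MonoidHom.range_comp]
      exact sup_le_sup le_sup_left le_rfl)
    (fun _ => one_mem _)
  convert this using 1
  have e0 : Subgroup.closure (Set.range fun e : Fin m2 => f (i2 (e2 (of e))) * 1 * (f (i2 (e2 (of e))))⁻¹) = ⊥ := by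
    rw [eq_bot_iff, Subgroup.closure_le]; rintro _ ⟨k, rfl⟩; simp
  rw [e0, sup_bot_eq, hj1']
  refine iSup_congr fun k => ?_
  rw [hP, Subgroup.map_map]

/-- R4 -/
lemma NiceSys.R4 {A : Type} [Group A] {Q : Option κ → Subgroup A} (h : NiceSys A Q) {mA : ℕ} (RA : Rk mA A)
    (RF : Rk (mA + 1) F) (i : A →* F) (t : F) (hi : i.range ⊔ Subgroup.zpowers t = ⊤) (k0 : κ)
    (hk0 : P k0 = (Q (some k0)).map i ⊔ cj t ((Q none).map i))
    (hk : ∀ k, k ≠ k0 → P k = (Q (some k)).map i) : NiceSys F P := by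
  intro G _ f g m r hF hG hr hgen
  have hm := hF.unique RF
  have := h G (f.comp i) (fun o => o.elim (g k0 * f t) g) mA r RA hG (by
    rw [Fintype.card_option]; omega) (by
    rw [eq_top_iff, ← hgen]
    refine sup_le ?_ ?_
    · rw [MonoidHom.range_eq_map, ← hi, Subgroup.map_sup, ← MonoidHom.range_comp]
      refine sup_le_sup le_rfl ?_
      rw [MonoidHom.map_zpowers, Subgroup.zpowers_le]
      exact Subgroup.subset_closure ⟨(some k0, none), by simp⟩
    · refine le_trans ?_ le_sup_right
      apply Subgroup.closure_mono
      rintro _ ⟨⟨k, l⟩, rfl⟩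
      exact ⟨(some k, some l), rfl⟩)
  convert this using 1
  rw [iSup_option]
  apply le_antisymm
  · refine iSup_le fun k => ?_
    by_cases hkk : k = k0
    · subst hkk
      rw [hk0, Subgroup.map_sup, cj_sup, map_cj, cj_cj, Subgroup.map_map, Subgroup.map_map]
      exact sup_le (le_trans (le_iSup (fun k => cj (g k) ((Q (some k)).map (f.comp i))) k) le_sup_right) le_sup_left
    · rw [hk k hkk, Subgroup.map_map]
      exact le_trans (le_iSup (fun k => cj (g k) ((Q (some k)).map (f.comp i))) k) le_sup_right
  · refine sup_le ?_ (iSup_le fun k => ?_)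
    · refine le_trans ?_ (le_iSup (fun k => cj (g k) ((P k).map f)) k0)
      rw [hk0, Subgroup.map_sup, cj_sup, map_cj, cj_cj, Subgroup.map_map, Subgroup.map_map]
      exact le_sup_right
    · refine le_trans ?_ (le_iSup (fun k => cj (g k) ((P k).map f)) k)
      by_cases hkk : k = k0
      · subst hkk
        rw [hk0, Subgroup.map_sup, cj_sup, Subgroup.map_map]
        exact le_sup_left
      · rw [hk k hkk, Subgroup.map_map]; exact le_rfl
end
end MV


namespace MV
open FreeGroup (of)

section
variable {F κ : Type} [Group F]

/-- a family of pairwise non isogredient automorphisms in the same outer class -/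
def Fam (α : κ → MulAut F) : Prop :=
  (∀ k l, ∃ x, α k = MulAut.conj x * α l) ∧
    ∀ k l g, α k = MulAut.conj g * α l * (MulAut.conj g)⁻¹ → k = l

/-- all fixed subgroups are non commutative -/
def NC (α : κ → MulAut F) : Prop := ∀ k, ∃ a ∈ FixA (α k), ∃ b ∈ FixA (α k), a * b ≠ b * a

/-- the inductive statement -/
def TT (m : ℕ) : Prop := ∀ (F : Type) [Group F], Rk m F → ∀ (φ : MulAut F) (κ : Type) [Fintype κ] [Nonempty κ]
  (b : κ → F), (∀ k l g, b k = g * b l * (φ g)⁻¹ → k = l) → NiceSys F (fun k => FixA (MulAut.conj (b k) * φ))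

lemma FixA_map (e φ : MulAut F) : FixA (e * φ * e⁻¹) = (FixA φ).map e.toMonoidHom := by
  ext x
  rw [mem_FixA, Subgroup.mem_map]
  constructor
  · intro h
    refine ⟨e⁻¹ x, ?_, by simp⟩
    rw [mem_FixA]
    apply e.injective
    simpa using h
  · rintro ⟨y, hy, rfl⟩
    rw [mem_FixA] at hy
    simp [hy]

lemma FixA_cj (g : F) (φ : MulAut F) : FixA (MulAut.conj g * φ * (MulAut.conj g)⁻¹) = cj g (FixA φ) := by
  rw [FixA_map, cj_eq_map]

lemma aut_conj (e : MulAut F) (x : F) : e * MulAut.conj x = MulAut.conj (e x) * e := by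
  ext y; simp

lemma tw_eq (c : F) (β : MulAut F) :
    MulAut.conj c * β * (MulAut.conj c)⁻¹ = MulAut.conj (c * (β c)⁻¹) * β := by
  rw [← map_inv, mul_assoc, aut_conj, ← mul_assoc, ← map_mul, map_inv]

lemma Fam.tw {α : κ → MulAut F} (h : Fam α) (c : κ → F) :
    Fam (fun k => MulAut.conj (c k) * α k * (MulAut.conj (c k))⁻¹) := by
  refine ⟨fun k l => ?_, fun k l g hg => ?_⟩
  · obtain ⟨x, hx⟩ := h.1 k l
    simp only [tw_eq]
    refine ⟨c k * (α k (c k))⁻¹ * x * (c l * (α l (c l))⁻¹)⁻¹, ?_⟩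
    rw [← mul_assoc, ← map_mul, inv_mul_cancel_right, map_mul _ _ x, mul_assoc, ← hx]
  · refine h.2 k l ((c k)⁻¹ * g * c l) ?_
    simp only [map_mul, map_inv] at hg ⊢
    calc α k = (MulAut.conj (c k))⁻¹ * (MulAut.conj (c k) * α k * (MulAut.conj (c k))⁻¹) * MulAut.conj (c k) := by group
      _ = _ := by rw [hg]; group

lemma Fam.aut {α : κ → MulAut F} (h : Fam α) (e : MulAut F) : Fam (fun k => e * α k * e⁻¹) := by
  refine ⟨fun k l => ?_, fun k l g hg => ?_⟩
  · obtain ⟨x, hx⟩ := h.1 k l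
    refine ⟨e x, ?_⟩
    simp only [hx]
    rw [← mul_assoc, aut_conj]; group
  · refine h.2 k l (e⁻¹ g) ?_
    have h1 : MulAut.conj (e⁻¹ g) = e⁻¹ * MulAut.conj g * e := by rw [aut_conj]; group
    rw [h1]
    simp only at hg
    calc α k = e⁻¹ * (e * α k * e⁻¹) * e := by group
      _ = _ := by rw [hg]; group

lemma Fam.chg {α : κ → MulAut F} (h : Fam α) (e : MulAut F) (c : κ → F) :
    Fam (fun k => MulAut.conj (c k) * (e * α k * e⁻¹) * (MulAut.conj (c k))⁻¹) := (h.aut e).tw c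

lemma FixA_chg (e φ : MulAut F) (c : F) : FixA (MulAut.conj c * (e * φ * e⁻¹) * (MulAut.conj c)⁻¹) =
    cj c ((FixA φ).map e.toMonoidHom) := by
  rw [FixA_cj, FixA_map]

lemma NC.aut {α : κ → MulAut F} (h : NC α) (e : MulAut F) : NC (fun k => e * α k * e⁻¹) := by
  intro k
  obtain ⟨a, ha, b, hb, hab⟩ := h k
  simp only [FixA_map]
  refine ⟨_, ⟨a, ha, rfl⟩, _, ⟨b, hb, rfl⟩, ?_⟩
  intro h
  apply hab
  apply e.injective
  simpa using h

lemma NC.tw {α : κ → MulAut F} (h : NC α) (c : κ → F) :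
    NC (fun k => MulAut.conj (c k) * α k * (MulAut.conj (c k))⁻¹) :=
  fun k => NC.aut (κ := Unit) (α := fun _ => α k) (fun _ => h k) (MulAut.conj (c k)) ()

lemma NC.chg {α : κ → MulAut F} (h : NC α) (e : MulAut F) (c : κ → F) :
    NC (fun k => MulAut.conj (c k) * (e * α k * e⁻¹) * (MulAut.conj (c k))⁻¹) := (h.aut e).tw c

lemma NC.ne_bot {α : κ → MulAut F} (h : NC α) (k : κ) : ∃ p ∈ FixA (α k), p ≠ 1 := by
  obtain ⟨a, ha, b, hb, hab⟩ := h k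
  exact ⟨a, ha, fun h => hab (by simp [h])⟩

lemma NC.ne_bot' {α : κ → MulAut F} (h : NC α) (k : κ) : FixA (α k) ≠ ⊥ := by
  obtain ⟨p, hp, h1⟩ := h.ne_bot k
  intro h; rw [h, Subgroup.mem_bot] at hp; exact h1 hp

lemma map_cj_symm (e : MulAut F) (c : F) (P : Subgroup F) :
    P = cj ((e⁻¹ c)⁻¹) ((cj c (P.map e.toMonoidHom)).map (e⁻¹).toMonoidHom) := by
  rw [map_cj, cj_cj, Subgroup.map_map]
  ext x
  simp [mem_cj]

lemma NiceSys.chg [Fintype κ] {P : κ → Subgroup F} (e : MulAut F) (c : κ → F)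
    (h : NiceSys F (fun k => cj (c k) ((P k).map e.toMonoidHom))) : NiceSys F P :=
  h.transport e⁻¹ (Equiv.refl κ) (fun k => (e⁻¹ (c k))⁻¹) (fun k => map_cj_symm e (c k) (P k))

lemma NiceSys.chgF [Fintype κ] {α : κ → MulAut F} (e : MulAut F) (c : κ → F)
    (h : NiceSys F (fun k => FixA (MulAut.conj (c k) * (e * α k * e⁻¹) * (MulAut.conj (c k))⁻¹))) :
    NiceSys F (fun k => FixA (α k)) := by
  refine NiceSys.chg e c ?_
  simpa only [FixA_chg] using h

/-- restriction of an automorphism to an invariant subgroup -/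
noncomputable def resA (φ : MulAut F) (A : Subgroup F) (h : ∀ g, φ g ∈ A ↔ g ∈ A) : MulAut A :=
  MulEquiv.ofBijective ((φ.toMonoidHom.comp A.subtype).codRestrict A (fun x => (h x.1).2 x.2)) (by
    constructor
    · intro x y hxy
      have := congrArg Subtype.val hxy
      exact Subtype.ext (φ.injective this)
    · intro y
      refine ⟨⟨φ⁻¹ y.1, ?_⟩, ?_⟩
      · rw [← h]; simp
      · apply Subtype.ext
        show φ (φ⁻¹ y.1) = y.1
        simp)

lemma resA_apply (φ : MulAut F) (A : Subgroup F) (h : ∀ g, φ g ∈ A ↔ g ∈ A) (x : A) :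
    ((resA φ A h x : A) : F) = φ x.1 := rfl

lemma Tcall_b [Fintype κ] [Nonempty κ] {m : ℕ} (hT : TT m) (A : Subgroup F) (hA : Rk m A) (φ : MulAut F)
    (h : ∀ g, φ g ∈ A ↔ g ∈ A) (b : κ → F) (hb : ∀ k, b k ∈ A)
    (hn : ∀ k l, ∀ g ∈ A, b k = g * b l * (φ g)⁻¹ → k = l) :
    NiceSys A (fun k => (FixA (MulAut.conj (b k) * φ)).subgroupOf A) := by
  have := hT A hA (resA φ A h) κ (fun k => ⟨b k, hb k⟩) (by
    intro k l g hg
    refine hn k l g.1 g.2 ?_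
    have := congrArg Subtype.val hg
    simpa [resA_apply] using this)
  convert this using 2 with k
  ext x
  rw [Subgroup.mem_subgroupOf, mem_FixA, mem_FixA, Subtype.ext_iff]
  simp [resA_apply]

lemma inv_conj {φ : MulAut F} {A : Subgroup F} (h : ∀ g, φ g ∈ A ↔ g ∈ A) {x : F} (hx : x ∈ A) (g : F) :
    (MulAut.conj x * φ) g ∈ A ↔ g ∈ A := by
  rw [← h g]
  simp only [MulAut.mul_apply, MulAut.conj_apply]
  rw [Subgroup.mul_mem_cancel_right _ (inv_mem hx), Subgroup.mul_mem_cancel_left _ hx]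

lemma Tcall [Fintype κ] {m : ℕ} (hT : TT m) (A : Subgroup F) (hA : Rk m A) {α : κ → MulAut F}
    (hα : Fam α) (k0 : κ) (h : ∀ g, α k0 g ∈ A ↔ g ∈ A) (hx : ∀ k, ∃ x ∈ A, α k = MulAut.conj x * α k0) :
    NiceSys A (fun k => (FixA (α k)).subgroupOf A) := by
  choose x hxA hx using hx
  haveI : Nonempty κ := ⟨k0⟩
  have := Tcall_b hT A hA (α k0) h x hxA (by
    intro k l g hg hk
    refine hα.2 k l g ?_
    rw [hx k, hk, hx l]
    have e1 : MulAut.conj g * (MulAut.conj (x l) * α k0) * (MulAut.conj g)⁻¹ =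
      MulAut.conj g * MulAut.conj (x l) * (α k0 * MulAut.conj g⁻¹) := by rw [map_inv]; group
    rw [e1, aut_conj (α k0), map_mul, map_mul, map_inv, map_inv, map_inv]; group)
  convert this using 2 with k
  rw [hx k]
end
end MV


namespace MV
open FreeGroup (of)

section
variable {ι : Type} [DecidableEq ι]

/-- inclusion of a factor -/
def incl (Y : Set ι) : FreeGroup Y →* FreeGroup ι := FreeGroup.lift (fun i => of i.1)

lemma incl_of (Y : Set ι) (i : Y) : incl Y (of i) = of i.1 := by simp [incl]

lemma incl_inj (Y : Set ι) : Function.Injective (incl Y) := by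
  classical
  let r : FreeGroup ι →* FreeGroup Y := FreeGroup.lift (fun i => if h : i ∈ Y then of ⟨i, h⟩ else 1)
  have : r.comp (incl Y) = MonoidHom.id _ := by
    ext i; simp [r, incl_of]
  intro a b hab
  have h1 := DFunLike.congr_fun this a
  have h2 := DFunLike.congr_fun this b
  simp only [MonoidHom.comp_apply, MonoidHom.id_apply] at h1 h2
  rw [← h1, ← h2, hab]

lemma incl_range (Y : Set ι) : (incl Y).range = Fac Y := by
  unfold incl
  rw [FreeGroup.range_lift_eq_closure, Fac]
  congr 1
  ext x; simp

noncomputable def inclE (Y : Set ι) : FreeGroup Y ≃* Fac Y :=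
  (MonoidHom.ofInjective (incl_inj Y)).trans (MulEquiv.subgroupCongr (incl_range Y))

lemma inclE_apply (Y : Set ι) (x : FreeGroup Y) : (inclE Y x : FreeGroup ι) = incl Y x := rfl

lemma Fac_Rk [Fintype ι] (Y : Set ι) : Rk Y.ncard (Fac Y) := by
  classical
  have : Rk (Fintype.card Y) (FreeGroup Y) := Rk.free
  have := this.iso (inclE Y)
  rwa [← Nat.card_eq_fintype_card, Nat.card_coe_set_eq] at this

lemma Fac_mono {Y Z : Set ι} (h : Y ⊆ Z) : Fac Y ≤ Fac Z := Subgroup.closure_mono (Set.image_mono h)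

lemma Fac_univ : Fac (Set.univ : Set ι) = ⊤ := by
  rw [Fac, Set.image_univ, FreeGroup.closure_range_of]

lemma Fac_sup (Y Z : Set ι) : Fac Y ⊔ Fac Z = Fac (Y ∪ Z) := by
  rw [Fac, Fac, Fac, Set.image_union, Subgroup.closure_union]

lemma Fam.comp {F κ κ' : Type} [Group F] {α : κ → MulAut F} (h : Fam α) {σ : κ' → κ} (hσ : Function.Injective σ) :
    Fam (fun k => α (σ k)) :=
  ⟨fun k l => h.1 _ _, fun k l g hg => hσ (h.2 _ _ g hg)⟩

lemma mem_of_fix {α β : MulAut (FreeGroup ι)} {x : FreeGroup ι} (h : β = MulAut.conj x * α) {Y : Set ι}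
    (hα : ∀ g, α g ∈ Fac Y ↔ g ∈ Fac Y) {p : FreeGroup ι} (hp : p ∈ FixA β) (hpY : p ∈ Fac Y) (h1 : p ≠ 1) :
    x ∈ Fac Y := by
  rw [mem_FixA, h] at hp
  refine Fac_malnormal ((hα p).2 hpY) (by simpa using h1) ?_
  have : x * α p * x⁻¹ = p := by simpa using hp
  rwa [this]

lemma NiceSys.tw {F κ : Type} [Group F] [Fintype κ] {α : κ → MulAut F} (c : κ → F)
    (h : NiceSys F (fun k => FixA (MulAut.conj (c k) * α k * (MulAut.conj (c k))⁻¹))) :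
    NiceSys F (fun k => FixA (α k)) := by
  refine NiceSys.chgF 1 c ?_
  simpa using h

variable [Fintype ι]

lemma stepII0 {κ : Type} [Fintype κ] (hT : ∀ m < Fintype.card ι, TT m) {X : Set ι} (hX : X.Nonempty)
    (hX' : Xᶜ.Nonempty) {α : κ → MulAut (FreeGroup ι)} (hα : Fam α) (hn : NC α) (k0 : κ)
    (h1 : ∀ g, α k0 g ∈ Fac X ↔ g ∈ Fac X) (h2 : ∀ g, α k0 g ∈ Fac Xᶜ ↔ g ∈ Fac Xᶜ)
    (h : ∀ k, k ≠ k0 → FixA (α k) ≤ Fac X ∨ FixA (α k) ≤ Fac Xᶜ) :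
    NiceSys (FreeGroup ι) (fun k => FixA (α k)) := by
  classical
  have hsum : X.ncard + Xᶜ.ncard = Fintype.card ι := by
    rw [Set.ncard_add_ncard_compl, Nat.card_eq_fintype_card]
  have hp1 : 0 < X.ncard := (Set.ncard_pos (Set.toFinite _)).2 hX
  have hp2 : 0 < Xᶜ.ncard := (Set.ncard_pos (Set.toFinite _)).2 hX'
  let p : κ → Prop := fun k => FixA (α k) ≤ Fac X
  let κ1 := {k : κ // k = k0 ∨ p k}
  let κ2 := {k : κ // k = k0 ∨ ¬ p k}
  have key : ∀ (Y : Set ι) (q : κ → Prop) [DecidablePred q] (hq : ∀ k, q k → k ≠ k0 → FixA (α k) ≤ Fac Y) (hq0 : q k0)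
      (hY : ∀ g, α k0 g ∈ Fac Y ↔ g ∈ Fac Y) (hc : Y.ncard < Fintype.card ι),
      NiceSys (Fac Y) (fun k : {k // q k} => (FixA (α k.1)).subgroupOf (Fac Y)) := by
    intro Y q _ hq hq0 hY hc
    refine Tcall (hT _ hc) (Fac Y) (Fac_Rk Y) (hα.comp Subtype.val_injective) ⟨k0, hq0⟩ hY ?_
    rintro ⟨k, hk⟩
    by_cases hkk : k = k0
    · subst hkk; exact ⟨1, one_mem _, by simp⟩
    · obtain ⟨x, hx⟩ := hα.1 k k0
      obtain ⟨a, ha, ha1⟩ := hn.ne_bot k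
      exact ⟨x, mem_of_fix hx hY ha (hq k hk hkk ha) ha1, hx⟩
  have N1 := key X (fun k => k = k0 ∨ p k) (fun k hk hkk => hk.resolve_left hkk) (Or.inl rfl) h1 (by omega)
  have N2 := key Xᶜ (fun k => k = k0 ∨ ¬ p k) (fun k hk hkk => (h k hkk).resolve_left (hk.resolve_left hkk))
    (Or.inl rfl) h2 (by omega)
  refine NiceSys.R3 (E := Empty) N1 N2 (Fac_Rk X) (Fac_Rk Xᶜ) (by rw [hsum]; exact Rk.free)
    (Fac X).subtype (Fac Xᶜ).subtype ?_ Subtype.val Subtype.val ?_ ⟨k0, Or.inl rfl⟩ ⟨k0, Or.inl rfl⟩ (Or.inl rfl)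
    ?_ ?_ ?_ ?_
  · rw [Subgroup.range_subtype, Subgroup.range_subtype, Fac_sup, Set.union_compl_self, Fac_univ]
  · intro k
    by_cases hk : p k
    · exact Or.inl ⟨⟨k, Or.inr hk⟩, rfl⟩
    · exact Or.inr ⟨⟨k, Or.inr hk⟩, rfl⟩
  · rw [Fintype.card_subtype, Fintype.card_subtype, ← Finset.card_union_add_card_inter]
    have e1 : (Finset.univ.filter fun k => k = k0 ∨ p k) ∪ (Finset.univ.filter fun k => k = k0 ∨ ¬ p k) =
      Finset.univ := by
      ext k; simp; tauto
    have e2 : (Finset.univ.filter fun k => k = k0 ∨ p k) ∩ (Finset.univ.filter fun k => k = k0 ∨ ¬ p k) =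
      {k0} := by
      ext k; simp; tauto
    rw [e1, e2]; simp
  · intro j
    rw [Subgroup.subgroupOf_map_subtype]; exact inf_le_left
  · intro j
    rw [Subgroup.subgroupOf_map_subtype]; exact inf_le_left
  · intro k
    by_cases hk : k = k0
    · subst hk
      rw [fixII (X := X) (α k) (fun g hg => (h2 g).2 hg) (fun g hg => (h1 g).2 hg)]
      refine sup_le_sup ?_ ?_
      · refine le_trans ?_ (le_iSup₂_of_le (⟨k, Or.inl rfl⟩ : {k' : κ // k' = k ∨ p k'}) rfl le_rfl)
        rw [Subgroup.subgroupOf_map_subtype]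
      · refine le_trans ?_ (le_iSup₂_of_le (⟨k, Or.inl rfl⟩ : {k' : κ // k' = k ∨ ¬ p k'}) rfl le_rfl)
        rw [Subgroup.subgroupOf_map_subtype]
    · by_cases hp : p k
      · refine le_trans ?_ le_sup_left
        refine le_trans ?_ (le_iSup₂_of_le (⟨k, Or.inr hp⟩ : {k' : κ // k' = k0 ∨ p k'}) rfl le_rfl)
        rw [Subgroup.subgroupOf_map_subtype]
        exact le_inf le_rfl hp
      · refine le_trans ?_ le_sup_right
        refine le_trans ?_ (le_iSup₂_of_le (⟨k, Or.inr hp⟩ : {k' : κ // k' = k0 ∨ ¬ p k'}) rfl le_rfl)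
        rw [Subgroup.subgroupOf_map_subtype]
        exact le_inf le_rfl ((h k hk).resolve_left hp)

/-- step II -/
lemma stepII {κ : Type} [Fintype κ] (hT : ∀ m < Fintype.card ι, TT m) {X : Set ι} (hX : X.Nonempty)
    (hX' : Xᶜ.Nonempty) {α : κ → MulAut (FreeGroup ι)} (hα : Fam α) (hn : NC α) (k0 : κ)
    (h1 : ∀ g, α k0 g ∈ Fac X ↔ g ∈ Fac X) (h2 : ∀ g, α k0 g ∈ Fac Xᶜ ↔ g ∈ Fac Xᶜ)
    (h : ∀ k, k ≠ k0 → ∃ g, cj g (FixA (α k)) ≤ Fac X ∨ cj g (FixA (α k)) ≤ Fac Xᶜ) :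
    NiceSys (FreeGroup ι) (fun k => FixA (α k)) := by
  classical
  have : ∀ k, ∃ g, (k = k0 → g = 1) ∧ (k ≠ k0 → cj g (FixA (α k)) ≤ Fac X ∨ cj g (FixA (α k)) ≤ Fac Xᶜ) := by
    intro k
    by_cases hk : k = k0
    · exact ⟨1, fun _ => rfl, fun h => absurd hk h⟩
    · obtain ⟨g, hg⟩ := h k hk
      exact ⟨g, fun h => absurd h hk, fun _ => hg⟩
  choose c hc0 hc using this
  refine NiceSys.tw c (stepII0 hT hX hX' (hα.tw c) (hn.tw c) k0 ?_ ?_ ?_)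
  · simpa [hc0 k0 rfl] using h1
  · simpa [hc0 k0 rfl] using h2
  · intro k hk
    rw [FixA_cj]; exact hc k hk
end
end MV


namespace MV
open FreeGroup (of)

section
variable {ι : Type} [DecidableEq ι]

lemma NiceSys.aut {F κ : Type} [Group F] [Fintype κ] {α : κ → MulAut F} (e : MulAut F)
    (h : NiceSys F (fun k => FixA (e * α k * e⁻¹))) :
    NiceSys F (fun k => FixA (α k)) := by
  refine NiceSys.chgF e (fun _ => 1) ?_
  simpa using h

lemma iff_of_fix {F : Type} [Group F] {A : Subgroup F} {e : MulAut F} (h : ∀ a ∈ A, e a = a) (g : F) :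
    e g ∈ A ↔ g ∈ A := by
  constructor
  · intro hg
    have := h _ hg
    rwa [e.injective this] at hg
  · intro hg; rwa [h g hg]

lemma fac_ext {Y : Set ι} {G : Type} [Group G] {f g : FreeGroup ι →* G} (h : ∀ i ∈ Y, f (of i) = g (of i)) :
    ∀ a ∈ Fac Y, f a = g a := by
  intro a ha
  induction ha using Subgroup.closure_induction with
  | mem x hx => obtain ⟨i, hi, rfl⟩ := hx; exact h i hi
  | one => simp
  | mul x y _ _ hx hy => rw [map_mul, map_mul, hx, hy]
  | inv x _ hx => rw [map_inv, map_inv, hx]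

lemma transv (i : ι) {g : FreeGroup ι} (hg : g ∈ Fac ({i}ᶜ : Set ι)) :
    ∃ e : MulAut (FreeGroup ι), e (of i) = of i * g ∧ ∀ a ∈ Fac ({i}ᶜ : Set ι), e a = a := by
  let f : FreeGroup ι → (FreeGroup ι →* FreeGroup ι) := fun g =>
    FreeGroup.lift (fun j => if j = i then of i * g else of j)
  have hfi : ∀ g, f g (of i) = of i * g := fun g => by simp [f]
  have hfA : ∀ g, ∀ a ∈ Fac ({i}ᶜ : Set ι), f g a = a := fun g => by
    refine fac_ext (g := MonoidHom.id _) ?_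
    intro j hj
    have : j ≠ i := hj
    simp [f, this]
  have hinv : ∀ g ∈ Fac ({i}ᶜ : Set ι), (f g⁻¹).comp (f g) = MonoidHom.id _ := by
    intro g hg
    ext j
    by_cases hj : j = i
    · subst hj
      simp only [MonoidHom.comp_apply, hfi, map_mul, hfA _ g hg, MonoidHom.id_apply]; simp
    · have hj' : of j ∈ Fac ({i}ᶜ : Set ι) := of_mem_Fac hj
      simp only [MonoidHom.comp_apply, hfA _ _ hj', MonoidHom.id_apply]
  refine ⟨MonoidHom.toMulEquiv (f g) (f g⁻¹) (hinv g hg) (by simpa using hinv g⁻¹ (inv_mem hg)), hfi g, hfA g⟩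

variable [Fintype ι]

lemma stepI0 {κ : Type} [Fintype κ] (hT : ∀ m < Fintype.card ι, TT m) {i : ι} (hi : ∃ j, j ≠ i)
    {α : κ → MulAut (FreeGroup ι)} (hα : Fam α) (hn : NC α) (k0 : κ)
    (hW : ∀ g, α k0 g ∈ N [(i, true)] ↔ g ∈ N [(i, true)])
    (hA : ∀ g, α k0 g ∈ Fac ({i}ᶜ : Set ι) ↔ g ∈ Fac ({i}ᶜ : Set ι))
    (hb : (of i)⁻¹ * α k0 (of i) ∈ Fac ({i}ᶜ : Set ι))
    (h : ∀ k, k ≠ k0 → FixA (α k) ≤ Fac ({i}ᶜ : Set ι)) :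
    NiceSys (FreeGroup ι) (fun k => FixA (α k)) := by
  classical
  set b := (of i)⁻¹ * α k0 (of i) with hbdef
  have hbi : α k0 (of i) = of i * b := by simp [hbdef]
  by_cases hg : ∃ g ∈ Fac ({i}ᶜ : Set ι), b = g * (α k0 g)⁻¹
  · obtain ⟨g, hg, hbg⟩ := hg
    obtain ⟨e, he1, he2⟩ := transv i hg
    have heA := iff_of_fix he2
    refine NiceSys.aut e⁻¹ ?_
    refine stepII hT (X := {i}) (Set.singleton_nonempty i) (by obtain ⟨j, hj⟩ := hi; exact ⟨j, hj⟩)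
      (hα.aut e⁻¹) (hn.aut e⁻¹) k0 ?_ ?_ ?_
    · apply iff_of_fix
      refine fac_ext (f := (e⁻¹ * α k0 * e⁻¹⁻¹).toMonoidHom) (g := MonoidHom.id _) ?_
      intro j hj
      have hj : j = i := hj
      subst hj
      show e⁻¹ (α k0 (e⁻¹⁻¹ (of j))) = of j
      rw [inv_inv, he1, map_mul, hbi, hbg]
      have : of j * (g * (α k0 g)⁻¹) * α k0 g = of j * g := by group
      rw [this, ← he1]; simp
    · intro g
      rw [← heA]
      simp [hA, heA]
    · intro k hk
      refine ⟨1, Or.inr ?_⟩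
      rw [cj_one, FixA_map]
      rintro _ ⟨x, hx, rfl⟩
      rw [← heA]
      simpa using h k hk hx
  · push Not at hg
    have hx : ∀ k, ∃ x ∈ Fac ({i}ᶜ : Set ι), α k = MulAut.conj x * α k0 ∧ (k = k0 → x = 1) := by
      intro k
      by_cases hkk : k = k0
      · subst hkk; exact ⟨1, one_mem _, by simp⟩
      · obtain ⟨x, hx⟩ := hα.1 k k0
        obtain ⟨a, ha, ha1⟩ := hn.ne_bot k
        exact ⟨x, mem_of_fix hx hA ha (h k hkk ha) ha1, hx, fun h => absurd h hkk⟩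
    choose x hxA hx hx0 using hx
    let b' : Option κ → FreeGroup ι := fun o => o.elim b x
    have hcard : ({i}ᶜ : Set ι).ncard + 1 = Fintype.card ι := by
      have := Set.ncard_add_ncard_compl ({i} : Set ι)
      rw [Set.ncard_singleton, Nat.card_eq_fintype_card] at this
      omega
    have iso : ∀ g u v, u = g * v * (α k0 g)⁻¹ →
        MulAut.conj u * α k0 = MulAut.conj g * (MulAut.conj v * α k0) * (MulAut.conj g)⁻¹ := by
      rintro g u v rfl
      have e1 : MulAut.conj g * (MulAut.conj v * α k0) * (MulAut.conj g)⁻¹ =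
        MulAut.conj g * MulAut.conj v * (α k0 * MulAut.conj g⁻¹) := by rw [map_inv]; group
      rw [e1, aut_conj (α k0), map_mul, map_mul, map_inv, map_inv, map_inv]; group
    have hbn : ∀ k, ∀ g ∈ Fac ({i}ᶜ : Set ι), x k ≠ g * b * (α k0 g)⁻¹ := by
      intro k g hgA hk
      by_cases hkk : k = k0
      · rw [hx0 k hkk] at hk
        refine hg g⁻¹ (inv_mem hgA) ?_
        rw [map_inv, inv_inv]
        have : b = g⁻¹ * (g * b * (α k0 g)⁻¹) * α k0 g := by group
        rw [this, ← hk, mul_one]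
      · apply hkk
        refine hα.2 k k0 (g * (of i)⁻¹) ?_
        rw [hx k, iso (g * (of i)⁻¹) (x k) 1 ?_]
        · simp
        · rw [hk, hbdef, map_mul, map_inv]; group
    have hNS := Tcall_b (hT _ (by omega)) (Fac ({i}ᶜ : Set ι)) (Fac_Rk _) (α k0) hA b'
      (by rintro (_ | k); exacts [hb, hxA k]) (by
        rintro (_ | k) (_ | l) g hgA hk
        · rfl
        · exfalso
          have hk : b = g * x l * (α k0 g)⁻¹ := hk
          refine hbn l g⁻¹ (inv_mem hgA) ?_
          rw [hk, map_inv]; group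
        · exact absurd hk (hbn k g hgA)
        · have hk : x k = g * x l * (α k0 g)⁻¹ := hk
          rw [hα.2 k l g]
          rw [hx k, hx l]; exact iso g _ _ hk)
    refine NiceSys.R4 hNS (Fac_Rk _) (by rw [hcard]; exact Rk.free) (Fac ({i}ᶜ : Set ι)).subtype (of i) ?_ k0 ?_ ?_
    · rw [Subgroup.range_subtype]
      have : Subgroup.zpowers (of i) = Fac {i} := by
        rw [Fac, Set.image_singleton, Subgroup.zpowers_eq_closure]
      rw [this, Fac_sup, Set.compl_union_self, Fac_univ]
    · simp only [Subgroup.subgroupOf_map_subtype]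
      have e0 : MulAut.conj (b' (some k0)) * α k0 = α k0 := (hx k0).symm
      rw [e0]
      exact fixI (α k0) hW (fun g hg => (hA g).2 hg) hb hbi hg
    · intro k hk
      rw [Subgroup.subgroupOf_map_subtype]
      have e0 : MulAut.conj (b' (some k)) * α k0 = α k := (hx k).symm
      rw [e0, inf_eq_left.2 (h k hk)]

lemma stepI {κ : Type} [Fintype κ] (hT : ∀ m < Fintype.card ι, TT m) {i : ι} (hi : ∃ j, j ≠ i)
    {α : κ → MulAut (FreeGroup ι)} (hα : Fam α) (hn : NC α) (k0 : κ)
    (hW : EqF (img (α k0) (N [(i, true)])) (N [(i, true)]))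
    (h : ∀ k, k ≠ k0 → NSep (N [(i, true)]) (FixA (α k))) :
    NiceSys (FreeGroup ι) (fun k => FixA (α k)) := by
  classical
  have : ∀ k, ∃ g, (k = k0 → g = 1) ∧ (k ≠ k0 → cj g (FixA (α k)) ≤ Fac ({i}ᶜ : Set ι)) := by
    intro k
    by_cases hk : k = k0
    · exact ⟨1, fun _ => rfl, fun h => absurd hk h⟩
    · obtain ⟨g, hg⟩ := ellI (h k hk) (hn.ne_bot' k)
      exact ⟨g, fun h => absurd h hk, fun _ => hg⟩
  choose c hc0 hc using this
  obtain ⟨s1, s2, s3⟩ := splitI hi (α k0) hW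
  refine NiceSys.tw c (stepI0 hT hi (hα.tw c) (hn.tw c) k0 ?_ ?_ ?_ ?_)
  · simpa [hc0 k0 rfl] using s1
  · simpa [hc0 k0 rfl] using s2
  · simpa [hc0 k0 rfl] using s3
  · intro k hk
    rw [FixA_cj]; exact hc k hk

lemma stepII_sep {κ : Type} [Fintype κ] (hT : ∀ m < Fintype.card ι, TT m) {X : Set ι} (hX : X.Nonempty)
    (hX' : Xᶜ.Nonempty) {α : κ → MulAut (FreeGroup ι)} (hα : Fam α) (hn : NC α) (k0 : κ)
    (hW : EqF (img (α k0) (UU (Lt X))) (UU (Lt X)))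
    (h : ∀ k, k ≠ k0 → NSep (UU (Lt X)) (FixA (α k))) :
    NiceSys (FreeGroup ι) (fun k => FixA (α k)) := by
  obtain ⟨s1, s2⟩ := splitII hX hX' (α k0) hW
  refine stepII hT hX hX' hα hn k0 s1 s2 ?_
  intro k hk
  exact ell (h k hk).swap (hn.ne_bot' k)
end
end MV


namespace MV
open FreeGroup (of)

section
variable {ι : Type} [DecidableEq ι]

lemma zpow_root_commute {G : Type} [Group G] [IsMulTorsionFree G] {a b : G} {k : ℤ} (hk : k ≠ 0)
    (h : Commute (a ^ k) b) : Commute a b := by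
  rcases Int.natAbs_eq k with e | e
  · rw [e, zpow_natCast] at h
    exact pow_root_commute (by omega) h
  · rw [e, zpow_neg, zpow_natCast] at h
    exact pow_root_commute (k := k.natAbs) (by omega) (by simpa using h.inv_left)

lemma centr {x a b : FreeGroup ι} (ha : x * a = a * x) (hb : x * b = b * x) (hab : a * b ≠ b * a) : x = 1 := by
  by_contra hx
  obtain ⟨t, ht⟩ := comm_cyclic (Subgroup.closure {x, a}) (by
    intro u hu v hv
    have : IsMulCommutative (Subgroup.closure {x, a}) := by
      apply Subgroup.isMulCommutative_closure
      rintro u hu v hv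
      simp only [Set.mem_insert_iff, Set.mem_singleton_iff] at hu hv
      rcases hu with rfl | rfl <;> rcases hv with rfl | rfl <;> simp [ha]
    have := this.is_comm.comm ⟨u, hu⟩ ⟨v, hv⟩
    exact congrArg Subtype.val this)
  have h1 : x ∈ Subgroup.zpowers t := by rw [← ht]; exact Subgroup.subset_closure (by simp)
  have h2 : a ∈ Subgroup.zpowers t := by rw [← ht]; exact Subgroup.subset_closure (by simp)
  obtain ⟨m, hm⟩ := Subgroup.mem_zpowers_iff.1 h1
  obtain ⟨l, hl⟩ := Subgroup.mem_zpowers_iff.1 h2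
  have hm0 : m ≠ 0 := by rintro rfl; exact hx (by rw [← hm]; simp)
  have : Commute (t ^ m) b := by rw [hm]; exact hb
  have := (zpow_root_commute hm0 this).zpow_left l
  rw [hl] at this
  exact hab this

/-- outer-equivalent automorphisms with the same non commutative fixed group agree -/
lemma aut_uniq {β γ : MulAut (FreeGroup ι)} {x : FreeGroup ι} (h : β = MulAut.conj x * γ)
    (hf : FixA β = FixA γ) (hn : ∃ a ∈ FixA β, ∃ b ∈ FixA β, a * b ≠ b * a) : β = γ := by
  obtain ⟨a, ha, b, hb, hab⟩ := hn
  have key : ∀ a ∈ FixA β, x * a = a * x := by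
    intro a ha
    have h1 : γ a = a := by rw [hf] at ha; exact ha
    have h2 : β a = a := ha
    rw [h] at h2
    simp only [MulAut.mul_apply, h1, MulAut.conj_apply] at h2
    exact mul_inv_eq_iff_eq_mul.1 h2
  rw [h, centr (key a ha) (key b hb) hab]; simp

lemma outer_tw {F κ : Type} [Group F] {α : κ → MulAut F} (h : Fam α) (k l : κ) (g g' : F) :
    ∃ x, MulAut.conj g * α k * (MulAut.conj g)⁻¹ = MulAut.conj x * (MulAut.conj g' * α l * (MulAut.conj g')⁻¹) := by
  obtain ⟨x, hx⟩ := h.1 k l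
  simp only [tw_eq]
  refine ⟨g * (α k g)⁻¹ * x * (g' * (α l g')⁻¹)⁻¹, ?_⟩
  rw [← mul_assoc, ← map_mul, inv_mul_cancel_right, map_mul _ _ x, mul_assoc, ← hx]

variable [Fintype ι]

lemma FixA_fg (φ : MulAut (FreeGroup ι)) : (FixA φ).FG := Fix_fg _

lemma fam_uniq {κ : Type} {α : κ → MulAut (FreeGroup ι)} (hα : Fam α) (hn : NC α) {k l : κ} {g g' : FreeGroup ι}
    (h : cj g (FixA (α k)) = cj g' (FixA (α l))) :
    MulAut.conj g * α k * (MulAut.conj g)⁻¹ = MulAut.conj g' * α l * (MulAut.conj g')⁻¹ := by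
  obtain ⟨x, hx⟩ := outer_tw hα k l g g'
  refine aut_uniq hx (by rw [FixA_cj, FixA_cj, h]) ?_
  exact (hn.tw (fun _ => g)) k

lemma indec_key {κ : Type} [Fintype κ] {α : κ → MulAut (FreeGroup ι)} (hα : Fam α) (hn : NC α)
    (hI : ∀ A : Set (FreeGroup ι), AInv A → Nontriv A → ∃ k, ¬ NSep A (FixA (α k)))
    {W : Set (FreeGroup ι)} (e : MulAut (FreeGroup ι))
    (hW : (cjSys (fun k => FixA (α k)) (fun k => FixA_fg _)).Min (img e W)) :
    ∃ (k0 : κ) (c : κ → FreeGroup ι),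
      EqF (img (MulAut.conj (c k0) * (e⁻¹ * α k0 * e⁻¹⁻¹) * (MulAut.conj (c k0))⁻¹) W) W ∧
      ∀ k, k ≠ k0 → NSep W (FixA (MulAut.conj (c k) * (e⁻¹ * α k * e⁻¹⁻¹) * (MulAut.conj (c k))⁻¹)) := by
  classical
  set P : κ → Subgroup (FreeGroup ι) := fun k => FixA (α k) with hP
  set S := cjSys P (fun k => FixA_fg _) with hS
  have hQ : ∀ Q : Cjs P, ∃ k g, Q.1 = cj g (P k) := fun Q => Q.2
  choose kk gg hkg using hQ
  let α' : Cjs P → MulAut (FreeGroup ι) := fun Q => MulAut.conj (gg Q) * α (kk Q) * (MulAut.conj (gg Q))⁻¹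
  have hfix : ∀ Q : Cjs P, FixA (α' Q) = Q.1 := fun Q => by rw [hkg Q]; exact FixA_cj _ _
  have huq : ∀ (Q : Cjs P) k g, Q.1 = cj g (P k) → α' Q = MulAut.conj g * α k * (MulAut.conj g)⁻¹ := by
    intro Q k g h
    exact fam_uniq hα hn (by rw [← h]; exact (hkg Q).symm)
  have hFS : HSys.FixSys S α' := by
    refine ⟨?_, ?_, ?_, ?_, ?_⟩
    · intro Q x
      rw [← mem_FixA, hfix]; rfl
    · intro Q Q' h
      apply Subtype.ext
      rw [← hfix Q, ← hfix Q', h]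
    · intro g Q
      rw [huq (g • Q) (kk Q) (g * gg Q) (by rw [Cjs_smul, hkg Q, cj_cj])]
      simp only [α', map_mul]; group
    · intro Q Q'
      exact outer_tw hα _ _ _ _
    · intro Q
      obtain ⟨a, ha, b, hb, hab⟩ := (hn.tw (fun _ => gg Q)) (kk Q)
      have hab' : FixA (MulAut.conj (gg Q) * α (kk Q) * (MulAut.conj (gg Q))⁻¹) = Q.1 := hfix Q
      simp only [hab'] at ha hb
      exact ⟨⟨a, ha⟩, ⟨b, hb⟩, fun h => hab (congrArg Subtype.val h)⟩
  obtain ⟨k0, hk0⟩ := hI _ hW.1 hW.2.1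
  unfold NSep at hk0
  push Not at hk0
  obtain ⟨g, hg⟩ := hk0
  let E : Cjs P := ⟨cj g (P k0), k0, g, rfl⟩
  obtain ⟨hK1, hK2⟩ := hFS.thmK hW (E := E) hg
  rw [huq E k0 g rfl] at hK2
  refine ⟨k0, fun k => if k = k0 then e⁻¹ g else 1, ?_, ?_⟩
  · have h1 := hK2.img e⁻¹
    rw [← img_mul, ← img_mul, ← img_mul, inv_mul_cancel, img_one] at h1
    convert h1 using 2
    beta_reduce
    rw [if_pos rfl]
    have : MulAut.conj (e⁻¹ g) = e⁻¹ * MulAut.conj g * e := by rw [aut_conj]; group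
    rw [this]; group
  · intro k hk
    simp only [if_neg hk, map_one, one_mul, inv_one, mul_one]
    rw [FixA_map]
    intro h hs
    have hs' : Sep (img e W) (cj (e h) (P k)) := by
      refine (sep_img e ?_).2 hs
      intro x
      rw [mem_cj, mem_cj, Subgroup.mem_map]
      constructor
      · intro hx
        exact ⟨_, hx, by simp⟩
      · rintro ⟨y, hy, hye⟩
        have : y = (e h)⁻¹ * x * e h := by
          apply (e⁻¹).injective
          have : e⁻¹ y = h⁻¹ * e.symm x * h := hye
          rw [this]; simp
        rw [← this]; exact hy
    have hmem : (⟨cj (e h) (P k), k, e h, rfl⟩ : Cjs P) ∈ S.sep (img e W) := hs'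
    rw [hK1] at hmem
    have heq : cj (e h) (P k) = cj g (P k0) := congrArg Subtype.val hmem
    have := fam_uniq hα hn heq
    apply hk
    refine hα.2 k k0 ((e h)⁻¹ * g) ?_
    calc α k = (MulAut.conj (e h))⁻¹ * (MulAut.conj (e h) * α k * (MulAut.conj (e h))⁻¹) * MulAut.conj (e h) := by
          group
      _ = _ := by rw [this, map_mul, map_inv]; group

lemma nonempty_of_nc {a b : FreeGroup ι} (h : a * b ≠ b * a) : Nonempty ι := by
  by_contra h0
  rw [not_nonempty_iff] at h0
  exact h (Subsingleton.elim _ _)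

lemma exists_ne_of_nc {a b : FreeGroup ι} (h : a * b ≠ b * a) (i : ι) : ∃ j, j ≠ i := by
  by_contra h0
  push Not at h0
  have : ∀ x : FreeGroup ι, x ∈ Subgroup.zpowers (of i) := by
    intro x
    have h1 : x ∈ Subgroup.closure (Set.range (of : ι → FreeGroup ι)) := by
      rw [FreeGroup.closure_range_of]; trivial
    refine (Subgroup.closure_le _).2 ?_ h1
    rintro _ ⟨j, rfl⟩
    rw [h0 j]; exact Subgroup.mem_zpowers _
  obtain ⟨m, rfl⟩ := Subgroup.mem_zpowers_iff.1 (this a)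
  obtain ⟨l, rfl⟩ := Subgroup.mem_zpowers_iff.1 (this b)
  exact h (zpow_mul_comm _ _ _)

theorem mainIndec {κ : Type} [Fintype κ] [Nonempty κ] (hT : ∀ m < Fintype.card ι, TT m)
    {α : κ → MulAut (FreeGroup ι)} (hα : Fam α) (hn : NC α)
    (hI : ∀ A : Set (FreeGroup ι), AInv A → Nontriv A → ∃ k, ¬ NSep A (FixA (α k))) :
    NiceSys (FreeGroup ι) (fun k => FixA (α k)) := by
  obtain ⟨a, -, b, -, hab⟩ := hn (Classical.arbitrary κ)
  haveI := nonempty_of_nc hab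
  obtain ⟨e, ⟨i, hi⟩ | ⟨X, hX, hX', hm⟩⟩ := lemmaN (cjSys (fun k => FixA (α k)) (fun k => FixA_fg _))
  · obtain ⟨k0, c, h1, h2⟩ := indec_key hα hn hI e hi
    exact NiceSys.chgF e⁻¹ c (stepI hT (exists_ne_of_nc hab i) (hα.chg e⁻¹ c) (hn.chg e⁻¹ c) k0 h1 h2)
  · obtain ⟨k0, c, h1, h2⟩ := indec_key hα hn hI e hm
    exact NiceSys.chgF e⁻¹ c (stepII_sep hT hX hX' (hα.chg e⁻¹ c) (hn.chg e⁻¹ c) k0 h1 h2)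
end
end MV


namespace MV
open FreeGroup (of)

section
variable {H F : Type} [Group H] [Group F]

lemma AInv.comap {V : Set F} (h : AInv V) {j : H →* F} (hj : Function.Injective j) : AInv (j ⁻¹' V) := by
  intro g
  filter_upwards [hj.tendsto_cofinite.eventually (h (j g))] with x hx
  simpa using hx

lemma freq_comap {q : F → Prop} {j : H →* F} (h : ∃ᶠ x in cofinite, q x ∧ x ∈ j.range) :
    ∃ᶠ y in cofinite, q (j y) := by
  rw [Filter.frequently_cofinite_iff_infinite] at h ⊢
  intro hf
  refine h ((hf.image j).subset ?_)
  rintro x ⟨hx, y, rfl⟩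
  exact ⟨y, hx, rfl⟩

lemma Sep.push {V : Set F} {j : H →* F} (hj : Function.Injective j) {Q : Subgroup H} (h : Sep (j ⁻¹' V) Q) :
    Sep V (Q.map j) := by
  constructor
  · refine hj.tendsto_cofinite.frequently (h.1.mono ?_)
    rintro x ⟨h1, h2⟩
    exact ⟨h1, x, h2, rfl⟩
  · refine hj.tendsto_cofinite.frequently (h.2.mono ?_)
    rintro x ⟨h1, h2⟩
    exact ⟨h1, x, h2, rfl⟩

lemma NSep.comap {V : Set F} {P : Subgroup F} (h : NSep V P) {j : H →* F} (hj : Function.Injective j)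
    (hP : P ≤ j.range) : NSep (j ⁻¹' V) (P.comap j) := by
  intro g hg
  have := hg.push hj
  rw [map_cj, Subgroup.map_comap_eq, inf_eq_right.2 hP] at this
  exact h _ this

lemma Sep.mono {V : Set F} {P Q : Subgroup F} (h : Sep V P) (hPQ : P ≤ Q) : Sep V Q :=
  ⟨h.1.mono fun x hx => ⟨hx.1, hPQ hx.2⟩, h.2.mono fun x hx => ⟨hx.1, hPQ hx.2⟩⟩

lemma NSep.mono {V : Set F} {P Q : Subgroup F} (h : NSep V Q) (hPQ : P ≤ Q) : NSep V P :=
  fun g hg => h g (hg.mono (cj_mono hPQ))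

lemma map_subgroupOf {P A B : Subgroup F} (hP : P ≤ A) (h : A ≤ B) :
    (P.subgroupOf A).map (Subgroup.inclusion h) = P.subgroupOf B := by
  ext x
  rw [Subgroup.mem_map, Subgroup.mem_subgroupOf]
  constructor
  · rintro ⟨y, hy, rfl⟩; exact hy
  · intro hx; exact ⟨⟨x.1, hP hx⟩, hx, rfl⟩
end

section
variable {ι : Type} [DecidableEq ι]

/-- extension of an automorphism of a factor by the identity on the complementary factor -/
lemma ext_aut (Y : Set ι) (e : MulAut (FreeGroup Y)) :
    ∃ E : MulAut (FreeGroup ι), ∀ x, E (incl Y x) = incl Y (e x) := by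
  classical
  let f : MulAut (FreeGroup Y) → (FreeGroup ι →* FreeGroup ι) := fun e =>
    FreeGroup.lift (fun i => if h : i ∈ Y then incl Y (e (of ⟨i, h⟩)) else of i)
  have hf : ∀ e x, f e (incl Y x) = incl Y (e x) := by
    intro e x
    have : (f e).comp (incl Y) = (incl Y).comp e.toMonoidHom := by
      ext i; simp [f, incl_of]
    exact DFunLike.congr_fun this x
  have hinv : ∀ e, (f e⁻¹).comp (f e) = MonoidHom.id _ := by
    intro e
    ext i
    by_cases h : i ∈ Y
    · have : of i = incl Y (of ⟨i, h⟩) := (incl_of Y ⟨i, h⟩).symm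
      simp only [MonoidHom.comp_apply, this, hf, MonoidHom.id_apply]; simp
    · simp [f, h]
  exact ⟨MonoidHom.toMulEquiv (f e) (f e⁻¹) (hinv e) (by simpa using hinv e⁻¹), hf e⟩

variable [Fintype ι]

lemma split_free {κ : Type} [Fintype κ] [Nonempty κ] (P : κ → Subgroup (FreeGroup ι)) (hfg : ∀ k, (P k).FG)
    (hn : ∀ k, ∃ a ∈ P k, ∃ b ∈ P k, a * b ≠ b * a) {V : Set (FreeGroup ι)} (hV : AInv V) (hV' : Nontriv V)
    (hs : ∀ k, NSep V (P k)) :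
    ∃ (e : MulAut (FreeGroup ι)) (X : Set ι), X.Nonempty ∧ Xᶜ.Nonempty ∧
      ∀ k, ∃ g, cj g ((P k).map e.toMonoidHom) ≤ Fac X ∨ cj g ((P k).map e.toMonoidHom) ≤ Fac Xᶜ := by
  obtain ⟨a, -, b, -, hab⟩ := hn (Classical.arbitrary κ)
  haveI := nonempty_of_nc hab
  have hne : ∀ (e : MulAut (FreeGroup ι)) k, (P k).map e.toMonoidHom ≠ ⊥ := by
    intro e k h
    obtain ⟨a, ha, b, hb, hab⟩ := hn k
    have : (P k) = ⊥ := (Subgroup.map_eq_bot_iff_of_injective _ e.injective).1 h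
    rw [this, Subgroup.mem_bot] at ha
    exact hab (by simp [ha])
  have key : ∀ W, (cjSys P hfg).Min W → ∀ k, NSep W (P k) := by
    intro W hW
    have h0 : (cjSys P hfg).c V = 0 := (cjSys_c_zero hV).2 fun k g => hs k g
    have h1 := hW.2.2 V hV hV'
    rw [h0, Nat.le_zero] at h1
    exact fun k g => (cjSys_c_zero hW.1).1 h1 k g
  have key2 : ∀ (e : MulAut (FreeGroup ι)) W, (cjSys P hfg).Min (img e W) → ∀ k, NSep W ((P k).map (e⁻¹).toMonoidHom) := by
    intro e W hW k
    have := (key _ hW k).map e⁻¹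
    rwa [← img_mul, inv_mul_cancel, img_one] at this
  obtain ⟨e, ⟨i, hi⟩ | ⟨X, hX, hX', hm⟩⟩ := lemmaN (cjSys P hfg)
  · refine ⟨e⁻¹, {i}, Set.singleton_nonempty i, ?_, fun k => ?_⟩
    · obtain ⟨j, hj⟩ := exists_ne_of_nc hab i; exact ⟨j, hj⟩
    · obtain ⟨g, hg⟩ := ellI (key2 e _ hi k) (hne _ k)
      exact ⟨g, Or.inr hg⟩
  · refine ⟨e⁻¹, X, hX, hX', fun k => ?_⟩
    exact ell (NSep.swap (key2 e _ hm k)) (hne _ k)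

/-- invariance of an indecomposable factor -/
lemma indec_inv {κ : Type} {P : κ → Subgroup (FreeGroup ι)} {Y : Set ι} (hP : ∀ k, P k ≤ Fac Y)
    (hI : ∀ V : Set (FreeGroup ι), AInv V → (∀ k, NSep V (P k)) → ¬ Sep V (Fac Y))
    (β : MulAut (FreeGroup ι)) (hβ : ∀ k, ∃ x, (P k).map β.toMonoidHom = cj x (P k))
    {p : FreeGroup ι} (hp : p ∈ Fac Y) (h1 : p ≠ 1) (hp' : β p ∈ Fac Y) : ∀ a ∈ Fac Y, β a ∈ Fac Y := by
  have hW : AInv (UU (Lt Yᶜ)) := UU_ainv _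
  have hN : NSep (UU (Lt Yᶜ)) ((Fac Y).map β.toMonoidHom) := by
    refine NSep.of_ltr hW fun k hs => ?_
    set W' := MV.ltr k (UU (Lt Yᶜ)) with hW'
    have hA : AInv W' := hW.ltr k
    refine hI (img β⁻¹ W') (hA.img _) ?_ ?_
    · intro l
      obtain ⟨x, hx⟩ := hβ l
      have h1 : NSep W' ((P l).map β.toMonoidHom) := by
        rw [hx]
        exact (((NSep_Fac (Lt_disj Y)).ltr_set hW k).mono (hP l)).cj x
      have := h1.map β⁻¹
      rw [Subgroup.map_map] at this
      convert this
      ext y; simp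
    · refine (sep_img β⁻¹ ?_).2 hs
      intro x
      rw [Subgroup.mem_map]
      constructor
      · intro h; exact ⟨x, h, rfl⟩
      · rintro ⟨y, hy, hyx⟩
        have : y = x := β.injective hyx
        rwa [← this]
  have := ell_le hN (p := β p) ⟨p, hp, rfl⟩ hp' (by simpa using h1)
  intro a ha
  exact this ⟨a, ha, rfl⟩

lemma rec_indec {κ : Type} [Fintype κ] [Nonempty κ] (hT : ∀ m < Fintype.card ι, TT m) {Y : Set ι}
    {α : κ → MulAut (FreeGroup ι)} (hα : Fam α) (hn : NC α) (hP : ∀ k, FixA (α k) ≤ Fac Y)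
    (hI : ∀ V : Set (FreeGroup ι), AInv V → (∀ k, NSep V (FixA (α k))) → ¬ Sep V (Fac Y)) :
    NiceSys (Fac Y) (fun k => (FixA (α k)).subgroupOf (Fac Y)) := by
  by_cases hY : Y = Set.univ
  · subst hY
    have := mainIndec hT hα hn (by
      intro A hA hA'
      by_contra hcon
      push Not at hcon
      refine hI A hA hcon ?_
      rw [Fac_univ]
      exact ⟨by simpa using hA'.1, by simpa using hA'.2⟩)
    refine this.transport ((Subgroup.topEquiv.symm).trans (MulEquiv.subgroupCongr Fac_univ.symm)) (Equiv.refl _)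
      (fun _ => 1) ?_
    intro k
    rw [cj_one]
    ext x
    rw [Subgroup.mem_subgroupOf, Subgroup.mem_map]
    constructor
    · intro hx; exact ⟨x.1, hx, rfl⟩
    · rintro ⟨y, hy, rfl⟩; exact hy
  · have hc : Y.ncard < Fintype.card ι := by
      have := Set.ncard_lt_ncard ((Set.ssubset_univ_iff).2 hY) (Set.toFinite _)
      rwa [Set.ncard_univ, Nat.card_eq_fintype_card] at this
    let k0 : κ := Classical.arbitrary κ
    obtain ⟨p, hp, hp1⟩ := hn.ne_bot k0
    have hfix : α k0 p = p := hp
    have hfix' : (α k0)⁻¹ p = p := by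
      rw [MulAut.inv_apply, MulEquiv.symm_apply_eq, hfix]
    have i1 := indec_inv hP hI (α k0) (by
      intro l
      obtain ⟨x, hx⟩ := hα.1 k0 l
      refine ⟨x, ?_⟩
      rw [hx]
      ext y
      rw [Subgroup.mem_map, mem_cj]
      constructor
      · rintro ⟨z, hz, rfl⟩
        have hz' : α l z = z := hz
        simpa [hz', mul_assoc] using hz
      · intro hy
        refine ⟨_, hy, ?_⟩
        have hz' : α l (x⁻¹ * y * x) = x⁻¹ * y * x := hy
        show x * α l (x⁻¹ * y * x) * x⁻¹ = y
        rw [hz']; group) (hP k0 hp) hp1 (by rw [hfix]; exact hP k0 hp)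
    have i2 := indec_inv hP hI (α k0)⁻¹ (by
      intro l
      obtain ⟨x, hx⟩ := hα.1 l k0
      refine ⟨(α k0)⁻¹ x, ?_⟩
      have key : ∀ z, α l z = z → (α k0)⁻¹ z = (α k0)⁻¹ x * z * ((α k0)⁻¹ x)⁻¹ := by
        intro z hz
        rw [hx] at hz
        have hz : x * α k0 z * x⁻¹ = z := hz
        apply (α k0).injective
        simp only [map_mul, map_inv]
        simp [hz]
      ext y
      rw [Subgroup.mem_map, mem_cj]
      constructor
      · rintro ⟨z, hz, rfl⟩
        have e1 : (α k0)⁻¹.toMonoidHom z = (α k0)⁻¹ x * z * ((α k0)⁻¹ x)⁻¹ := key z hz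
        rw [e1]
        simpa [mul_assoc] using hz
      · intro hy
        refine ⟨_, hy, ?_⟩
        have e1 := key _ hy
        refine Eq.trans e1 ?_
        group) (hP k0 hp) hp1 (by rw [hfix']; exact hP k0 hp)
    have hinv : ∀ g, α k0 g ∈ Fac Y ↔ g ∈ Fac Y := by
      intro g
      refine ⟨fun h => ?_, i1 g⟩
      simpa using i2 _ h
    refine Tcall (hT _ hc) (Fac Y) (Fac_Rk Y) hα k0 hinv ?_
    intro k
    obtain ⟨x, hx⟩ := hα.1 k k0
    obtain ⟨a, ha, ha1⟩ := hn.ne_bot k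
    exact ⟨x, mem_of_fix hx hinv ha (hP k ha) ha1, hx⟩

lemma rec_combine {κ : Type} [Fintype κ] [Nonempty κ] {X1 X2 : Set ι}
    (hd : Disjoint X1 X2) {α : κ → MulAut (FreeGroup ι)} (hα : Fam α) (hn : NC α)
    (ih1 : ∀ (κ' : Type) [Fintype κ'] [Nonempty κ'] (α : κ' → MulAut (FreeGroup ι)), Fam α → NC α →
      (∀ k, FixA (α k) ≤ Fac X1) → NiceSys (Fac X1) (fun k => (FixA (α k)).subgroupOf (Fac X1)))
    (ih2 : ∀ (κ' : Type) [Fintype κ'] [Nonempty κ'] (α : κ' → MulAut (FreeGroup ι)), Fam α → NC α →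
      (∀ k, FixA (α k) ≤ Fac X2) → NiceSys (Fac X2) (fun k => (FixA (α k)).subgroupOf (Fac X2)))
    (hP : ∀ k, FixA (α k) ≤ Fac X1 ∨ FixA (α k) ≤ Fac X2) :
    NiceSys (Fac (X1 ∪ X2)) (fun k => (FixA (α k)).subgroupOf (Fac (X1 ∪ X2))) := by
  classical
  have hl : Fac X1 ≤ Fac (X1 ∪ X2) := Fac_mono Set.subset_union_left
  have hr : Fac X2 ≤ Fac (X1 ∪ X2) := Fac_mono Set.subset_union_right
  have RF : Rk (X1.ncard + X2.ncard) (Fac (X1 ∪ X2)) := by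
    rw [← Set.ncard_union_eq hd (Set.toFinite _) (Set.toFinite _)]
    exact Fac_Rk _
  have hgen : (Subgroup.inclusion hl).range ⊔ (Subgroup.inclusion hr).range = ⊤ := by
    apply Subgroup.map_injective (Fac (X1 ∪ X2)).subtype_injective
    rw [Subgroup.map_sup, MonoidHom.map_range, MonoidHom.map_range, Subgroup.subtype_comp_inclusion,
      Subgroup.subtype_comp_inclusion, Subgroup.range_subtype, Subgroup.range_subtype, Fac_sup,
      ← MonoidHom.range_eq_map, Subgroup.range_subtype]
  let p : κ → Prop := fun k => FixA (α k) ≤ Fac X1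
  by_cases h1 : ∀ k, p k
  · refine NiceSys.R2' (ih1 κ α hα hn h1) (Fac_Rk X1) (Fac_Rk X2) RF (Subgroup.inclusion hl) (Subgroup.inclusion hr)
      hgen (Classical.arbitrary κ) ?_
    intro k
    rw [map_subgroupOf (h1 k) hl]
  by_cases h2 : ∀ k, ¬ p k
  · have h2' : ∀ k, FixA (α k) ≤ Fac X2 := fun k => (hP k).resolve_left (h2 k)
    refine NiceSys.R2' (ih2 κ α hα hn h2') (Fac_Rk X2) (Fac_Rk X1) (by rw [add_comm]; exact RF) (Subgroup.inclusion hr) (Subgroup.inclusion hl)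
      (by rw [sup_comm]; exact hgen) (Classical.arbitrary κ) ?_
    intro k
    rw [map_subgroupOf (h2' k) hr]
  push Not at h1 h2
  obtain ⟨b, hb⟩ := h1
  obtain ⟨a, ha⟩ := h2
  haveI : Nonempty {k // p k} := ⟨⟨a, ha⟩⟩
  haveI : Nonempty {k // ¬ p k} := ⟨⟨b, hb⟩⟩
  have h2' : ∀ k : {k // ¬ p k}, FixA (α k.1) ≤ Fac X2 := fun k => (hP k).resolve_left k.2
  have N1 := ih1 {k // p k} (fun k => α k.1) (hα.comp Subtype.val_injective) (fun k => hn k.1) (fun k => k.2)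
  have N2 := ih2 {k // ¬ p k} (fun k => α k.1) (hα.comp Subtype.val_injective) (fun k => hn k.1) h2'
  refine NiceSys.R3 (E := Unit) N1 N2 (Fac_Rk X1) (Fac_Rk X2) RF (Subgroup.inclusion hl) (Subgroup.inclusion hr)
    hgen Subtype.val Subtype.val ?_ ⟨a, ha⟩ ⟨b, hb⟩ (Or.inr ⟨()⟩) ?_ ?_ ?_ ?_
  · intro k
    by_cases hk : p k
    · exact Or.inl ⟨⟨k, hk⟩, rfl⟩
    · exact Or.inr ⟨⟨k, hk⟩, rfl⟩
  · rw [Fintype.card_subtype_compl, Fintype.card_unit]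
    have := Fintype.card_subtype_le p
    omega
  · intro k; rw [map_subgroupOf k.2 hl]
  · intro k; rw [map_subgroupOf (h2' k) hr]
  · intro k
    by_cases hk : p k
    · refine le_trans ?_ le_sup_left
      refine le_trans ?_ (le_iSup₂_of_le (⟨k, hk⟩ : {k' : κ // p k'}) rfl le_rfl)
      rw [map_subgroupOf hk hl]
    · refine le_trans ?_ le_sup_right
      refine le_trans ?_ (le_iSup₂_of_le (⟨k, hk⟩ : {k' : κ // ¬ p k'}) rfl le_rfl)
      rw [map_subgroupOf (h2' ⟨k, hk⟩) hr]

lemma map_incl_Fac (Y : Set ι) (X : Set Y) : (Fac X).map (incl Y) = Fac (Subtype.val '' X) := by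
  rw [Fac, MonoidHom.map_closure, Fac]
  congr 1
  ext x
  simp only [Set.mem_image]
  constructor
  · rintro ⟨_, ⟨i, hi, rfl⟩, rfl⟩
    exact ⟨i.1, ⟨i, hi, rfl⟩, (incl_of Y i).symm⟩
  · rintro ⟨_, ⟨i, hi, rfl⟩, rfl⟩
    exact ⟨_, ⟨i, hi, rfl⟩, incl_of Y i⟩

theorem recY (hT : ∀ m < Fintype.card ι, TT m) : ∀ (n : ℕ) (Y : Set ι), Y.ncard = n → 
    ∀ (κ : Type) [Fintype κ] [Nonempty κ] (α : κ → MulAut (FreeGroup ι)), Fam α → NC α →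
      (∀ k, FixA (α k) ≤ Fac Y) → NiceSys (Fac Y) (fun k => (FixA (α k)).subgroupOf (Fac Y)) := by
  classical
  intro n
  induction n using Nat.strong_induction_on with
  | _ n ih =>
  intro Y hYn κ _ _ α hα hn hP
  by_cases hI : ∀ V : Set (FreeGroup ι), AInv V → (∀ k, NSep V (FixA (α k))) → ¬ Sep V (Fac Y)
  · exact rec_indec hT hα hn hP hI
  push Not at hI
  obtain ⟨V, hV, hVs, hVY⟩ := hI
  have hjr : ∀ k, FixA (α k) ≤ (incl Y).range := fun k => by rw [incl_range]; exact hP k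
  have hmc : ∀ k, ((FixA (α k)).comap (incl Y)).map (incl Y) = FixA (α k) := fun k => by
    rw [Subgroup.map_comap_eq, inf_eq_right.2 (hjr k)]
  obtain ⟨e, X, hX, hX', hg⟩ := split_free (ι := Y) (fun k => (FixA (α k)).comap (incl Y))
    (by
      intro k
      have := FixA_fg (α k)
      rw [← hmc k] at this
      obtain ⟨T, hTT⟩ := this
      have : ∀ t ∈ T, ∃ s ∈ (FixA (α k)).comap (incl Y), incl Y s = t := by
        intro t ht
        have : t ∈ Subgroup.closure (T : Set (FreeGroup ι)) := Subgroup.subset_closure ht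
        rw [hTT] at this
        exact this
      choose! s hs hs' using this
      refine ⟨T.image s, ?_⟩
      apply Subgroup.map_injective (incl_inj Y)
      beta_reduce
      rw [← hTT, MonoidHom.map_closure]
      congr 1
      ext x
      simp only [Finset.coe_image, Set.mem_image, Finset.mem_coe]
      constructor
      · rintro ⟨_, ⟨t, ht, rfl⟩, rfl⟩; rwa [hs' t ht]
      · intro hx; exact ⟨_, ⟨x, hx, rfl⟩, hs' x hx⟩)
    (by
      intro k
      obtain ⟨a, ha, b, hb, hab⟩ := hn k
      obtain ⟨a', rfl⟩ := hjr k ha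
      obtain ⟨b', rfl⟩ := hjr k hb
      exact ⟨a', ha, b', hb, fun h => hab (by rw [← map_mul, h, map_mul])⟩)
    (V := (incl Y) ⁻¹' V) (hV.comap (incl_inj Y))
    ⟨freq_comap (j := incl Y) (q := fun x => x ∈ V) (by rw [incl_range]; exact hVY.1),
      freq_comap (j := incl Y) (q := fun x => x ∉ V) (by rw [incl_range]; exact hVY.2)⟩
    (fun k => (hVs k).comap (incl_inj Y) (hjr k))
  choose g hg using hg
  obtain ⟨E, hE⟩ := ext_aut Y e
  have hEY : ∀ x, E x ∈ Fac Y ↔ x ∈ Fac Y := by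
    have h1 : ∀ x ∈ Fac Y, E x ∈ Fac Y := by
      intro x hx
      rw [← incl_range] at hx ⊢
      obtain ⟨y, rfl⟩ := hx
      exact ⟨_, (hE y).symm⟩
    intro x
    refine ⟨fun hx => ?_, h1 x⟩
    rw [← incl_range] at hx ⊢
    obtain ⟨y, hy⟩ := hx
    refine ⟨e⁻¹ y, ?_⟩
    apply E.injective
    rw [hE, ← hy]; simp
  have hEm : ∀ k, (FixA (α k)).map E.toMonoidHom = (((FixA (α k)).comap (incl Y)).map e.toMonoidHom).map (incl Y) := by
    intro k
    conv_lhs => rw [← hmc k]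
    rw [Subgroup.map_map, Subgroup.map_map]
    congr 1
    ext x; exact hE (of x)
  let c : κ → FreeGroup ι := fun k => incl Y (g k)
  have hcY : ∀ k, c k ∈ Fac Y := fun k => by rw [← incl_range]; exact ⟨_, rfl⟩
  have hfin : ∀ k, cj (c k) ((FixA (α k)).map E.toMonoidHom) ≤ Fac (Subtype.val '' X) ∨
      cj (c k) ((FixA (α k)).map E.toMonoidHom) ≤ Fac (Subtype.val '' Xᶜ) := by
    intro k
    rw [hEm, ← map_cj, ← map_incl_Fac, ← map_incl_Fac]
    exact (hg k).imp (Subgroup.map_mono) (Subgroup.map_mono)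
  have hun : Subtype.val '' X ∪ Subtype.val '' Xᶜ = Y := by
    rw [← Set.image_union, Set.union_compl_self, Set.image_univ, Subtype.range_coe]
  have hdis : Disjoint (Subtype.val '' X) (Subtype.val '' Xᶜ) :=
    (Set.disjoint_image_iff Subtype.val_injective).2 disjoint_compl_right
  have hsum : (Subtype.val '' X).ncard + (Subtype.val '' Xᶜ).ncard = n := by
    rw [← Set.ncard_union_eq hdis (Set.toFinite _) (Set.toFinite _), hun, hYn]
  have hp1 : 0 < (Subtype.val '' X).ncard := (Set.ncard_pos (Set.toFinite _)).2 (hX.image _)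
  have hp2 : 0 < (Subtype.val '' Xᶜ).ncard := (Set.ncard_pos (Set.toFinite _)).2 (hX'.image _)
  have main := rec_combine hdis (hα.chg E c) (hn.chg E c) (ih _ (by omega) _ rfl) (ih _ (by omega) _ rfl)
    (by intro k; rw [FixA_chg]; exact hfin k)
  rw [hun] at main
  have hEY' : ∀ x, E⁻¹ x ∈ Fac Y ↔ x ∈ Fac Y := fun x => by rw [← hEY]; simp
  refine main.transport (resA E⁻¹ (Fac Y) hEY') (Equiv.refl _)
    (fun k => ⟨(E⁻¹ (c k))⁻¹, inv_mem ((hEY' _).2 (hcY k))⟩) ?_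
  intro k
  apply Subgroup.map_injective (Fac Y).subtype_injective
  rw [map_cj, Subgroup.subgroupOf_map_subtype, inf_eq_left.2 (hP k), Subgroup.map_map]
  have e1 : (Fac Y).subtype.comp (resA E⁻¹ (Fac Y) hEY').toMonoidHom = (E⁻¹).toMonoidHom.comp (Fac Y).subtype := rfl
  rw [e1, ← Subgroup.map_map, Subgroup.subgroupOf_map_subtype]
  simp only [Equiv.refl_apply, FixA_chg]
  rw [inf_eq_left.2]
  · exact map_cj_symm E (c k) (FixA (α k))
  · rw [← cj_of_mem (hcY k)]
    refine cj_mono ?_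
    rintro _ ⟨x, hx, rfl⟩
    exact (hEY x).2 (hP k hx)
end
end MV


namespace MV
open FreeGroup (of)

lemma conj_inj_of_nc {ι : Type} [DecidableEq ι] {a b : FreeGroup ι} (hab : a * b ≠ b * a) {u v : FreeGroup ι}
    (h : MulAut.conj u = MulAut.conj v) : u = v := by
  have key : ∀ c, (v⁻¹ * u) * c = c * (v⁻¹ * u) := by
    intro c
    have h1 : u * c * u⁻¹ = v * c * v⁻¹ := DFunLike.congr_fun h c
    calc (v⁻¹ * u) * c = v⁻¹ * (u * c * u⁻¹) * u := by group
      _ = _ := by rw [h1]; group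
  have := centr (key a) (key b) hab
  exact (inv_mul_eq_one.1 this).symm

lemma npp_gen {m : ℕ} {α : MulAut (FreeGroup (Fin m))} {t : FreeGroup (Fin m)} (ht : FixA α = Subgroup.zpowers t)
    (h1 : t ≠ 1) : NPP t := by
  rintro ⟨h, k, hk, rfl⟩
  have hfix : h ^ k ∈ FixA α := by rw [ht]; exact Subgroup.mem_zpowers _
  have hfix' : α (h ^ k) = h ^ k := hfix
  rw [map_pow] at hfix'
  have hh : α h = h := pow_left_injective (by omega : k ≠ 0) hfix'
  have hm : h ∈ Subgroup.zpowers (h ^ k) := by rw [← ht]; exact hh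
  obtain ⟨j, hj⟩ := Subgroup.mem_zpowers_iff.1 hm
  have hne : h ≠ 1 := by rintro rfl; simp at h1
  have e : h ^ ((k : ℤ) * j - 1) = 1 := by
    rw [zpow_sub, zpow_mul, zpow_natCast, hj]; simp
  have h0 : (k : ℤ) * j - 1 ≠ 0 := by
    intro h0
    have : (k : ℤ) ∣ 1 := ⟨j, by linarith⟩
    have := Int.le_of_dvd one_pos this
    omega
  have hcom : ∀ b : FreeGroup (Fin m), Commute h b := fun b => 
    zpow_root_commute h0 (by rw [e]; exact Commute.one_left b)
  rcases Int.natAbs_eq ((k : ℤ) * j - 1) with e' | e'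
  · rw [e', zpow_natCast] at e
    exact hne ((pow_eq_one_iff_left (by omega)).1 e)
  · rw [e', zpow_neg, zpow_natCast, inv_eq_one] at e
    exact hne ((pow_eq_one_iff_left (by omega)).1 e)

lemma TT_step (m : ℕ) (hT : ∀ m' < m, TT m') : ∀ (N : ℕ) (φ : MulAut (FreeGroup (Fin m))) (κ : Type) [Fintype κ]
    [Nonempty κ] (b : κ → FreeGroup (Fin m)), Fintype.card κ = N →
    (∀ k l g, b k = g * b l * (φ g)⁻¹ → k = l) → NiceSys (FreeGroup (Fin m)) (fun k => FixA (MulAut.conj (b k) * φ)) := by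
  classical
  intro N
  induction N using Nat.strong_induction_on with
  | _ N ih =>
  intro φ κ _ _ b hN hb
  by_cases hn : NC (fun k => MulAut.conj (b k) * φ)
  · have hα : Fam (fun k => MulAut.conj (b k) * φ) := by
      refine ⟨fun k l => ⟨b k * (b l)⁻¹, ?_⟩, fun k l g hg => hb k l g ?_⟩
      · simp only [map_mul, map_inv]; group
      · obtain ⟨a, -, c, -, hac⟩ := hn k
        apply conj_inj_of_nc hac
        simp only at hg
        have e1 : MulAut.conj g * (MulAut.conj (b l) * φ) * (MulAut.conj g)⁻¹ =
          MulAut.conj g * MulAut.conj (b l) * (φ * MulAut.conj g⁻¹) := by rw [map_inv]; group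
        rw [e1, aut_conj φ, ← mul_assoc] at hg
        have := mul_right_cancel hg
        rw [this, map_mul, map_mul, map_inv φ]
    have := recY (ι := Fin m) (by simpa using hT) _ Set.univ rfl κ _ hα hn (by
      intro k; rw [Fac_univ]; exact le_top)
    refine this.transport ((MulEquiv.subgroupCongr Fac_univ).trans Subgroup.topEquiv) (Equiv.refl _) (fun _ => 1) ?_
    intro k
    rw [cj_one]
    ext x
    rw [Subgroup.mem_map]
    constructor
    · intro hx; exact ⟨⟨x, by rw [Fac_univ]; trivial⟩, hx, rfl⟩
    · rintro ⟨y, hy, rfl⟩; exact hy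
  · unfold NC at hn
    push Not at hn
    obtain ⟨k1, hk1⟩ := hn
    obtain ⟨t, ht⟩ := comm_cyclic _ hk1
    by_cases hu : ∃ k0, k0 ≠ k1
    · obtain ⟨k0, hk0⟩ := hu
      refine NiceSys.R1 k0 k1 hk0 t ht ?_
      haveI : Nonempty {k // k ≠ k1} := ⟨⟨k0, hk0⟩⟩
      refine ih (Fintype.card {k // k ≠ k1}) ?_ φ {k // k ≠ k1} (fun k => b k.1) rfl ?_
      · rw [← hN]; exact Fintype.card_subtype_lt (x := k1) (by simp)
      · intro k l g hg; exact Subtype.ext (hb _ _ g hg)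
    · push Not at hu
      letI : Unique κ := ⟨⟨k1⟩, hu⟩
      refine NiceSys.single fun r R => ?_
      have : FixA (MulAut.conj (b (default : κ)) * φ) = Subgroup.zpowers t := ht
      rw [this]
      by_cases h1 : t = 1
      · subst h1; rw [Subgroup.zpowers_one_eq_bot]; exact Nice.bot R
      · exact Nice.cyc R (npp_gen ht h1)

theorem TT_all (m : ℕ) : TT m := by
  induction m using Nat.strong_induction_on with
  | _ m hT =>
  intro F _ R φ κ _ _ b hb
  obtain ⟨e⟩ := R
  let φ' : MulAut (FreeGroup (Fin m)) := (e.trans φ).trans e.symm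
  have hφ : ∀ x, φ' x = e.symm (φ (e x)) := fun x => rfl
  have := TT_step m hT _ φ' κ (fun k => e.symm (b k)) rfl (by
    intro k l g hg
    refine hb k l (e g) ?_
    have := congrArg e hg
    simpa [hφ] using this)
  refine this.transport e (Equiv.refl _) (fun _ => 1) ?_
  intro k
  rw [cj_one]
  ext x
  rw [Subgroup.mem_map]
  constructor
  · intro hx
    have hx : b k * φ x * (b k)⁻¹ = x := hx
    refine ⟨e.symm x, ?_, by simp⟩
    rw [mem_FixA]
    apply e.injective
    simp [hφ, hx]
  · rintro ⟨y, hy, rfl⟩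
    rw [mem_FixA] at hy ⊢
    have := congrArg e hy
    simpa [hφ] using this

theorem nice_fix (n : ℕ) (φ : MulAut (FreeGroup (Fin n))) : Nice (FreeGroup (Fin n)) (FixA φ) := by
  have h := TT_all n (FreeGroup (Fin n)) ⟨MulEquiv.refl _⟩ φ Unit (fun _ => 1) (fun _ _ _ _ => rfl)
  have := h _ (MonoidHom.id _) (fun _ => 1) n n ⟨MulEquiv.refl _⟩ ⟨MulEquiv.refl _⟩ (by simp) (by
    rw [MonoidHom.range_eq_top.2 (fun x => ⟨x, rfl⟩)]; simp)
  simpa [cj_one] using this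
end MV


namespace MV
open FreeGroup (of)

lemma pos_iff {n : ℕ} {f : Fin n → ℕ} (hf : Monotone f) (j : ℕ) (t : Fin n) :
    (t : ℕ) < (Finset.univ.filter fun t => f t < j).card ↔ f t < j := by
  constructor
  · intro h
    by_contra hc
    have : (Finset.univ.filter fun t => f t < j) ⊆ Finset.Iio t := by
      intro u hu
      rw [Finset.mem_filter] at hu
      rw [Finset.mem_Iio]
      by_contra hut
      have := hf (not_lt.1 hut)
      omega
    have := Finset.card_le_card this
    rw [Fin.card_Iio] at this
    omega
  · intro h
    have : Finset.Iic t ⊆ (Finset.univ.filter fun t => f t < j) := by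
      intro u hu
      rw [Finset.mem_Iic] at hu
      rw [Finset.mem_filter]
      have := hf hu
      exact ⟨Finset.mem_univ _, by omega⟩
    have := Finset.card_le_card this
    rw [Fin.card_Iic] at this
    omega

theorem nice_final {n : ℕ} {K : Subgroup (FreeGroup (Fin n))} (h : Nice (FreeGroup (Fin n)) K) :
    ∃ (x : Fin n → FreeGroup (Fin n)), Function.Bijective (FreeGroup.lift x) ∧
      ∃ (r s : ℕ) (idx : Fin (r + 1) → ℕ) (y : Fin r → FreeGroup (Fin n))
        (z w : Fin s → FreeGroup (Fin n)),
        idx 0 = 0 ∧ StrictMono idx ∧ idx (Fin.last r) + s ≤ n ∧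
        K = Subgroup.closure (Set.range y ∪ Set.range z) ∧
        (∀ j : Fin r,
          (¬ ∃ (h : FreeGroup (Fin n)) (m : ℕ), 2 ≤ m ∧ y j = h ^ m) ∧
          y j ∈ Subgroup.closure
            (x '' {t : Fin n | idx j.castSucc ≤ (t : ℕ) ∧ (t : ℕ) < idx j.succ})) ∧
        (∀ k : Fin s,
          w k ∈ Subgroup.closure (x '' {j | (j : ℕ) < (idx (Fin.last r) + (k : ℕ))}) ∧
          ∃ t : Fin n, (t : ℕ) = idx (Fin.last r) + (k : ℕ) ∧
            z k = (x t)⁻¹ * w k * x t) := by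
  classical
  obtain ⟨X, J, _, _, x, lab, y, w, ht, hb, hK, hy, hw⟩ := h
  have hcard : Fintype.card X = n := Rk.card ⟨MulEquiv.refl _⟩ hb
  let e0 : Fin n ≃ X := (Fintype.equivFinOfCardEq hcard).symm
  let r := Fintype.card J
  let eJ : J ≃ Fin r := Fintype.equivFin J
  let key : X → ℕ := fun k => (lab k).elim (r + ht k) (fun j => (eJ j : ℕ))
  have key_none : ∀ k, lab k = none → key k = r + ht k := fun k hk => by simp [key, hk]
  have key_some : ∀ k j, lab k = some j → key k = eJ j := fun k j hk => by simp [key, hk]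
  have key_lt : ∀ k, key k < r ↔ lab k ≠ none := by
    intro k
    cases hl : lab k with
    | none => simp [key_none k hl]
    | some j => simp [key_some k j hl]
  have key_eq : ∀ k (j : Fin r), key k = j → lab k = some (eJ.symm j) := by
    intro k j hk
    cases hl : lab k with
    | none => rw [key_none k hl] at hk; have := j.2; omega
    | some j' =>
      rw [key_some k j' hl] at hk
      rw [← Fin.ext hk, Equiv.symm_apply_apply]
  let σ : Fin n ≃ X := (Tuple.sort (key ∘ e0)).trans e0
  let f : Fin n → ℕ := fun t => key (σ t)
  have hf : Monotone f := Tuple.monotone_sort (key ∘ e0)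
  let c : ℕ → ℕ := fun j => (Finset.univ.filter fun t => f t < j).card
  have hc : ∀ j (t : Fin n), (t : ℕ) < c j ↔ f t < j := pos_iff hf
  have hcn : ∀ j, c j ≤ n := fun j => by
    have := Finset.card_le_univ (Finset.univ.filter fun t => f t < j)
    simpa using this
  have hblock : ∀ j : Fin r, ∃ t, f t = j := by
    intro j
    by_contra hcon
    push Not at hcon
    have : y (eJ.symm j) = 1 := by
      have h2 := (hy (eJ.symm j)).2
      have : {k | lab k = some (eJ.symm j)} = ∅ := by
        ext k
        simp only [Set.mem_setOf_eq, Set.mem_empty_iff_false, iff_false]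
        intro hk
        refine hcon (σ.symm k) ?_
        show key (σ (σ.symm k)) = _
        rw [Equiv.apply_symm_apply, key_some k _ hk, Equiv.apply_symm_apply]
      rw [this] at h2
      simpa using h2
    refine (hy (eJ.symm j)).1 ⟨1, 2, le_rfl, by simp [this]⟩
  refine ⟨fun t => x (σ t), ?_, r, n - c r, fun j => c j, fun j => y (eJ.symm j),
    fun k => (x (σ ⟨c r + k, by have := k.2; have := hcn r; omega⟩))⁻¹ *
      w (σ ⟨c r + k, by have := k.2; have := hcn r; omega⟩) * x (σ ⟨c r + k, by have := k.2; have := hcn r; omega⟩),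
    fun k => w (σ ⟨c r + k, by have := k.2; have := hcn r; omega⟩), ?_, ?_, ?_, ?_, ?_, ?_⟩
  · have e1 : FreeGroup.lift (fun t => x (σ t)) = (FreeGroup.lift x).comp (FreeGroup.freeGroupCongr σ).toMonoidHom := by
      ext t; simp
    rw [e1]
    exact hb.comp (FreeGroup.freeGroupCongr σ).bijective
  · simp [c]
  · rw [Fin.strictMono_iff_lt_succ]
    intro j
    obtain ⟨t, htj⟩ := hblock j
    have h1 : ¬ (t : ℕ) < c (j : ℕ) := by rw [hc, htj]; omega
    have h2 : (t : ℕ) < c ((j : ℕ) + 1) := by rw [hc, htj]; omega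
    simp only [Fin.val_castSucc, Fin.val_succ]
    omega
  · simp only [Fin.val_last]; have := hcn r; omega
  · rw [hK]
    congr 1
    congr 1
    · ext g
      simp only [Set.mem_range]
      constructor
      · rintro ⟨j, rfl⟩; exact ⟨eJ j, by simp⟩
      · rintro ⟨j, rfl⟩; exact ⟨_, rfl⟩
    · ext g
      simp only [Set.mem_range, Set.mem_setOf_eq]
      constructor
      · rintro ⟨k, hk, rfl⟩
        have h1 : ¬ ((σ.symm k : Fin n) : ℕ) < c r := by
          rw [hc]; show ¬ key (σ (σ.symm k)) < r
          rw [Equiv.apply_symm_apply, key_lt]; simpa using hk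
        have h2 := (σ.symm k).2
        refine ⟨⟨(σ.symm k : ℕ) - c r, by omega⟩, ?_⟩
        have : (⟨c r + ((σ.symm k : ℕ) - c r), by omega⟩ : Fin n) = σ.symm k := Fin.ext (by simp only; omega)
        simp only [this, Equiv.apply_symm_apply]
      · rintro ⟨k, rfl⟩
        refine ⟨_, ?_, rfl⟩
        by_contra hne
        rw [← ne_eq, ← key_lt] at hne
        have := (hc r _).2 hne
        simp only at this
        omega
  · intro j
    refine ⟨(hy _).1, ?_⟩
    refine Subgroup.closure_mono ?_ (hy (eJ.symm j)).2
    rintro _ ⟨k, hk, rfl⟩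
    have hkey : f (σ.symm k) = j := by
      show key (σ (σ.symm k)) = _
      rw [Equiv.apply_symm_apply, key_some k _ hk, Equiv.apply_symm_apply]
    refine ⟨σ.symm k, ⟨?_, ?_⟩, by simp⟩
    · simp only [Fin.val_castSucc]
      rw [← not_lt, hc, hkey]; omega
    · simp only [Fin.val_succ]
      rw [hc, hkey]; omega
  · intro k
    have hlt : c r + (k : ℕ) < n := by have := k.2; have := hcn r; omega
    refine ⟨?_, ⟨c r + k, hlt⟩, by simp, rfl⟩
    have hnone : lab (σ ⟨c r + k, hlt⟩) = none := by
      by_contra hne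
      rw [← ne_eq, ← key_lt] at hne
      have := (hc r _).2 hne
      simp only at this
      omega
    refine Subgroup.closure_mono ?_ (hw _ hnone)
    rintro _ ⟨k', hk', rfl⟩
    refine ⟨σ.symm k', ?_, by simp⟩
    simp only [Fin.val_last, Set.mem_setOf_eq]
    have hkk : f (σ.symm k') < f ⟨c r + k, hlt⟩ := by
      show key (σ (σ.symm k')) < key _
      rw [Equiv.apply_symm_apply, key_none _ hnone]
      rcases hk' with h | h
      · rw [← key_lt] at h; omega
      · cases hl : lab k' with
        | none => rw [key_none _ hl]; omega
        | some j =>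
          have := (key_lt k').2 (by simp [hl])
          omega
    have := hf.reflect_lt hkk
    exact this
end MV


end MVProof

/-- (Martino–Ventura) Structure of the fixed subgroup of an automorphism of `F_n`:
there are an ordered free basis `x_1, …, x_n` of `F_n`, indices
`0 = i_0 < i_1 < ⋯ < i_r` with `i_r + s ≤ n`, and elements `y_1, …, y_r`,
`z_1, …, z_s` generating `Fix φ`, where each `y_j` is not a proper power and
`y_j ∈ ⟨x_{i_{j-1}+1}, …, x_{i_j}⟩`, and `z_k = x_{i_r+k}⁻¹ w_k x_{i_r+k}` with
`w_k ∈ ⟨x_1, …, x_{i_r+k-1}⟩`. -/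
theorem fixedSubgroup_structure (n : ℕ) (φ : FreeGroup (Fin n) ≃* FreeGroup (Fin n)) :
    ∃ (x : Fin n → FreeGroup (Fin n)), IsOrderedBasis x ∧
      ∃ (r s : ℕ) (idx : Fin (r + 1) → ℕ) (y : Fin r → FreeGroup (Fin n))
        (z w : Fin s → FreeGroup (Fin n)),
        idx 0 = 0 ∧ StrictMono idx ∧ idx (Fin.last r) + s ≤ n ∧
        fixedSubgroup φ.toMonoidHom = Subgroup.closure (Set.range y ∪ Set.range z) ∧
        (∀ j : Fin r,
          (¬ ∃ (h : FreeGroup (Fin n)) (m : ℕ), 2 ≤ m ∧ y j = h ^ m) ∧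
          y j ∈ Subgroup.closure
            (x '' {t : Fin n | idx j.castSucc ≤ (t : ℕ) ∧ (t : ℕ) < idx j.succ})) ∧
        (∀ k : Fin s,
          w k ∈ stage x (idx (Fin.last r) + (k : ℕ)) ∧
          ∃ t : Fin n, (t : ℕ) = idx (Fin.last r) + (k : ℕ) ∧
            z k = (x t)⁻¹ * w k * x t) := by
  exact MV.nice_final (MV.nice_fix n φ)
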